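/- arXiv:math/0604487 — 2 statements merged into one kernel-verified Lean document; each statement's English description precedes it below -/
import Mathlib

section
/- Let {G_n} be bounded simply connected domains with B(0,r) ⊆ G_n ⊆ B(0,R) for fixed 0 < r < R < ∞, such that the complements ℂ∖G_n are uniformly locally connected. Let φ_n map 𝔻 conformally onto G_n with φ_n(0) = 0. If φ_n(z) → φ(z) pointwise for each z ∈ 𝔻, then φ_n → φ uniformly on the closed disc 𝔻̄. -/
/-- A sequence of closed sets `A n ⊆ ℂ` is uniformly locally connected if for every
`ε > 0` there is `δ > 0`, independent of `n`, such that any two points of `A n` at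
distance less than `δ` can be joined by a continuum in `A n` of diameter less than `ε`. -/
def UnifLocallyConnected (A : ℕ → Set ℂ) : Prop :=
  ∀ ε : ℝ, 0 < ε → ∃ δ : ℝ, 0 < δ ∧ ∀ n : ℕ, ∀ a ∈ A n, ∀ b ∈ A n,
    dist a b < δ → ∃ B : Set ℂ, B ⊆ A n ∧ a ∈ B ∧ b ∈ B ∧
      IsCompact B ∧ IsConnected B ∧ Metric.diam B < ε

section Helpers
open Set Metric Filter Topology

/-- Two continuous logarithms of the same function differ by a constant on a connected set. -/
lemma log_diff_const {X : Type*} [TopologicalSpace X] {S : Set X} (hS : IsPreconnected S)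
    {L₁ L₂ : X → ℂ} (h₁ : ContinuousOn L₁ S) (h₂ : ContinuousOn L₂ S)
    (h : ∀ x ∈ S, Complex.exp (L₁ x) = Complex.exp (L₂ x)) {x y : X} (hx : x ∈ S) (hy : y ∈ S) :
    L₁ x - L₂ x = L₁ y - L₂ y := by
  have hpi : (2 * Real.pi * Complex.I : ℂ) ≠ 0 := Complex.two_pi_I_ne_zero
  let f : X → ℂ := fun x => (L₁ x - L₂ x) / (2 * Real.pi * Complex.I)
  have hf : ContinuousOn f S := (h₁.sub h₂).div_const _
  have hm : ∀ x ∈ S, ∃ n : ℤ, f x = n := by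
    intro x hx
    obtain ⟨n, hn⟩ := Complex.exp_eq_exp_iff_exists_int.1 (h x hx)
    refine ⟨n, ?_⟩
    simp only [f]
    rw [hn, add_sub_cancel_left, mul_div_assoc, div_self hpi, mul_one]
  have hdisc : IsDiscrete (range ((↑) : ℤ → ℂ)) := by
    rw [isDiscrete_iff_discreteTopology]
    exact (Complex.isClosedEmbedding_intCast.isEmbedding.toHomeomorph.symm).isEmbedding.discreteTopology
  have := hS.constant_of_mapsTo hdisc hf (fun x hx => by
    obtain ⟨n, hn⟩ := hm x hx; exact ⟨n, hn.symm⟩) hx hy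
  simp only [f] at this
  field_simp at this
  exact this

/-- A nonvanishing continuous function on a convex body has a continuous logarithm. -/
lemma exists_log_convex {K : Set ℂ} (hK : Convex ℝ K) (hKc : IsClosed K) (h0 : K ∈ 𝓝 (0:ℂ))
    {g : ℂ → ℂ} (hg : ContinuousOn g K) (hg0 : ∀ z ∈ K, g z ≠ 0) :
    ∃ L : ℂ → ℂ, ContinuousOn L K ∧ ∀ z ∈ K, Complex.exp (L z) = g z := by
  let ρ : ℂ → ℂ := fun z => (max 1 (gauge K z))⁻¹ • z
  have hgc : Continuous (gauge K) := continuous_gauge hK h0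
  have hpos : ∀ z, (0:ℝ) < max 1 (gauge K z) := fun z => lt_max_of_lt_left one_pos
  have hρ : Continuous ρ :=
    ((continuous_const.max hgc).inv₀ (fun z => (hpos z).ne')).smul continuous_id
  have hmem : ∀ z, ρ z ∈ K := by
    intro z
    rw [← hKc.closure_eq, ← gauge_le_one_iff_mem_closure hK h0]
    simp only [ρ]
    rw [gauge_smul_of_nonneg (inv_nonneg.2 (hpos z).le), smul_eq_mul, inv_mul_le_iff₀ (hpos z), mul_one]
    exact le_max_right _ _
  have hid : ∀ z ∈ K, ρ z = z := by
    intro z hz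
    have : gauge K z ≤ 1 := gauge_le_one_of_mem hz
    simp [ρ, max_eq_left this]
  have hsc : IsSimplyConnected (univ : Set ℂ) := by
    have := (convex_univ (𝕜 := ℝ) (E := ℂ)).contractibleSpace ⟨0, trivial⟩
    exact inferInstanceAs (SimplyConnectedSpace (univ : Set ℂ))
  obtain ⟨L, hL, hLe⟩ := Complex.exists_continuousOn_eqOn_exp_comp (U := (univ : Set ℂ))
    (g := g ∘ ρ) hsc isOpen_univ
    ((hg.comp_continuous hρ hmem).continuousOn) (by
      rintro ⟨z, -, hz⟩; exact hg0 _ (hmem z) hz)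
  refine ⟨L, hL.mono (subset_univ _), fun z hz => ?_⟩
  have := hLe (mem_univ z)
  simpa [hid z hz] using this

lemma no_log_pow_circle {k : ℕ} (hk : k ≠ 0) {L : ℂ → ℂ} (hL : ContinuousOn L (sphere 0 1))
    (h : ∀ z ∈ sphere (0:ℂ) 1, Complex.exp (L z) = z ^ k) : False := by
  let γ : ℝ → ℂ := fun θ => Complex.exp (θ * Complex.I)
  have hγ : Continuous γ := by fun_prop
  have hγm : ∀ θ, γ θ ∈ sphere (0:ℂ) 1 := fun θ => by simp [γ, Complex.norm_exp_ofReal_mul_I]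
  have := log_diff_const (S := (univ : Set ℝ)) isPreconnected_univ
    (L₁ := fun θ => L (γ θ)) (L₂ := fun θ => k * (θ * Complex.I))
    (hL.comp_continuous hγ hγm).continuousOn (by fun_prop)
    (fun θ _ => by rw [h _ (hγm θ), Complex.exp_nat_mul]) (mem_univ 0) (mem_univ (2 * Real.pi))
  have e : γ (2 * Real.pi) = γ 0 := by simp [γ, Complex.exp_two_pi_mul_I]
  simp only [e] at this
  have hh : (k:ℂ) * (2 * Real.pi * Complex.I) = 0 := by
    push_cast at this
    linear_combination this
  rcases mul_eq_zero.1 hh with h' | h'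
  · exact hk (by exact_mod_cast h')
  · exact Complex.two_pi_I_ne_zero h'

lemma no_log_pow_frontier {K : Set ℂ} (hK : Convex ℝ K) (hb : Bornology.IsBounded K)
    (h0 : K ∈ 𝓝 (0:ℂ)) {k : ℕ} (hk : k ≠ 0) {L : ℂ → ℂ} (hL : ContinuousOn L (frontier K))
    (h : ∀ z ∈ frontier K, Complex.exp (L z) = z ^ k) : False := by
  have hgc : Continuous (gauge K) := continuous_gauge hK h0
  have hgp : ∀ u ∈ sphere (0:ℂ) 1, 0 < gauge K u := by
    intro u hu
    refine (gauge_pos (absorbent_nhds_zero h0) ?_).2 ?_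
    · exact (NormedSpace.isVonNBounded_iff ℝ).2 hb
    · rintro rfl; simp at hu
  let σ : ℂ → ℂ := fun u => (gauge K u)⁻¹ • u
  have hσ : ContinuousOn σ (sphere 0 1) :=
    (hgc.continuousOn.inv₀ (fun u hu => (hgp u hu).ne')).smul continuousOn_id
  have hσm : MapsTo σ (sphere 0 1) (frontier K) := by
    intro u hu
    rw [← gauge_eq_one_iff_mem_frontier hK h0]
    simp only [σ]
    rw [gauge_smul_of_nonneg (inv_nonneg.2 (hgp u hu).le), smul_eq_mul, inv_mul_cancel₀ (hgp u hu).ne']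
  refine no_log_pow_circle hk (L := fun u => L (σ u) + ((k * Real.log (gauge K u) : ℝ) : ℂ)) ?_ ?_
  · refine (hL.comp hσ hσm).add (Complex.continuous_ofReal.comp_continuousOn ?_)
    exact continuousOn_const.mul (hgc.continuousOn.log (fun u hu => (hgp u hu).ne'))
  · intro u hu
    have hp := hgp u hu
    rw [Complex.exp_add, h _ (hσm hu), ← Complex.ofReal_exp, Real.exp_nat_mul, Real.exp_log hp]
    simp only [σ, Complex.real_smul]
    push_cast
    rw [← mul_pow]
    congr 1
    have : (gauge K u : ℂ) ≠ 0 := by exact_mod_cast hp.ne'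
    field_simp

/-- Argument principle surrogate. -/
lemma no_log_of_zero {K : Set ℂ} (hK : Convex ℝ K) (hKc : IsClosed K) (hb : Bornology.IsBounded K)
    (h0 : K ∈ 𝓝 (0:ℂ)) {F : ℂ → ℂ} (hF : ContinuousOn F K) (hFa : AnalyticAt ℂ F 0)
    (hF0 : F 0 = 0) (hFn : ∀ z ∈ K, z ≠ 0 → F z ≠ 0)
    {L : ℂ → ℂ} (hL : ContinuousOn L (frontier K))
    (h : ∀ z ∈ frontier K, Complex.exp (L z) = F z) : False := by
  have hne : ¬ ∀ᶠ z in 𝓝 (0:ℂ), F z = 0 := by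
    intro hev
    have h1 : ∀ᶠ z in 𝓝[≠] (0:ℂ), F z = 0 ∧ z ∈ K ∧ z ≠ 0 := by
      filter_upwards [nhdsWithin_le_nhds hev, nhdsWithin_le_nhds h0, self_mem_nhdsWithin] with z a b c
      exact ⟨a, b, c⟩
    obtain ⟨z, a, b, c⟩ := h1.exists
    exact hFn z b c a
  obtain ⟨k, g, hga, hg0, hge⟩ := hFa.exists_eventuallyEq_pow_smul_nonzero_iff.2 hne
  have hk : k ≠ 0 := by
    rintro rfl
    have := hge.self_of_nhds
    simp [hF0] at this
    exact hg0 this.symm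
  classical
  let H : ℂ → ℂ := fun z => if z = 0 then g 0 else F z / z ^ k
  have hHg : H =ᶠ[𝓝 0] g := by
    filter_upwards [hge] with z hz
    by_cases hz0 : z = 0
    · simp [H, hz0]
    · simp only [H, hz0, if_false, hz, sub_zero, smul_eq_mul]
      field_simp
  have hHc : ContinuousOn H K := by
    intro z hz
    by_cases hz0 : z = 0
    · subst hz0
      exact (hga.continuousAt.congr hHg.symm).continuousWithinAt
    · have : ContinuousWithinAt (fun z => F z / z ^ k) K z :=
        (hF z hz).div (by fun_prop) (pow_ne_zero _ hz0)
      refine this.congr_of_eventuallyEq ?_ (by simp [H, hz0])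
      filter_upwards [nhdsWithin_le_nhds (isOpen_ne.mem_nhds hz0)] with w hw
      have : w ≠ 0 := hw
      simp [H, this]
  have hHn : ∀ z ∈ K, H z ≠ 0 := by
    intro z hz
    by_cases hz0 : z = 0
    · simpa [H, hz0] using hg0
    · simp only [H, hz0, if_false]
      exact div_ne_zero (hFn z hz hz0) (pow_ne_zero _ hz0)
  obtain ⟨M, hM, hMe⟩ := exists_log_convex hK hKc h0 hHc hHn
  have hfs : frontier K ⊆ K := hKc.frontier_subset
  refine no_log_pow_frontier hK hb h0 hk (L := fun z => L z - M z) (hL.sub (hM.mono hfs)) ?_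
  intro z hz
  have hz0 : z ≠ 0 := by
    rintro rfl
    exact hz.2 (mem_interior_iff_mem_nhds.2 h0)
  rw [Complex.exp_sub, h z hz, hMe z (hfs hz)]
  simp only [H, hz0, if_false]
  have := hFn z (hfs hz) hz0
  field_simp

/-- log of a quotient on the complement of a connected open set. -/
lemma exists_log_compl {G : Set ℂ} (hGo : IsOpen G) (hGc : IsPreconnected G) {u v : ℂ}
    (hu : u ∈ G) (hv : v ∈ G) : ∃ L : ℂ → ℂ, ContinuousOn L Gᶜ ∧
      ∀ w ∈ Gᶜ, Complex.exp (L w) = (w - u) / (w - v) := by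
  have hne : ∀ u ∈ G, ∀ w ∈ Gᶜ, w - u ≠ 0 := by
    intro u hu w hw h
    exact hw (by rwa [sub_eq_zero.1 h])
  refine hGc.induction₂ (fun u v => ∃ L : ℂ → ℂ, ContinuousOn L Gᶜ ∧
      ∀ w ∈ Gᶜ, Complex.exp (L w) = (w - u) / (w - v)) ?_ ?_ ?_ hu hv
  · intro u hu
    obtain ⟨s, hs, hsG⟩ := Metric.isOpen_iff.1 hGo u hu
    have : ball u s ∈ 𝓝[G] u := nhdsWithin_le_nhds (ball_mem_nhds u hs)
    filter_upwards [this, self_mem_nhdsWithin] with v hv hvG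
    have hsl : ∀ w ∈ Gᶜ, (w - v) / (w - u) ∈ Complex.slitPlane := by
      intro w hw
      · have e : (w - v) / (w - u) = 1 + (u - v) / (w - u) := by
          have := hne u hu w hw
          field_simp
          ring
        rw [e]
        apply Complex.mem_slitPlane_of_norm_lt_one
        rw [norm_div]
        have h1 : s ≤ ‖w - u‖ := by
          by_contra hlt
          push Not at hlt
          exact hw (hsG (by rwa [mem_ball, dist_eq_norm]))
        have h2 : ‖u - v‖ < s := by
          rw [mem_ball, dist_comm, dist_eq_norm] at hv
          exact hv
        rw [div_lt_one (by linarith)]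
        linarith
    refine ⟨fun w => - Complex.log ((w - v) / (w - u)), ?_, ?_⟩
    · refine (ContinuousOn.clog ?_ hsl).neg
      exact ContinuousOn.div (by fun_prop) (by fun_prop) (hne u hu)
    · intro w hw
      rw [Complex.exp_neg, Complex.exp_log (Complex.slitPlane_ne_zero (hsl w hw)), inv_div]
  · rintro x y z hx hy hz ⟨L, hL, hLe⟩ ⟨M, hM, hMe⟩
    refine ⟨fun w => L w + M w, hL.add hM, fun w hw => ?_⟩
    rw [Complex.exp_add, hLe w hw, hMe w hw]
    have := hne y hy w hw
    have := hne z hz w hw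
    field_simp
  · rintro x y hx hy ⟨L, hL, hLe⟩
    refine ⟨fun w => - L w, hL.neg, fun w hw => ?_⟩
    rw [Complex.exp_neg, hLe w hw, inv_div]

/-- log of a quotient on a ball avoiding the two points. -/
lemma exists_log_ball {a u v : ℂ} {ε : ℝ} (hu : ε ≤ dist u a) (hv : ε ≤ dist v a) :
    ∃ L : ℂ → ℂ, ContinuousOn L (ball a ε) ∧
      ∀ w ∈ ball a ε, Complex.exp (L w) = (w - u) / (w - v) := by
  rcases le_or_gt ε 0 with hε | hε
  · refine ⟨0, ?_, ?_⟩ <;> simp [ball_eq_empty.2 hε]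
  have key : ∀ u : ℂ, ε ≤ dist u a → ∃ L : ℂ → ℂ, ContinuousOn L (ball a ε) ∧
      ∀ w ∈ ball a ε, Complex.exp (L w) = (w - u) := by
    intro u hu
    rw [dist_comm, dist_eq_norm] at hu
    have h0 : a - u ≠ 0 := norm_pos_iff.1 (by linarith)
    have hsl : ∀ w ∈ ball a ε, (w - u) / (a - u) ∈ Complex.slitPlane := by
      intro w hw
      have e : (w - u) / (a - u) = 1 + (w - a) / (a - u) := by
        field_simp
        ring
      rw [e]
      apply Complex.mem_slitPlane_of_norm_lt_one
      rw [norm_div, div_lt_one (by linarith)]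
      rw [mem_ball, dist_eq_norm] at hw
      linarith
    refine ⟨fun w => Complex.log ((w - u) / (a - u)) + Complex.log (a - u), ?_, ?_⟩
    · exact (ContinuousOn.clog (by fun_prop) hsl).add continuousOn_const
    · intro w hw
      rw [Complex.exp_add, Complex.exp_log (Complex.slitPlane_ne_zero (hsl w hw)),
        Complex.exp_log h0]
      field_simp
  obtain ⟨L, hL, hLe⟩ := key u hu
  obtain ⟨M, hM, hMe⟩ := key v hv
  exact ⟨fun w => L w - M w, hL.sub hM, fun w hw => by rw [Complex.exp_sub, hLe w hw, hMe w hw]⟩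


lemma separation {G : Set ℂ} (hGo : IsOpen G) (hGc : IsPreconnected G) {r ε δ ρ : ℝ}
    (hrG : ball 0 r ⊆ G) (hεr : ε ≤ r) (hr : 0 < r) {Φ : ℂ → ℂ}
    (hΦc : ContinuousOn Φ (closedBall 0 1)) (hΦd : DifferentiableOn ℂ Φ (ball 0 1))
    (hΦb : BijOn Φ (ball 0 1) G) (hΦ0 : Φ 0 = 0) (hbd : ∀ z ∈ sphere (0:ℂ) 1, Φ z ∈ Gᶜ)
    (hρ1 : ρ < 1) {p : ℂ} (hp0 : p ∈ sphere (0:ℂ) 1)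
    (hp1 : p ∈ sphere (1:ℂ) ρ)
    (hAδ : ∀ z ∈ closedBall (0:ℂ) 1, z ∈ sphere (1:ℂ) ρ → dist (Φ z) (Φ p) < δ)
    (hAε : ∀ z ∈ closedBall (0:ℂ) 1, z ∈ sphere (1:ℂ) ρ → dist (Φ z) (Φ p) < ε)
    (hB : ∀ b ∈ Gᶜ, dist (Φ p) b < δ → ∃ B : Set ℂ, B ⊆ Gᶜ ∧ Φ p ∈ B ∧ b ∈ B ∧
      IsCompact B ∧ IsConnected B ∧ Metric.diam B < ε)
    {z₁ : ℂ} (hz0 : z₁ ∈ ball (0:ℂ) 1) (hz1 : z₁ ∈ ball (1:ℂ) ρ) :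
    dist (Φ z₁) (Φ p) < ε := by
  by_contra! hcon
  have h0G : (0:ℂ) ∈ G := hrG (by simpa using hr)
  have hv : ε ≤ dist 0 (Φ p) := by
    by_contra! hlt
    refine hbd p hp0 (hrG ?_)
    rw [mem_ball, dist_comm]
    linarith
  have hw1 : Φ z₁ ∈ G := hΦb.mapsTo hz0
  obtain ⟨L₁, hL₁, hL₁e⟩ := exists_log_ball hcon hv
  obtain ⟨L₂, hL₂, hL₂e⟩ := exists_log_compl hGo hGc hw1 h0G
  set V : Set ℂ := closedBall 0 1 ∩ closedBall 1 ρ with hV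
  let τ : ℂ → ℂ := fun x => z₁ + x
  have hτ : Continuous τ := by fun_prop
  let K : Set ℂ := τ ⁻¹' V
  have hVc : Convex ℝ V := (convex_closedBall _ _).inter (convex_closedBall _ _)
  have hK : Convex ℝ K := hVc.translate_preimage_right z₁
  have hKc : IsClosed K := (isClosed_closedBall.inter isClosed_closedBall).preimage hτ
  have hKb : Bornology.IsBounded K := by
    refine (isBounded_closedBall (x := (0:ℂ)) (r := 2)).subset ?_
    rintro x ⟨hx, -⟩
    rw [mem_closedBall_zero_iff] at hx ⊢
    rw [mem_ball_zero_iff] at hz0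
    have : x = τ x - z₁ := by simp [τ]
    rw [this]
    refine (norm_sub_le _ _).trans ?_
    linarith
  have hKo : τ ⁻¹' (ball 0 1 ∩ ball 1 ρ) ⊆ interior K :=
    interior_maximal (preimage_mono (inter_subset_inter ball_subset_closedBall
      ball_subset_closedBall)) ((isOpen_ball.inter isOpen_ball).preimage hτ)
  have h0K : K ∈ 𝓝 (0:ℂ) := by
    rw [← mem_interior_iff_mem_nhds]
    exact hKo (by simpa [τ] using And.intro hz0 hz1)
  have hτK : MapsTo τ K (closedBall 0 1) := fun x hx => hx.1
  have hΦτ : ContinuousOn (fun x => Φ (τ x)) K := hΦc.comp hτ.continuousOn hτK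
  have hinj : ∀ z ∈ closedBall (0:ℂ) 1, ∀ z' ∈ ball (0:ℂ) 1, Φ z = Φ z' → z = z' := by
    intro z hz z' hz' he
    rcases eq_or_lt_of_le (mem_closedBall.1 hz) with h | h
    · exact absurd (hΦb.mapsTo hz') (he ▸ hbd z h)
    · exact hΦb.injOn h hz' he
  have hΦne : ∀ x ∈ K, Φ (τ x) ≠ 0 := by
    intro x hx h
    have := hinj _ hx.1 0 (by simp) (by rw [h, hΦ0])
    have h2 := hx.2
    rw [this, mem_closedBall] at h2
    simp at h2
    linarith
  let F : ℂ → ℂ := fun x => (Φ (τ x) - Φ z₁) / (Φ (τ x) - 0)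
  have hFc : ContinuousOn F K :=
    (hΦτ.sub continuousOn_const).div (hΦτ.sub continuousOn_const) (by simpa using hΦne)
  have hFa : AnalyticAt ℂ F 0 := by
    have h1 : AnalyticAt ℂ Φ (τ 0) :=
      hΦd.analyticAt (isOpen_ball.mem_nhds (by simpa [τ] using hz0))
    have h2 : AnalyticAt ℂ τ 0 := analyticAt_const.add analyticAt_id
    have h3 : AnalyticAt ℂ (fun x => Φ (τ x)) 0 := h1.comp h2
    refine (h3.sub analyticAt_const).div (h3.sub analyticAt_const) ?_
    simpa using hΦne 0 (mem_of_mem_nhds h0K)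
  have hF0 : F 0 = 0 := by simp [F, τ]
  have hFn : ∀ x ∈ K, x ≠ 0 → F x ≠ 0 := by
    intro x hx hx0
    refine div_ne_zero ?_ (by simpa using hΦne x hx)
    intro h
    have := hinj _ hx.1 z₁ hz0 (sub_eq_zero.1 h)
    exact hx0 (by simpa [τ] using this)
  -- the two boundary arcs
  let S₁ : Set ℂ := τ ⁻¹' (closedBall 0 1 ∩ sphere 1 ρ)
  let S₂ : Set ℂ := τ ⁻¹' (sphere 0 1 ∩ closedBall 1 ρ)
  have hS₁ : IsClosed S₁ := (isClosed_closedBall.inter isClosed_sphere).preimage hτ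
  have hS₂ : IsClosed S₂ := (isClosed_sphere.inter isClosed_closedBall).preimage hτ
  have hfr : frontier K ⊆ S₁ ∪ S₂ := by
    intro x hx
    have hxK : x ∈ K := hKc.frontier_subset hx
    have hxi : ¬ (τ x ∈ ball (0:ℂ) 1 ∧ τ x ∈ ball (1:ℂ) ρ) := fun h => hx.2 (hKo h)
    rcases eq_or_lt_of_le (mem_closedBall.1 hxK.1) with h | h
    · exact Or.inr ⟨h, hxK.2⟩
    · rcases eq_or_lt_of_le (mem_closedBall.1 hxK.2) with h' | h'
      · exact Or.inl ⟨hxK.1, h'⟩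
      · exact absurd ⟨h, h'⟩ hxi
  have hm₁ : MapsTo (fun x => Φ (τ x)) S₁ (ball (Φ p) ε) := fun x hx => hAε _ hx.1 hx.2
  have hm₂ : MapsTo (fun x => Φ (τ x)) S₂ Gᶜ := fun x hx => hbd _ hx.1
  have hc₁ : ContinuousOn (fun x => L₁ (Φ (τ x))) S₁ :=
    hL₁.comp (hΦτ.mono (fun x hx => ⟨hx.1, sphere_subset_closedBall hx.2⟩)) hm₁
  have hc₂ : ContinuousOn (fun x => L₂ (Φ (τ x))) S₂ :=
    hL₂.comp (hΦτ.mono (fun x hx => ⟨sphere_subset_closedBall hx.1, hx.2⟩)) hm₂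
  let c : ℂ := L₁ (Φ p) - L₂ (Φ p)
  have hpG : Φ p ∈ Gᶜ := hbd p hp0
  have hglue : ∀ x ∈ S₁, x ∈ S₂ → L₁ (Φ (τ x)) = L₂ (Φ (τ x)) + c := by
    intro x hx₁ hx₂
    obtain ⟨B, hBG, hpB, hxB, hBc, hBconn, hBd⟩ := hB (Φ (τ x)) (hm₂ hx₂)
      (by rw [dist_comm]; exact hAδ _ hx₁.1 hx₁.2)
    have hBb : B ⊆ ball (Φ p) ε := fun y hy =>
      (dist_le_diam_of_mem hBc.isBounded hy hpB).trans_lt hBd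
    have := log_diff_const hBconn.isPreconnected (hL₁.mono hBb) (hL₂.mono hBG)
      (fun y hy => by rw [hL₁e y (hBb hy), hL₂e y (hBG hy)]) hxB hpB
    simp only [c]
    linear_combination this
  have hc1 : Complex.exp c = 1 := by
    have hpb : Φ p ∈ ball (Φ p) ε := hAε p (sphere_subset_closedBall hp0) hp1
    have hne : Complex.exp (L₂ (Φ p)) ≠ 0 := Complex.exp_ne_zero _
    rw [Complex.exp_sub, hL₁e _ hpb, ← hL₂e _ hpG, div_self hne]
  classical
  let L : ℂ → ℂ := fun x => if x ∈ S₁ then L₁ (Φ (τ x)) else L₂ (Φ (τ x)) + c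
  have hLe₁ : EqOn L (fun x => L₁ (Φ (τ x))) S₁ := fun x hx => by simp [L, hx]
  have hLe₂ : EqOn L (fun x => L₂ (Φ (τ x)) + c) S₂ := fun x hx => by
    by_cases h : x ∈ S₁
    · simp only [L, h, if_true]; exact hglue x h hx
    · simp [L, h]
  have hLc : ContinuousOn L (S₁ ∪ S₂) :=
    (hc₁.congr hLe₁).union_of_isClosed ((hc₂.add continuousOn_const).congr hLe₂) hS₁ hS₂
  refine no_log_of_zero hK hKc hKb h0K hFc hFa hF0 hFn (hLc.mono hfr) (fun x hx => ?_)
  rcases hfr hx with h | h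
  · rw [hLe₁ h]
    exact hL₁e _ (hm₁ h)
  · rw [hLe₂ h]
    simp only
    rw [Complex.exp_add, hc1, mul_one]
    exact hL₂e _ (hm₂ h)

lemma area_bound {G : Set ℂ} {R : ℝ} (hR : G ⊆ ball 0 R) {Φ : ℂ → ℂ}
    (hΦd : DifferentiableOn ℂ Φ (ball 0 1)) (hΦb : BijOn Φ (ball 0 1) G) :
    ∫⁻ z in ball (0:ℂ) 1, ‖deriv Φ z‖ₑ ^ 2 ≤ ENNReal.ofReal R ^ 2 * NNReal.pi := by
  have h1 := MeasureTheory.lintegral_image_eq_lintegral_abs_det_fderiv_mul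
    (MeasureTheory.volume : MeasureTheory.Measure ℂ) (s := ball (0:ℂ) 1) measurableSet_ball
    (f := Φ) (f' := fun z => (ContinuousLinearMap.toSpanSingleton ℂ (deriv Φ z)).restrictScalars ℝ)
    (fun z hz => ((hΦd.differentiableAt (isOpen_ball.mem_nhds hz)).hasDerivAt.hasFDerivAt
      |>.restrictScalars ℝ).hasFDerivWithinAt) hΦb.injOn (fun _ => 1)
  have hdet : ∀ z, ENNReal.ofReal |((ContinuousLinearMap.toSpanSingleton ℂ (deriv Φ z)).restrictScalars ℝ).det|
      = ‖deriv Φ z‖ₑ ^ 2 := by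
    intro z
    have : ((ContinuousLinearMap.toSpanSingleton ℂ (deriv Φ z)).restrictScalars ℝ).det
        = ‖deriv Φ z‖ ^ 2 := by
      simp [ContinuousLinearMap.det, LinearMap.det_restrictScalars, Algebra.norm_complex_apply,
        Complex.normSq_eq_norm_sq]
    rw [this, abs_of_nonneg (by positivity), ENNReal.ofReal_pow (norm_nonneg _), ofReal_norm]
  simp only [hdet, mul_one, MeasureTheory.lintegral_const, one_mul,
    MeasureTheory.Measure.restrict_apply MeasurableSet.univ, univ_inter] at h1
  rw [← h1, hΦb.image_eq]
  refine (MeasureTheory.measure_mono hR).trans ?_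
  rw [Complex.volume_ball]

lemma normSq_arc (ρ t : ℝ) :
    ‖(1:ℂ) - ρ * Complex.exp (t * Complex.I)‖ ^ 2 = 1 - 2 * ρ * Real.cos t + ρ ^ 2 := by
  rw [← Complex.normSq_eq_norm_sq, Complex.normSq_apply, Complex.exp_mul_I, ← Complex.ofReal_cos,
    ← Complex.ofReal_sin]
  simp [-Complex.ofReal_cos, -Complex.ofReal_sin]
  have := Real.sin_sq_add_cos_sq t
  linear_combination (ρ ^ 2) * this

lemma arc_bound {Φ : ℂ → ℂ} (hΦc : ContinuousOn Φ (closedBall 0 1))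
    (hΦd : DifferentiableOn ℂ Φ (ball 0 1)) {ρ η : ℝ} (hρ : 0 < ρ) (hη : 0 < η)
    (hJ : ENNReal.ofReal (ρ ^ 2 * (2 * Real.pi)) *
      ∫⁻ θ in Ioo (-Real.pi) Real.pi, (ball (0:ℂ) 1).indicator (fun z => ‖deriv Φ z‖ₑ ^ 2)
        (1 - ρ * Complex.exp (θ * Complex.I)) ≤ ENNReal.ofReal (η ^ 2))
    {z z' : ℂ} (hz : z ∈ closedBall (0:ℂ) 1) (hzρ : z ∈ sphere (1:ℂ) ρ)
    (hz' : z' ∈ closedBall (0:ℂ) 1) (hzρ' : z' ∈ sphere (1:ℂ) ρ) :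
    dist (Φ z) (Φ z') ≤ η := by
  have hpar : ∀ z ∈ sphere (1:ℂ) ρ, z = 1 - ρ * Complex.exp ((1 - z).arg * Complex.I) := by
    intro z hz
    have h1 := Complex.norm_mul_exp_arg_mul_I (1 - z)
    have h2 : ‖1 - z‖ = ρ := by
      rw [mem_sphere, dist_comm, dist_eq_norm] at hz; exact hz
    rw [h2] at h1
    rw [h1]; ring
  wlog hle : (1 - z).arg ≤ (1 - z').arg generalizing z z'
  · rw [dist_comm]
    exact this hz' hzρ' hz hzρ (le_of_not_ge hle)
  set a := (1 - z).arg with ha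
  set b := (1 - z').arg with hb
  have ea := hpar z hzρ
  have eb := hpar z' hzρ'
  rw [← ha] at ea
  rw [← hb] at eb
  have hapi : -Real.pi < a := Complex.neg_pi_lt_arg _
  have hbpi : b ≤ Real.pi := Complex.arg_le_pi _
  let γ : ℝ → ℂ := fun t => 1 - ρ * Complex.exp (t * Complex.I)
  have hγc : Continuous γ := by fun_prop
  have hcos : ∀ t, γ t ∈ closedBall (0:ℂ) 1 ↔ ρ ≤ 2 * Real.cos t := by
    intro t
    rw [mem_closedBall_zero_iff, ← sq_le_one_iff₀ (norm_nonneg _), normSq_arc]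
    constructor
    · intro h; by_contra! h'; nlinarith
    · intro h; nlinarith
  have hcos' : ∀ t, γ t ∈ ball (0:ℂ) 1 ↔ ρ < 2 * Real.cos t := by
    intro t
    rw [mem_ball_zero_iff, ← sq_lt_one_iff₀ (norm_nonneg _), normSq_arc]
    constructor
    · intro h; by_contra! h'; nlinarith
    · intro h; nlinarith
  have hca := (hcos a).1 (by simp only [γ]; rwa [← ea])
  have hcb := (hcos b).1 (by simp only [γ]; rwa [← eb])
  have hin : ∀ t ∈ Ioo a b, γ t ∈ ball (0:ℂ) 1 := by
    intro t ht
    rw [hcos']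
    rcases le_total 0 t with h | h
    · have := Real.cos_lt_cos_of_nonneg_of_le_pi h hbpi ht.2
      linarith
    · have := Real.cos_lt_cos_of_nonneg_of_le_pi (x := -t) (y := -a) (by linarith) (by linarith)
        (by linarith [ht.1])
      rw [Real.cos_neg, Real.cos_neg] at this
      linarith
  have hin' : ∀ t ∈ Icc a b, γ t ∈ closedBall (0:ℂ) 1 := by
    intro t ht
    rcases eq_or_lt_of_le ht.1 with h | h
    · rw [← h]; simp only [γ]; rwa [← ea]
    rcases eq_or_lt_of_le ht.2 with h' | h'
    · rw [h']; simp only [γ]; rwa [← eb]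
    exact ball_subset_closedBall (hin t ⟨h, h'⟩)
  let D : ℝ → ℂ := fun t => deriv Φ (γ t) * (-(ρ * (Complex.exp (t * Complex.I) * Complex.I)))
  have hder : ∀ t ∈ Ioo a b, HasDerivAt (fun t => Φ (γ t)) (D t) t := by
    intro t ht
    have h1 := (hΦd.differentiableAt (isOpen_ball.mem_nhds (hin t ht))).hasDerivAt
    have h2 : HasDerivAt γ (-(ρ * (Complex.exp (t * Complex.I) * Complex.I))) t := by
      have h3 : HasDerivAt (fun t : ℝ => (t:ℂ) * Complex.I) Complex.I t := by
        simpa using (Complex.ofRealCLM.hasDerivAt (x := t)).mul_const Complex.I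
      exact ((h3.cexp.const_mul (ρ:ℂ)).const_sub 1)
    exact h1.comp t h2
  have hDm : Measurable D := ((measurable_deriv Φ).comp hγc.measurable).mul (by fun_prop)
  have hDn : ∀ t, ‖D t‖ₑ = ENNReal.ofReal ρ * ‖deriv Φ (γ t)‖ₑ := by
    intro t
    have : ‖Complex.exp (t * Complex.I) * Complex.I‖ₑ = 1 := by
      rw [← ofReal_norm, norm_mul, Complex.norm_exp_ofReal_mul_I]; simp
    simp only [D]
    rw [enorm_mul, enorm_neg, enorm_mul, this, mul_one, mul_comm]
    congr 1
    rw [← ofReal_norm, Complex.norm_real, Real.norm_of_nonneg hρ.le]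
  set J := ∫⁻ θ in Ioo (-Real.pi) Real.pi, (ball (0:ℂ) 1).indicator (fun z => ‖deriv Φ z‖ₑ ^ 2)
        (1 - ρ * Complex.exp (θ * Complex.I)) with hJdef
  have hsub : Ioo a b ⊆ Ioo (-Real.pi) Real.pi := Ioo_subset_Ioo hapi.le hbpi
  have hJ1 : ∫⁻ t in Ioo a b, ‖deriv Φ (γ t)‖ₑ ^ 2 ≤ J := by
    rw [hJdef]
    refine le_trans (le_of_eq ?_) (MeasureTheory.lintegral_mono_set hsub)
    refine MeasureTheory.setLIntegral_congr_fun measurableSet_Ioo (fun t ht => ?_)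
    exact (indicator_of_mem (hin t ht) (fun z => ‖deriv Φ z‖ₑ ^ 2)).symm
  have hCS : (∫⁻ t in Ioo a b, ‖D t‖ₑ) ^ 2 ≤ ENNReal.ofReal (η ^ 2) := by
    have h1 := ENNReal.lintegral_mul_le_Lp_mul_Lq
      (MeasureTheory.volume.restrict (Ioo a b)) (p := 2) (q := 2)
      (Real.HolderConjugate.two_two) (f := fun t => ‖deriv Φ (γ t)‖ₑ)
      (g := fun _ => ENNReal.ofReal ρ)
      ((measurable_deriv Φ).comp hγc.measurable).enorm.aemeasurable aemeasurable_const
    have h2 : ∫⁻ t in Ioo a b, ‖D t‖ₑ = ∫⁻ t in Ioo a b,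
        ((fun t => ‖deriv Φ (γ t)‖ₑ) * (fun _ => ENNReal.ofReal ρ) : ℝ → ENNReal) t := by
      refine MeasureTheory.lintegral_congr (fun t => ?_)
      rw [hDn, mul_comm]; rfl
    rw [h2]
    refine (pow_le_pow_left' h1 2).trans ?_
    rw [mul_pow, ← ENNReal.rpow_natCast, ← ENNReal.rpow_natCast, ← ENNReal.rpow_mul,
      ← ENNReal.rpow_mul]
    norm_num
    refine le_trans ?_ hJ
    rw [mul_comm, ENNReal.ofReal_mul (by positivity), ENNReal.ofReal_pow hρ.le]
    gcongr
    linarith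
  have hfin : ∫⁻ t in Ioo a b, ‖D t‖ₑ ≠ ⊤ := by
    intro h
    rw [h] at hCS
    simp at hCS
  have hDint : IntervalIntegrable D MeasureTheory.volume a b := by
    rw [intervalIntegrable_iff_integrableOn_Ioo_of_le hle]
    exact ⟨hDm.aestronglyMeasurable, lt_top_iff_ne_top.2 hfin⟩
  have hFTC := intervalIntegral.integral_eq_sub_of_hasDerivAt_of_le hle
    (hΦc.comp hγc.continuousOn hin') hder hDint
  have e1 : Φ (γ a) = Φ z := by simp only [γ]; rw [← ea]
  have e2 : Φ (γ b) = Φ z' := by simp only [γ]; rw [← eb]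
  simp only [Function.comp_apply] at hFTC
  rw [e1, e2] at hFTC
  rw [dist_comm, dist_eq_norm, ← hFTC, intervalIntegral.integral_of_le hle,
    MeasureTheory.integral_Ioc_eq_integral_Ioo]
  have h3 : ‖∫ t in Ioo a b, D t‖ₑ ≤ ∫⁻ t in Ioo a b, ‖D t‖ₑ :=
    MeasureTheory.enorm_integral_le_lintegral_enorm _
  have h4 : ‖∫ t in Ioo a b, D t‖ₑ ^ 2 ≤ ENNReal.ofReal (η ^ 2) := (pow_le_pow_left' h3 2).trans hCS
  rw [← ofReal_norm, ← ENNReal.ofReal_pow (norm_nonneg _),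
    ENNReal.ofReal_le_ofReal_iff (by positivity)] at h4
  exact le_of_sq_le_sq h4 hη.le

lemma length_area (R : ℝ) {η : ℝ} (hη : 0 < η) : ∃ δ₀ : ℝ, 0 < δ₀ ∧ δ₀ < 1 ∧
    ∀ (G : Set ℂ) (Φ : ℂ → ℂ), G ⊆ ball 0 R → ContinuousOn Φ (closedBall 0 1) →
    DifferentiableOn ℂ Φ (ball 0 1) → BijOn Φ (ball 0 1) G →
    ∃ ρ ∈ Ioo δ₀ 1, ∀ z ∈ closedBall (0:ℂ) 1, z ∈ sphere (1:ℂ) ρ → 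
      ∀ z' ∈ closedBall (0:ℂ) 1, z' ∈ sphere (1:ℂ) ρ → dist (Φ z) (Φ z') ≤ η := by
  have hpi := Real.pi_pos
  set N : ℝ := (R ^ 2 * Real.pi + 1) * (2 * Real.pi) / η ^ 2 with hN
  have hNpos : 0 < N := by positivity
  refine ⟨Real.exp (-N), Real.exp_pos _, by rw [Real.exp_lt_one_iff]; linarith, ?_⟩
  intro G Φ hGR hΦc hΦd hΦb
  set δ₀ := Real.exp (-N) with hδ₀
  have hδpos : 0 < δ₀ := Real.exp_pos _
  have hδ1 : δ₀ < 1 := by rw [hδ₀, Real.exp_lt_one_iff]; linarith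
  let f : ℂ → ENNReal := (ball (0:ℂ) 1).indicator (fun z => ‖deriv Φ z‖ₑ ^ 2)
  have hfm : Measurable f := ((measurable_deriv Φ).enorm.pow_const 2).indicator measurableSet_ball
  by_contra! hcon
  have hJ : ∀ ρ ∈ Ioo δ₀ 1, ENNReal.ofReal (η ^ 2 / (2 * Real.pi) * ρ⁻¹) ≤
      ENNReal.ofReal ρ * ∫⁻ θ in Ioo (-Real.pi) Real.pi, f (1 - ρ * Complex.exp (θ * Complex.I)) := by
    intro ρ hρ
    have hρ0 : 0 < ρ := hδpos.trans hρ.1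
    obtain ⟨z, hz, hzρ, z', hz', hzρ', hd⟩ := hcon ρ hρ
    have h1 : ENNReal.ofReal (η ^ 2) ≤ ENNReal.ofReal (ρ ^ 2 * (2 * Real.pi)) *
      ∫⁻ θ in Ioo (-Real.pi) Real.pi, f (1 - ρ * Complex.exp (θ * Complex.I)) := by
      by_contra! hlt
      exact absurd (arc_bound hΦc hΦd hρ0 hη hlt.le hz hzρ hz' hzρ') (not_le.2 hd)
    have e1 : η ^ 2 / (2 * Real.pi) * ρ⁻¹ = (ρ * (2 * Real.pi))⁻¹ * η ^ 2 := by
      field_simp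
    have e2 : ρ = (ρ * (2 * Real.pi))⁻¹ * (ρ ^ 2 * (2 * Real.pi)) := by
      field_simp
    rw [e1, ENNReal.ofReal_mul (by positivity)]
    nth_rewrite 2 [e2]
    rw [ENNReal.ofReal_mul (by positivity), mul_assoc]
    gcongr
  have hpolar := Complex.lintegral_comp_polarCoord_symm (fun z => f (1 - z))
  rw [MeasureTheory.lintegral_sub_left_eq_self f 1] at hpolar
  have hfin : ∫⁻ z, f z ≤ ENNReal.ofReal (R ^ 2 * Real.pi) := by
    simp only [f]
    rw [MeasureTheory.lintegral_indicator measurableSet_ball]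
    refine (area_bound hGR hΦd hΦb).trans ?_
    have hR0 : 0 ≤ R := by
      by_contra! h
      have := hGR (hΦb.mapsTo (mem_ball_self one_pos))
      rw [ball_eq_empty.2 h.le] at this
      exact this
    rw [ENNReal.ofReal_mul (by positivity), ENNReal.ofReal_pow hR0]
    gcongr
    rw [← NNReal.coe_real_pi, ENNReal.ofReal_coe_nnreal]
  have hlow : ∫⁻ ρ in Ioo δ₀ 1, ENNReal.ofReal (η ^ 2 / (2 * Real.pi) * ρ⁻¹) ≤ ∫⁻ z, f z := by
    rw [← hpolar]
    have hsub : Ioo δ₀ 1 ×ˢ Ioo (-Real.pi) Real.pi ⊆ polarCoord.target := by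
      rintro ⟨x, y⟩ ⟨hx, hy⟩
      exact ⟨hδpos.trans hx.1, hy⟩
    refine le_trans ?_ (MeasureTheory.lintegral_mono_set hsub)
    rw [MeasureTheory.Measure.volume_eq_prod, ← MeasureTheory.Measure.prod_restrict,
      MeasureTheory.lintegral_prod]
    · refine MeasureTheory.setLIntegral_mono' measurableSet_Ioo (fun ρ hρ => ?_)
      refine (hJ ρ hρ).trans (le_of_eq ?_)
      rw [← MeasureTheory.lintegral_const_mul]
      · refine MeasureTheory.lintegral_congr (fun θ => ?_)
        rw [Complex.polarCoord_symm_apply, Complex.exp_mul_I]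
        simp
      · exact hfm.comp (by fun_prop)
    · apply Measurable.aemeasurable
      simp only [Complex.polarCoord_symm_apply, smul_eq_mul]
      refine Measurable.mul (by fun_prop) (hfm.comp (by fun_prop))
  have hcalc : ∫⁻ ρ in Ioo δ₀ 1, ENNReal.ofReal (η ^ 2 / (2 * Real.pi) * ρ⁻¹) =
      ENNReal.ofReal (R ^ 2 * Real.pi + 1) := by
    have hii : IntervalIntegrable (fun ρ : ℝ => η ^ 2 / (2 * Real.pi) * ρ⁻¹) MeasureTheory.volume δ₀ 1 := by
      apply ContinuousOn.intervalIntegrable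
      refine continuousOn_const.mul (continuousOn_id.inv₀ ?_)
      intro x hx
      rw [uIcc_of_le hδ1.le] at hx
      exact (hδpos.trans_le hx.1).ne'
    rw [← MeasureTheory.ofReal_integral_eq_lintegral_ofReal]
    · rw [← MeasureTheory.integral_Ioc_eq_integral_Ioo, ← intervalIntegral.integral_of_le hδ1.le,
        intervalIntegral.integral_const_mul, integral_inv_of_pos hδpos one_pos, one_div,
        Real.log_inv, hδ₀, Real.log_exp, hN]
      congr 1
      field_simp
    · exact (intervalIntegrable_iff_integrableOn_Ioo_of_le hδ1.le).1 hii
    · refine (MeasureTheory.ae_restrict_mem measurableSet_Ioo).mono (fun ρ hρ => ?_)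
      have : 0 < ρ := hδpos.trans hρ.1
      simp only [Pi.zero_apply]
      positivity
  rw [hcalc] at hlow
  have := hlow.trans hfin
  rw [ENNReal.ofReal_le_ofReal_iff (by positivity)] at this
  linarith

lemma boundary_maps {G : Set ℂ} {Φ : ℂ → ℂ}
    (hΦc : ContinuousOn Φ (closedBall 0 1)) (hΦd : DifferentiableOn ℂ Φ (ball 0 1))
    (hΦb : BijOn Φ (ball 0 1) G) : ∀ z ∈ sphere (0:ℂ) 1, Φ z ∈ Gᶜ := by
  intro ζ hζ hG
  obtain ⟨z₀, hz₀, he⟩ := hΦb.surjOn hG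
  have hζn : ‖ζ‖ = 1 := by simpa using hζ
  have hz₀n : ‖z₀‖ < 1 := by simpa using hz₀
  -- a small ball around `z₀` away from `ζ`
  set s : ℝ := (1 - ‖z₀‖) / 2 with hs
  have hspos : 0 < s := by linarith
  have hsub : ball z₀ s ⊆ ball (0:ℂ) 1 := by
    intro w hw
    rw [mem_ball, dist_eq_norm] at hw
    rw [mem_ball_zero_iff]
    have : ‖w‖ ≤ ‖w - z₀‖ + ‖z₀‖ := by simpa using norm_add_le (w - z₀) z₀
    linarith
  have han : AnalyticOnNhd ℂ Φ (ball 0 1) := hΦd.analyticOnNhd isOpen_ball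
  have hopen : IsOpen (Φ '' ball z₀ s) := by
    rcases han.is_constant_or_isOpen (convex_ball (0:ℂ) 1).isPreconnected with ⟨w, hw⟩ | h
    · exfalso
      have h1 : (1/2 : ℂ) ∈ ball (0:ℂ) 1 := by simp; norm_num
      have h2 : (0 : ℂ) ∈ ball (0:ℂ) 1 := by simp
      have := hΦb.injOn h1 h2 (by rw [hw _ h1, hw _ h2])
      norm_num at this
    · exact h _ hsub isOpen_ball
  have hmem : Φ '' ball z₀ s ∈ 𝓝 (Φ ζ) := hopen.mem_nhds ⟨z₀, mem_ball_self hspos, he⟩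
  have hcw : ContinuousWithinAt Φ (ball 0 1) ζ :=
    (hΦc ζ (sphere_subset_closedBall hζ)).mono ball_subset_closedBall
  have hev : ∀ᶠ z in 𝓝[ball 0 1] ζ, Φ z ∈ Φ '' ball z₀ s := hcw hmem
  have hfar : ∀ᶠ z in 𝓝[ball 0 1] ζ, z ∈ ball ζ s :=
    nhdsWithin_le_nhds (ball_mem_nhds ζ hspos)
  have hcl : ζ ∈ closure (ball (0:ℂ) 1) := by
    rw [closure_ball (0:ℂ) one_ne_zero]; exact sphere_subset_closedBall hζ
  have : (𝓝[ball (0:ℂ) 1] ζ).NeBot := mem_closure_iff_nhdsWithin_neBot.1 hcl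
  obtain ⟨z, ⟨w, hw, hwz⟩, hzs, hzb⟩ := (hev.and (hfar.and self_mem_nhdsWithin)).exists
  have : w = z := hΦb.injOn (hsub hw) hzb hwz
  subst this
  rw [mem_ball] at hw hzs
  have h1 : dist ζ z₀ < 2 * s := by
    have := dist_triangle_left ζ z₀ w
    linarith
  rw [dist_eq_norm] at h1
  have h2 : ‖ζ‖ ≤ ‖ζ - z₀‖ + ‖z₀‖ := by simpa using norm_add_le (ζ - z₀) z₀
  linarith

lemma exists_corner {ρ : ℝ} (h0 : 0 < ρ) (h1 : ρ < 1) :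
    ∃ p : ℂ, p ∈ sphere (0:ℂ) 1 ∧ p ∈ sphere (1:ℂ) ρ := by
  have hs : 0 ≤ ρ ^ 2 * (1 - ρ ^ 2 / 4) := by
    apply mul_nonneg (by positivity); nlinarith
  refine ⟨⟨1 - ρ ^ 2 / 2, Real.sqrt (ρ ^ 2 * (1 - ρ ^ 2 / 4))⟩, ?_, ?_⟩
  · rw [mem_sphere_zero_iff_norm, ← sq_eq_sq₀ (norm_nonneg _) one_pos.le,
      ← Complex.normSq_eq_norm_sq, Complex.normSq_mk, Real.mul_self_sqrt hs]
    ring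
  · rw [mem_sphere_iff_norm, ← sq_eq_sq₀ (norm_nonneg _) h0.le,
      ← Complex.normSq_eq_norm_sq, Complex.normSq_apply]
    simp only [Complex.sub_re, Complex.sub_im, Complex.one_re, Complex.one_im, sub_zero]
    rw [Real.mul_self_sqrt hs]
    ring

lemma equicont_one {r R : ℝ} (hr : 0 < r)
    {G : ℕ → Set ℂ} (hGo : ∀ n, IsOpen (G n)) (hGc : ∀ n, IsConnected (G n))
    (hsub : ∀ n, Metric.ball 0 r ⊆ G n ∧ G n ⊆ Metric.ball 0 R)
    (hulc : UnifLocallyConnected (fun n => (G n)ᶜ))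
    {Φ : ℕ → ℂ → ℂ} (hΦc : ∀ n, ContinuousOn (Φ n) (closedBall 0 1))
    (hΦd : ∀ n, DifferentiableOn ℂ (Φ n) (ball 0 1))
    (hΦb : ∀ n, BijOn (Φ n) (ball 0 1) (G n)) (hΦ0 : ∀ n, Φ n 0 = 0)
    {ε₀ : ℝ} (hε₀ : 0 < ε₀) :
    ∃ δ > 0, ∀ n, ∀ z ∈ closedBall (0:ℂ) 1, dist z 1 < δ → dist (Φ n z) (Φ n 1) < ε₀ := by
  set ε := min (ε₀ / 3) r with hε
  have hεpos : 0 < ε := lt_min (by linarith) hr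
  obtain ⟨δ', hδ', hB⟩ := hulc ε hεpos
  set η := min δ' ε / 2 with hη
  have hmin : 0 < min δ' ε := lt_min hδ' hεpos
  have hηpos : 0 < η := by linarith
  have hη1 : η < δ' := by have := min_le_left δ' ε; linarith
  have hη2 : η < ε := by have := min_le_right δ' ε; linarith
  obtain ⟨δ, hδ, hδ1, hlen⟩ := length_area R hηpos
  refine ⟨δ, hδ, fun n => ?_⟩
  obtain ⟨ρ, hρ, harc⟩ := hlen (G n) (Φ n) (hsub n).2 (hΦc n) (hΦd n) (hΦb n)
  have hρ0 : 0 < ρ := hδ.trans hρ.1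
  have hbd := boundary_maps (hΦc n) (hΦd n) (hΦb n)
  obtain ⟨p, hp0, hp1⟩ := exists_corner hρ0 hρ.2
  have hpc := sphere_subset_closedBall hp0
  have key : ∀ z ∈ ball (0:ℂ) 1, z ∈ ball (1:ℂ) ρ → dist (Φ n z) (Φ n p) < ε := by
    intro z hz hz1
    exact separation (hGo n) (hGc n).isPreconnected (hsub n).1 (min_le_right _ _) hr (hΦc n) (hΦd n)
      (hΦb n) (hΦ0 n) hbd hρ.2 hp0 hp1
      (fun z hz hz1 => (harc z hz hz1 p hpc hp1).trans_lt hη1)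
      (fun z hz hz1 => (harc z hz hz1 p hpc hp1).trans_lt hη2)
      (fun b hb hd => hB n _ (hbd p hp0) b hb hd) hz hz1
  have key2 : ∀ z ∈ closedBall (0:ℂ) 1, z ∈ ball (1:ℂ) ρ → dist (Φ n z) (Φ n p) ≤ ε := by
    intro z hz hz1
    have hcw : ContinuousWithinAt (Φ n) (ball 0 1) z := ((hΦc n) z hz).mono ball_subset_closedBall
    have hcl : z ∈ closure (ball (0:ℂ) 1) := by rwa [closure_ball (0:ℂ) one_ne_zero]
    have : (𝓝[ball (0:ℂ) 1] z).NeBot := mem_closure_iff_nhdsWithin_neBot.1 hcl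
    refine le_of_tendsto (hcw.tendsto.dist tendsto_const_nhds) ?_
    filter_upwards [nhdsWithin_le_nhds (isOpen_ball.mem_nhds hz1), self_mem_nhdsWithin] with w h1 h2
    exact (key w h2 h1).le
  intro z hz hzδ
  have h1 := key2 z hz (by rw [mem_ball]; linarith [hρ.1])
  have h2 := key2 1 (by simp) (by simpa using hρ0)
  have h3 := dist_triangle_right (Φ n z) (Φ n 1) (Φ n p)
  have h4 : ε ≤ ε₀ / 3 := min_le_left _ _
  linarith

lemma equicont_interior {R : ℝ} {Φ : ℕ → ℂ → ℂ}
    (hΦd : ∀ n, DifferentiableOn ℂ (Φ n) (ball 0 1))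
    (hΦb : ∀ n, MapsTo (Φ n) (ball 0 1) (ball 0 R)) {x : ℂ} (hx : x ∈ ball (0:ℂ) 1)
    {ε₀ : ℝ} (hε₀ : 0 < ε₀) :
    ∃ δ > 0, ∀ n, ∀ z, dist z x < δ → dist (Φ n z) (Φ n x) < ε₀ := by
  obtain ⟨s, hs, hsub⟩ := Metric.isOpen_iff.1 isOpen_ball x hx
  have hR : 0 < R := by
    have := hΦb 0 hx
    exact pos_of_mem_ball this
  refine ⟨min s (ε₀ * s / (2 * R)), lt_min hs (by positivity), fun n z hz => ?_⟩
  have hz1 : dist z x < s := hz.trans_le (min_le_left _ _)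
  have hz2 : dist z x < ε₀ * s / (2 * R) := hz.trans_le (min_le_right _ _)
  have := Complex.dist_le_div_mul_dist_of_mapsTo_ball (f := Φ n) (c := x) (R₁ := s) (R₂ := 2 * R)
    (z := z) ((hΦd n).mono hsub) (by
      intro w hw
      have h1 := hΦb n (hsub hw)
      have h2 := hΦb n hx
      rw [mem_ball] at h1 h2
      rw [mem_closedBall]
      have := dist_triangle_right (Φ n w) (Φ n x) 0
      linarith) hz1
  refine this.trans_lt ?_
  calc 2 * R / s * dist z x < 2 * R / s * (ε₀ * s / (2 * R)) := by gcongr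
    _ = ε₀ := by field_simp

lemma equicont_all {r R : ℝ} (hr : 0 < r)
    {G : ℕ → Set ℂ} (hGo : ∀ n, IsOpen (G n)) (hGc : ∀ n, IsConnected (G n))
    (hsub : ∀ n, Metric.ball 0 r ⊆ G n ∧ G n ⊆ Metric.ball 0 R)
    (hulc : UnifLocallyConnected (fun n => (G n)ᶜ))
    {Φ : ℕ → ℂ → ℂ} (hΦc : ∀ n, ContinuousOn (Φ n) (closedBall 0 1))
    (hΦd : ∀ n, DifferentiableOn ℂ (Φ n) (ball 0 1))
    (hΦb : ∀ n, BijOn (Φ n) (ball 0 1) (G n)) (hΦ0 : ∀ n, Φ n 0 = 0)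
    {x : ℂ} (hx : x ∈ closedBall (0:ℂ) 1) {ε₀ : ℝ} (hε₀ : 0 < ε₀) :
    ∃ δ > 0, ∀ n, ∀ z ∈ closedBall (0:ℂ) 1, dist z x < δ → dist (Φ n z) (Φ n x) < ε₀ := by
  rcases eq_or_lt_of_le (mem_closedBall.1 hx) with h | h
  · have hxn : ‖x‖ = 1 := by simpa using h
    have hx0 : x ≠ 0 := by rintro rfl; simp at hxn
    have hmb : MapsTo (fun z => x * z) (ball 0 1) (ball 0 1) := fun z hz => by
      rw [mem_ball_zero_iff] at hz ⊢; simpa [hxn] using hz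
    have hmc : MapsTo (fun z => x * z) (closedBall 0 1) (closedBall 0 1) := fun z hz => by
      rw [mem_closedBall_zero_iff] at hz ⊢; simpa [hxn] using hz
    have hbij : BijOn (fun z => x * z) (ball 0 1) (ball 0 1) := by
      refine ⟨hmb, (mul_right_injective₀ hx0).injOn, fun z hz => ⟨x⁻¹ * z, ?_, ?_⟩⟩
      · rw [mem_ball_zero_iff] at hz ⊢; simpa [hxn] using hz
      · simp only; field_simp
    obtain ⟨δ, hδ, hh⟩ := equicont_one hr hGo hGc hsub hulc (Φ := fun n z => Φ n (x * z))
      (fun n => (hΦc n).comp (by fun_prop) hmc) (fun n => (hΦd n).comp (by fun_prop) hmb)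
      (fun n => (hΦb n).comp hbij) (fun n => by simp [hΦ0 n]) hε₀
    refine ⟨δ, hδ, fun n z hz hzx => ?_⟩
    have e : x * (x⁻¹ * z) = z := by field_simp
    have := hh n (x⁻¹ * z) (by
      rw [mem_closedBall_zero_iff] at hz ⊢; simpa [hxn] using hz) (by
      rw [dist_eq_norm] at hzx ⊢
      have : x⁻¹ * z - 1 = x⁻¹ * (z - x) := by field_simp
      rw [this, norm_mul, norm_inv, hxn]
      simpa using hzx)
    simpa [e] using this
  · obtain ⟨δ, hδ, hh⟩ := equicont_interior (R := R) hΦd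
      (fun n z hz => (hsub n).2 ((hΦb n).mapsTo hz)) h hε₀
    exact ⟨δ, hδ, fun n z _ => hh n z⟩

end Helpers

/-- If the bounded simply connected domains `G n` satisfy `B(0,r) ⊆ G n ⊆ B(0,R)`,
their complements are uniformly locally connected, and the conformal maps
`φₙ : 𝔻 → G n` with `φₙ(0) = 0` converge pointwise on `𝔻`, then (their continuous
extensions) converge uniformly on the closed disc. -/
theorem uniform_convergence_of_conformal_maps (r R : ℝ) (hr : 0 < r) (hrR : r < R)
    (G : ℕ → Set ℂ) (hGo : ∀ n, IsOpen (G n)) (hGc : ∀ n, IsConnected (G n))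
    (hGs : ∀ n, SimplyConnectedSpace (G n))
    (hsub : ∀ n, Metric.ball 0 r ⊆ G n ∧ G n ⊆ Metric.ball 0 R)
    (hulc : UnifLocallyConnected (fun n => (G n)ᶜ))
    (φn Φn : ℕ → ℂ → ℂ) (φ : ℂ → ℂ)
    (hφnd : ∀ n, DifferentiableOn ℂ (φn n) (Metric.ball 0 1))
    (hφnb : ∀ n, Set.BijOn (φn n) (Metric.ball 0 1) (G n))
    (hφn0 : ∀ n, φn n 0 = 0)
    (hΦn : ∀ n, ContinuousOn (Φn n) (Metric.closedBall 0 1) ∧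
      Set.EqOn (Φn n) (φn n) (Metric.ball 0 1))
    (hpt : ∀ z ∈ Metric.ball (0:ℂ) 1,
      Filter.Tendsto (fun n => φn n z) Filter.atTop (nhds (φ z))) :
    ∃ Φ : ℂ → ℂ, ContinuousOn Φ (Metric.closedBall 0 1) ∧
      Set.EqOn Φ φ (Metric.ball 0 1) ∧
      TendstoUniformlyOn (fun n => Φn n) Φ Filter.atTop (Metric.closedBall 0 1) := by
  have hΦc := fun n => (hΦn n).1
  have hΦd : ∀ n, DifferentiableOn ℂ (Φn n) (Metric.ball 0 1) :=
    fun n => (hφnd n).congr (hΦn n).2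
  have hΦb : ∀ n, Set.BijOn (Φn n) (Metric.ball 0 1) (G n) :=
    fun n => (hφnb n).congr (hΦn n).2.symm
  have hΦ0 : ∀ n, Φn n 0 = 0 := fun n => by
    rw [(hΦn n).2 (by simp), hφn0 n]
  have hequi : ∀ x ∈ Metric.closedBall (0:ℂ) 1, ∀ ε > 0, ∃ δ > 0, ∀ n,
      ∀ z ∈ Metric.closedBall (0:ℂ) 1, dist z x < δ → dist (Φn n z) (Φn n x) < ε :=
    fun x hx ε hε => equicont_all hr hGo hGc hsub hulc hΦc hΦd hΦb hΦ0 hx hε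
  have hptb : ∀ z ∈ Metric.ball (0:ℂ) 1,
      Filter.Tendsto (fun n => Φn n z) Filter.atTop (nhds (φ z)) := fun z hz =>
    (hpt z hz).congr (fun n => ((hΦn n).2 hz).symm)
  have hlim : ∀ x ∈ Metric.closedBall (0:ℂ) 1, ∃ w,
      Filter.Tendsto (fun n => Φn n x) Filter.atTop (nhds w) := by
    intro x hx
    apply cauchySeq_tendsto_of_complete
    rw [Metric.cauchySeq_iff']
    intro ε hε
    obtain ⟨δ, hδ, hd⟩ := hequi x hx (ε / 3) (by linarith)
    have hcl : x ∈ closure (Metric.ball (0:ℂ) 1) := by rwa [closure_ball (0:ℂ) one_ne_zero]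
    obtain ⟨z, hz, hzx⟩ := Metric.mem_closure_iff.1 hcl δ hδ
    obtain ⟨N, hN⟩ := Metric.cauchySeq_iff'.1 (hptb z hz).cauchySeq (ε / 3) (by linarith)
    refine ⟨N, fun n hn => ?_⟩
    rw [dist_comm] at hzx
    have hzc := Metric.ball_subset_closedBall hz
    have h1 := hd n z hzc hzx
    have h2 := hd N z hzc hzx
    have h3 := hN n hn
    have h4 := dist_triangle4_left (Φn n z) (Φn N z) (Φn n x) (Φn N x)
    linarith
  choose! Φ hΦ using hlim
  have hun : TendstoUniformlyOn (fun n => Φn n) Φ Filter.atTop (Metric.closedBall 0 1) := by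
    rw [← tendstoLocallyUniformlyOn_iff_tendstoUniformlyOn_of_compact (isCompact_closedBall 0 1),
      Metric.tendstoLocallyUniformlyOn_iff]
    intro ε hε x hx
    obtain ⟨δ, hδ, hd⟩ := hequi x hx (ε / 4) (by linarith)
    refine ⟨Metric.ball x δ ∩ Metric.closedBall 0 1,
      Filter.inter_mem (nhdsWithin_le_nhds (Metric.ball_mem_nhds x hδ)) self_mem_nhdsWithin, ?_⟩
    filter_upwards [Metric.tendsto_nhds.1 (hΦ x hx) (ε / 4) (by linarith)] with n hn y hy
    have h1 := hd n y hy.2 hy.1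
    have h2 : dist (Φ y) (Φ x) ≤ ε / 4 :=
      le_of_tendsto' ((hΦ y hy.2).dist (hΦ x hx)) (fun m => (hd m y hy.2 hy.1).le)
    have h3 := dist_triangle4 (Φ y) (Φ x) (Φn n x) (Φn n y)
    rw [dist_comm (Φn n x) (Φn n y), dist_comm (Φ x)] at h3
    linarith
  refine ⟨Φ, hun.continuousOn (Filter.Frequently.of_forall hΦc), fun z hz => ?_, hun⟩
  exact tendsto_nhds_unique (hΦ z (Metric.ball_subset_closedBall hz)) (hptb z hz)
end

section
/- If a sequence of admissible domains (G_n, a_n, c_n, d_n) converges to an admissible domain (G, a, c, d) (meaning the three boundary Jordan arcs converge in the uniform metric on curves), then the sequence of closed sets {ℂ ∖ G_n} is uniformly locally connected. -/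
/-- A monotone, endpoint-preserving, continuous reparametrization of `[0,1]`. -/
def IsReparam (φ : unitInterval → unitInterval) : Prop :=
  Continuous φ ∧ Monotone φ ∧ φ 0 = 0 ∧ φ 1 = 1

/-- The uniform distance between curves in `ℂ`, modulo monotone reparametrization. -/
noncomputable def curveDist (γ₁ γ₂ : C(unitInterval, ℂ)) : ℝ :=
  sInf { r : ℝ | 0 ≤ r ∧ ∃ φ ψ : unitInterval → unitInterval,
    IsReparam φ ∧ IsReparam ψ ∧ ∀ t, dist (γ₁ (φ t)) (γ₂ (ψ t)) ≤ r }

/-- A bounded simply connected domain `G`, admissible with respect to three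
counterclockwise boundary points `a, c, d`: the boundary is the union of three
simple arcs `J₁ = d⌢a`, `J₂ = a⌢c`, `J₃ = c⌢d`; `J₃` does not touch the interiors
of `J₁` and `J₂`; and every point of `J₃` can be joined to infinity by a path not
crossing `∂G`. -/
structure AdmissibleDomain where
  G : Set ℂ
  a : ℂ
  c : ℂ
  d : ℂ
  J1 : C(unitInterval, ℂ)
  J2 : C(unitInterval, ℂ)
  J3 : C(unitInterval, ℂ)
  isOpen : IsOpen G
  bounded : Bornology.IsBounded G
  connected : IsConnected G
  simplyConnected : SimplyConnectedSpace G
  inj1 : Function.Injective J1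
  inj2 : Function.Injective J2
  inj3 : Function.Injective J3
  e10 : J1 0 = d
  e11 : J1 1 = a
  e20 : J2 0 = a
  e21 : J2 1 = c
  e30 : J3 0 = c
  e31 : J3 1 = d
  boundary : Set.range J1 ∪ Set.range J2 ∪ Set.range J3 = frontier G
  noTouch1 : Set.range J3 ∩ (Set.range J1 \ {d, a}) = ∅
  noTouch2 : Set.range J3 ∩ (Set.range J2 \ {a, c}) = ∅
  toInfinity : ∀ p ∈ Set.range J3, ∃ γ : ℝ → ℂ, Continuous γ ∧ γ 0 = p ∧
    Filter.Tendsto (fun t => ‖γ t‖) Filter.atTop Filter.atTop ∧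
    ∀ t : ℝ, 0 < t → γ t ∉ frontier G

/-- Convergence of admissible domains: the three boundary arcs converge in the
uniform curve metric and the marked points converge. -/
def AdmConverges (Dn : ℕ → AdmissibleDomain) (D : AdmissibleDomain) : Prop :=
  Filter.Tendsto (fun n => curveDist (Dn n).J1 D.J1) Filter.atTop (nhds 0) ∧
  Filter.Tendsto (fun n => curveDist (Dn n).J2 D.J2) Filter.atTop (nhds 0) ∧
  Filter.Tendsto (fun n => curveDist (Dn n).J3 D.J3) Filter.atTop (nhds 0) ∧
  Filter.Tendsto (fun n => (Dn n).a) Filter.atTop (nhds D.a) ∧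
  Filter.Tendsto (fun n => (Dn n).c) Filter.atTop (nhds D.c) ∧
  Filter.Tendsto (fun n => (Dn n).d) Filter.atTop (nhds D.d)

open Set Filter Topology

/-- `h` has a continuous logarithm on `A`. -/
def HasLog (h : ℂ → ℂ) (A : Set ℂ) : Prop :=
  ∃ L : ℂ → ℂ, ContinuousOn L A ∧ ∀ z ∈ A, Complex.exp (L z) = h z

lemma exists_log_plane (F : ℂ → ℂ) (hF : Continuous F) (h0 : ∀ z, F z ≠ 0) :
    ∃ L : ℂ → ℂ, Continuous L ∧ ∀ z, Complex.exp (L z) = F z := by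
  have hsc : IsSimplyConnected (univ : Set ℂ) := by
    have := convex_univ.contractibleSpace (E := ℂ) univ_nonempty
    exact (inferInstance : SimplyConnectedSpace (univ : Set ℂ))
  obtain ⟨f, hf, hf2⟩ := Complex.exists_continuousOn_eqOn_exp_comp hsc isOpen_univ
    hF.continuousOn (by rintro ⟨z, -, hz⟩; exact h0 z hz)
  exact ⟨f, by simpa [continuousOn_univ] using hf, fun z => hf2 (mem_univ z)⟩

lemma exists_log_line (F : ℝ → ℂ) (hF : Continuous F) (h0 : ∀ z, F z ≠ 0) :
    ∃ L : ℝ → ℂ, Continuous L ∧ ∀ z, Complex.exp (L z) = F z := by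
  have hsc : IsSimplyConnected (univ : Set ℝ) := by
    have := convex_univ.contractibleSpace (E := ℝ) univ_nonempty
    exact (inferInstance : SimplyConnectedSpace (univ : Set ℝ))
  obtain ⟨f, hf, hf2⟩ := Complex.exists_continuousOn_eqOn_exp_comp hsc isOpen_univ
    hF.continuousOn (by rintro ⟨z, -, hz⟩; exact h0 z hz)
  exact ⟨f, by simpa [continuousOn_univ] using hf, fun z => hf2 (mem_univ z)⟩

/-- two continuous logs on a preconnected set differ by a constant. -/
lemma log_diff_const_s11 {X : Type*} [TopologicalSpace X] {E : Set X} (hE : IsPreconnected E) {L l : X → ℂ}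
    (hL : ContinuousOn L E) (hl : ContinuousOn l E)
    (h : ∀ z ∈ E, Complex.exp (L z) = Complex.exp (l z)) :
    ∃ c : ℂ, Complex.exp c = 1 ∧ ∀ z ∈ E, L z = l z + c := by
  rcases E.eq_empty_or_nonempty with rfl | ⟨z0, hz0⟩
  · exact ⟨0, by simp, by simp⟩
  have key : ∀ z ∈ E, ∃ n : ℤ, L z - l z = n * (2 * Real.pi * Complex.I) := by
    intro z hz
    have := Complex.exp_eq_exp_iff_exists_int.1 (h z hz)
    obtain ⟨n, hn⟩ := this
    exact ⟨n, by rw [hn]; ring⟩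
  choose! n hn using key
  have hpi : (2 * Real.pi * Complex.I : ℂ) ≠ 0 := Complex.two_pi_I_ne_zero
  have hnc : ContinuousOn (fun z => ((n z : ℤ) : ℂ)) E := by
    have : ContinuousOn (fun z => (L z - l z) / (2 * Real.pi * Complex.I)) E := by fun_prop
    refine this.congr fun z hz => ?_
    show ((n z : ℤ) : ℂ) = (L z - l z) / (2 * Real.pi * Complex.I)
    rw [hn z hz]; field_simp
  have hnc2 : ContinuousOn n E := by
    have he : IsEmbedding ((↑) : ℤ → ℂ) := by
      have := Complex.isometry_ofReal.isEmbedding.comp Int.isClosedEmbedding_coe_real.isEmbedding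
      convert this using 1
      ext z; simp
    exact he.continuousOn_iff.2 hnc
  refine ⟨L z0 - l z0, ?_, fun z hz => ?_⟩
  · rw [Complex.exp_sub, h z0 hz0, div_self (Complex.exp_ne_zero _)]
  · have := hE.constant hnc2 hz hz0
    have h1 := hn z hz
    have h2 := hn z0 hz0
    rw [this, ← h2] at h1
    rw [← h1]; ring

/-- power of `z - w` has no log on a circle. -/
lemma no_log_circle (w : ℂ) (k : ℤ) (R : ℝ) (hR : 0 < R) (L : ℂ → ℂ) (hL : Continuous L)
    (h : ∀ z, ‖z - w‖ = R → Complex.exp (L z) = (z - w) ^ k) : k = 0 := by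
  have h1 : ∀ t ∈ (univ : Set ℝ), Complex.exp (L (w + R * Complex.exp (t * Complex.I)))
      = Complex.exp (k * (Real.log R + t * Complex.I)) := by
    intro t _
    rw [h]
    · rw [Complex.exp_int_mul, Complex.exp_add, ← Complex.ofReal_exp, Real.exp_log hR]
      congr 1; ring
    · simp [Complex.norm_exp_ofReal_mul_I, abs_of_pos hR]
  obtain ⟨c, -, hc⟩ := log_diff_const_s11 isPreconnected_univ (by fun_prop) (by fun_prop) h1
  have a := hc 0 trivial
  have b := hc (2 * Real.pi) trivial
  have e : Complex.exp (((2 * Real.pi : ℝ) : ℂ) * Complex.I) = Complex.exp (((0 : ℝ) : ℂ) * Complex.I) := by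
    push_cast; rw [Complex.exp_two_pi_mul_I]; simp
  rw [e, a] at b
  have : (k : ℂ) * (2 * Real.pi * Complex.I) = 0 := by
    push_cast at b; linear_combination -b
  rcases mul_eq_zero.1 this with h | h
  · exact_mod_cast h
  · exact absurd h Complex.two_pi_I_ne_zero

/-- Hard direction of Eilenberg's criterion. -/
lemma eilenberg {V A : Set ℂ} (hVb : Bornology.IsBounded V) (hA : IsClosed A)
    (hfr : frontier V ⊆ A) (hVo : IsOpen V) {w : ℂ} (hw : w ∈ V) (k : ℤ) (g : ℂ → ℂ)
    (hg : ContinuousOn g (closure V)) (hg0 : ∀ z ∈ closure V, g z ≠ 0)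
    (hlog : HasLog (fun z => (z - w) ^ k * g z) A) : k = 0 := by
  classical
  obtain ⟨L, hLc, hL⟩ := hlog
  obtain ⟨Lt, hLt⟩ := ContinuousMap.exists_restrict_eq hA ⟨fun z : A => L z, continuousOn_iff_continuous_domRestrict.1 hLc⟩
  have hLt' : ∀ z ∈ A, Lt z = L z := fun z hz => by
    have := congrArg (fun f => f ⟨z, hz⟩) hLt
    exact this
  have hwout : ∀ z ∈ Vᶜ, z - w ≠ 0 := by
    intro z hz h
    rw [sub_eq_zero.1 h] at hz
    exact hz hw
  let F : ℂ → ℂ := V.piecewise (fun z => Complex.exp (Lt z) / g z) (fun z => (z - w) ^ k)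
  have hF : Continuous F := by
    apply continuous_piecewise
    · intro z hz
      have h1 := hL z (hfr hz)
      have h2 := hg0 z (frontier_subset_closure hz)
      rw [hLt' z (hfr hz), h1]; field_simp
    · exact (by fun_prop : Continuous fun z => Complex.exp (Lt z)).continuousOn.div hg hg0
    · rw [hVo.isClosed_compl.closure_eq]
      exact ContinuousOn.zpow₀ (by fun_prop) k (fun z hz => Or.inl (hwout z hz))
  have hF0 : ∀ z, F z ≠ 0 := by
    intro z
    by_cases hz : z ∈ V
    · simp only [F, piecewise_eq_of_mem _ _ _ hz]
      exact div_ne_zero (Complex.exp_ne_zero _) (hg0 z (subset_closure hz))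
    · simp only [F, piecewise_eq_of_notMem _ _ _ hz]
      exact zpow_ne_zero _ (hwout z hz)
  obtain ⟨M, hMc, hM⟩ := exists_log_plane F hF hF0
  obtain ⟨R, hR0, hR⟩ : ∃ R > 0, V ⊆ Metric.ball w R := by
    obtain ⟨R, hR⟩ := hVb.subset_ball w
    exact ⟨max R 1, by positivity, hR.trans (Metric.ball_subset_ball (le_max_left _ _))⟩
  refine no_log_circle w k R hR0 M hMc fun z hz => ?_
  have hzV : z ∉ V := fun h => by
    have := hR h
    rw [Metric.mem_ball, dist_eq_norm, hz] at this
    exact lt_irrefl _ this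
  rw [hM]; simp only [F, piecewise_eq_of_notMem _ _ _ hzV]

lemma HasLog.mono {h : ℂ → ℂ} {A B : Set ℂ} (hA : HasLog h A) (hB : B ⊆ A) : HasLog h B := by
  obtain ⟨L, h1, h2⟩ := hA
  exact ⟨L, h1.mono hB, fun z hz => h2 z (hB hz)⟩

lemma HasLog.congr {h h' : ℂ → ℂ} {A : Set ℂ} (hA : HasLog h A) (hh : ∀ z ∈ A, h z = h' z) : HasLog h' A := by
  obtain ⟨L, h1, h2⟩ := hA
  exact ⟨L, h1, fun z hz => by rw [h2 z hz, hh z hz]⟩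

lemma hasLog_slit {h : ℂ → ℂ} {A : Set ℂ} (hc : ContinuousOn h A) (hs : ∀ z ∈ A, h z ∈ Complex.slitPlane) :
    HasLog h A :=
  ⟨fun z => Complex.log (h z), hc.clog hs, fun z hz => Complex.exp_log (Complex.slitPlane_ne_zero (hs z hz))⟩

/-- Easy direction of Eilenberg's criterion. -/
lemma hasLog_of_preconnected {A S : Set ℂ} (hA : IsClosed A) (hS : IsPreconnected S)
    (hSA : Disjoint S A) {w1 w2 : ℂ} (h1 : w1 ∈ S) (h2 : w2 ∈ S) :
    HasLog (fun z => (z - w1) / (z - w2)) A := by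
  have hne : ∀ w ∈ S, ∀ z ∈ A, z - w ≠ 0 := by
    intro w hw z hz h
    rw [sub_eq_zero.1 h] at hz
    exact Set.disjoint_left.1 hSA hw hz
  refine hS.induction₂ (fun w1 w2 => HasLog (fun z => (z - w1) / (z - w2)) A) ?_ ?_ ?_ h1 h2
  · intro w hw
    obtain ⟨r, hr, hrA⟩ := Metric.isOpen_iff.1 hA.isOpen_compl w (Set.disjoint_left.1 hSA hw)
    have : Metric.ball w (r/2) ∈ 𝓝[S] w := mem_nhdsWithin_of_mem_nhds (Metric.ball_mem_nhds _ (by positivity))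
    filter_upwards [this, self_mem_nhdsWithin] with w' hw' hw'S
    apply hasLog_slit
    · exact ContinuousOn.div (by fun_prop) (by fun_prop) (hne w' hw'S)
    · intro z hz
      suffices hh : ‖(z - w) / (z - w') - 1‖ < 1 by
        have := Complex.mem_slitPlane_of_norm_lt_one hh
        simpa using this
      have h0 := hne w' hw'S z hz
      have e : (z - w) / (z - w') - 1 = (w' - w) / (z - w') := by field_simp; ring
      rw [e, norm_div, div_lt_one (norm_pos_iff.2 h0)]
      have hzw : r ≤ dist z w := by
        by_contra hlt
        exact hrA (Metric.mem_ball.2 (not_le.1 hlt)) hz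
      have hw'' : dist w' w < r/2 := hw'
      have := dist_triangle z w' w
      rw [← dist_eq_norm, ← dist_eq_norm]; linarith
  · rintro x y z hx hy hz ⟨L, hL, hL'⟩ ⟨M, hM, hM'⟩
    refine ⟨fun z => L z + M z, hL.add hM, fun u hu => ?_⟩
    rw [Complex.exp_add, hL' u hu, hM' u hu]
    have := hne y hy u hu
    have := hne z hz u hu
    field_simp
  · rintro x y hx hy ⟨L, hL, hL'⟩
    refine ⟨fun z => - L z, hL.neg, fun u hu => ?_⟩
    rw [Complex.exp_neg, hL' u hu, inv_div]

/-- Off a convex set containing both points, the quotient lies in the slit plane. -/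
lemma quot_mem_slit {B : Set ℂ} (hB : Convex ℝ B) {w1 w2 z : ℂ} (h1 : w1 ∈ B) (h2 : w2 ∈ B) (hz : z ∉ B) :
    (z - w1) / (z - w2) ∈ Complex.slitPlane := by
  have hz2 : z - w2 ≠ 0 := fun h => hz (by rw [sub_eq_zero.1 h]; exact h2)
  by_contra hns
  rw [Complex.mem_slitPlane_iff_not_le_zero, not_not] at hns
  obtain ⟨hre, him⟩ := Complex.le_def.1 hns
  set r := ((z - w1) / (z - w2)).re with hr
  have e : (z - w1) / (z - w2) = r := Complex.ext (by simp [hr]) (by simpa using him)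
  have hr0 : r ≤ 0 := by simpa using hre
  rw [div_eq_iff hz2] at e
  apply hz
  have h1r : (1 : ℝ) - r > 0 := by linarith
  have : z = (1 / (1 - r)) • w1 + ((-r) / (1 - r)) • w2 := by
    simp only [Complex.real_smul]
    have : (1 - r : ℂ) ≠ 0 := by exact_mod_cast h1r.ne'
    push_cast
    field_simp
    linear_combination e
  rw [this]
  exact hB h1 h2 (by positivity) (div_nonneg (by linarith) h1r.le) (by field_simp; ring)

/-- principal log off `B`. -/
lemma offball_log {B : Set ℂ} (hB : Convex ℝ B) {w1 w2 : ℂ} (h1 : w1 ∈ B) (h2 : w2 ∈ B) :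
    ContinuousOn (fun z => Complex.log ((z - w1) / (z - w2))) Bᶜ ∧
    ∀ z ∈ Bᶜ, Complex.exp (Complex.log ((z - w1) / (z - w2))) = (z - w1) / (z - w2) := by
  constructor
  · apply ContinuousOn.clog
    · apply ContinuousOn.div (by fun_prop) (by fun_prop)
      intro z hz h
      exact hz (by rw [sub_eq_zero.1 h]; exact h2)
    · exact fun z hz => quot_mem_slit hB h1 h2 hz
  · exact fun z hz => Complex.exp_log (Complex.slitPlane_ne_zero (quot_mem_slit hB h1 h2 hz))

lemma hasLog_glue {h : ℂ → ℂ} {A M : Set ℂ} (hA : IsClosed A) (hM : IsClosed M) {L l : ℂ → ℂ} {c : ℂ}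
    (hL : ContinuousOn L A) (hL' : ∀ z ∈ A, Complex.exp (L z) = h z)
    (hl : ContinuousOn l M) (hl' : ∀ z ∈ M, Complex.exp (l z) = h z)
    (hc : Complex.exp c = 1) (hAM : ∀ z ∈ A, z ∈ M → L z = l z + c) : HasLog h (A ∪ M) := by
  classical
  refine ⟨A.piecewise L (fun z => l z + c), ?_, ?_⟩
  · apply ContinuousOn.union_of_isClosed _ _ hA hM
    · exact hL.congr (fun z hz => piecewise_eq_of_mem _ _ _ hz)
    · have hlc : ContinuousOn (fun z => l z + c) M := hl.add continuousOn_const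
      refine hlc.congr fun z hz => ?_
      by_cases hzA : z ∈ A
      · rw [piecewise_eq_of_mem _ _ _ hzA, hAM z hzA hz]
      · rw [piecewise_eq_of_notMem _ _ _ hzA]
  · intro z hz
    by_cases hzA : z ∈ A
    · rw [piecewise_eq_of_mem _ _ _ hzA, hL' z hzA]
    · rw [piecewise_eq_of_notMem _ _ _ hzA, Complex.exp_add, hc, mul_one]
      exact hl' z (hz.resolve_left hzA)

/-- any nonvanishing continuous function has a log on a simple arc. -/
lemma hasLog_arc (J : C(unitInterval, ℂ)) (hJ : Function.Injective J) (h : ℂ → ℂ)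
    (hc : ContinuousOn h (range J)) (h0 : ∀ z ∈ range J, h z ≠ 0) : HasLog h (range J) := by
  classical
  have hcJ : Continuous fun t : ℝ => h (J (projIcc 0 1 zero_le_one t)) := by
    apply hc.comp_continuous (J.continuous.comp continuous_projIcc)
    intro t; exact mem_range_self _
  obtain ⟨L, hLc, hL⟩ := exists_log_line _ hcJ (fun t => h0 _ (mem_range_self _))
  have hemb : IsClosedEmbedding J := J.continuous.isClosedEmbedding hJ
  let e : unitInterval ≃ₜ range J := hemb.isEmbedding.toHomeomorph
  refine ⟨fun z => if hz : z ∈ range J then L (e.symm ⟨z, hz⟩ : unitInterval) else 0, ?_, ?_⟩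
  · rw [continuousOn_iff_continuous_domRestrict]
    have : Continuous fun z : range J => L (e.symm z : unitInterval) := by fun_prop
    convert this using 1
    funext z
    exact dif_pos z.2
  · rintro z hz
    have hz' := hz
    obtain ⟨t, rfl⟩ := hz'
    have : e.symm ⟨J t, hz⟩ = t := by
      rw [Homeomorph.symm_apply_eq]; rfl
    simp only [hz, dif_pos, this, hL]
    simp

/-- extending a log to a neighbourhood. -/
lemma log_extend {h : ℂ → ℂ} {A O : Set ℂ} (hA : IsClosed A) (hO : IsOpen O) (hAO : A ⊆ O)
    (hc : ContinuousOn h O) (h0 : ∀ z ∈ O, h z ≠ 0) (hlog : HasLog h A) :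
    ∃ O' : Set ℂ, IsOpen O' ∧ A ⊆ O' ∧ O' ⊆ O ∧ HasLog h O' := by
  obtain ⟨L, hLc, hL⟩ := hlog
  obtain ⟨Lt, hLt⟩ := ContinuousMap.exists_restrict_eq hA ⟨fun z : A => L z, continuousOn_iff_continuous_domRestrict.1 hLc⟩
  have hLt' : ∀ z ∈ A, Lt z = L z := fun z hz => by
    have := congrArg (fun f => f ⟨z, hz⟩) hLt
    exact this
  have hq : ContinuousOn (fun z => h z / Complex.exp (Lt z)) O :=
    hc.div (by fun_prop) (fun z _ => Complex.exp_ne_zero _)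
  refine ⟨O ∩ (fun z => h z / Complex.exp (Lt z)) ⁻¹' Complex.slitPlane,
    hq.isOpen_inter_preimage hO Complex.isOpen_slitPlane, ?_, inter_subset_left, ?_⟩
  · intro z hz
    refine ⟨hAO hz, ?_⟩
    simp only [mem_preimage]
    rw [hLt' z hz, hL z hz, div_self (h0 z (hAO hz))]
    exact Complex.one_mem_slitPlane
  · refine ⟨fun z => Lt z + Complex.log (h z / Complex.exp (Lt z)), ?_, ?_⟩
    · apply ContinuousOn.add (by fun_prop)
      exact (hq.mono inter_subset_left).clog (fun z hz => hz.2)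
    · rintro z ⟨hz, hz2⟩
      rw [Complex.exp_add, Complex.exp_log (Complex.slitPlane_ne_zero hz2)]
      field_simp [Complex.exp_ne_zero]

lemma sep_component {X : Type*} [TopologicalSpace X] [T2Space X] {M T : Set X} (hM : IsCompact M)
    {x : X} (hx : x ∈ M) (hT : IsClosed T) (hd : Disjoint (connectedComponentIn M x) (T ∩ M)) :
    ∃ P Q : Set X, IsCompact P ∧ IsCompact Q ∧ Disjoint P Q ∧ P ∪ Q = M ∧ x ∈ P ∧ T ∩ M ⊆ Q := by
  have : CompactSpace M := isCompact_iff_compactSpace.1 hM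
  let T' : Set M := Subtype.val ⁻¹' T
  have hT' : IsClosed T' := hT.preimage continuous_subtype_val
  have H1 := hT'.isCompact.inter_iInter_nonempty
      (fun s : { s : Set M // IsClopen s ∧ (⟨x, hx⟩ : M) ∈ s } => s.1) fun s => s.2.1.1
  rw [← connectedComponent_eq_iInter_isClopen] at H1
  have hdis : ¬ (T' ∩ connectedComponent (⟨x, hx⟩ : M)).Nonempty := by
    rintro ⟨y, hy1, hy2⟩
    suffices hh : y.1 ∈ connectedComponentIn M x from Set.disjoint_left.1 hd hh ⟨hy1, y.2⟩
    rw [connectedComponentIn_eq_image hx]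
    exact mem_image_of_mem _ hy2
  have H2 := mt H1 hdis
  push Not at H2
  obtain ⟨u, hu⟩ := H2
  set S : Set M := ⋂ i ∈ u, i.1 with hS
  have hSc : IsClopen S := isClopen_biInter_finset fun s _ => s.2.1
  refine ⟨Subtype.val '' S, Subtype.val '' Sᶜ, hSc.1.isCompact.image continuous_subtype_val,
    hSc.compl.1.isCompact.image continuous_subtype_val, ?_, ?_, ?_, ?_⟩
  · rw [Set.disjoint_image_iff Subtype.val_injective]
    exact disjoint_compl_right
  · rw [← image_union, union_compl_self, image_univ, Subtype.range_coe]
  · exact ⟨⟨x, hx⟩, mem_iInter₂.2 fun s _ => s.2.2, rfl⟩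
  · rintro y ⟨hyT, hyM⟩
    refine ⟨⟨y, hyM⟩, fun hyS => ?_, rfl⟩
    have : (⟨y, hyM⟩ : M) ∈ T' ∩ S := ⟨hyT, hyS⟩
    rw [hu] at this
    exact this

lemma arc_reach (J : C(unitInterval, ℂ)) (hJ : Function.Injective J) {C L : Set ℂ}
    (hC : IsCompact C) (hCc : IsPreconnected C) (hL : IsClosed L) (hCL : C ⊆ range J ∪ L)
    {s0 : unitInterval} (hs0 : J s0 ∈ C) (hne : (C ∩ L).Nonempty) :
    ∃ s1, uIcc s0 s1 ⊆ J ⁻¹' C ∧ J s1 ∈ L := by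
  have hS : IsCompact (J ⁻¹' C) := (hC.isClosed.preimage J.continuous).isCompact
  by_cases hd : Disjoint (connectedComponentIn (J ⁻¹' C) s0) (J ⁻¹' L ∩ J ⁻¹' C)
  · exfalso
    obtain ⟨P, Q, hP, hQ, hPQ, hPQS, hsP, hTQ⟩ := sep_component hS hs0 (hL.preimage J.continuous) hd
    have h1 : IsClosed (J '' P) := (hP.image J.continuous).isClosed
    have h2 : IsClosed (J '' Q ∪ (C ∩ L)) :=
      ((hQ.image J.continuous).isClosed).union (hC.isClosed.inter hL)
    have hcov : C ⊆ J '' P ∪ (J '' Q ∪ (C ∩ L)) := by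
      intro z hz
      rcases hCL hz with ⟨s, rfl⟩ | h
      · have : s ∈ P ∪ Q := by rw [hPQS]; exact hz
        rcases this with h | h
        · exact Or.inl ⟨s, h, rfl⟩
        · exact Or.inr (Or.inl ⟨s, h, rfl⟩)
      · exact Or.inr (Or.inr ⟨hz, h⟩)
    obtain ⟨z, hz⟩ := hne
    obtain ⟨w, hwC, ⟨p, hp, rfl⟩, hw⟩ := isPreconnected_closed_iff.1 hCc _ _ h1 h2 hcov ⟨J s0, hs0, ⟨s0, hsP, rfl⟩⟩ ⟨z, hz.1, Or.inr hz⟩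
    rcases hw with ⟨q, hq, hqp⟩ | hw
    · exact Set.disjoint_left.1 hPQ hp (hJ hqp ▸ hq)
    · exact Set.disjoint_left.1 hPQ hp (hTQ ⟨hw.2, hw.1⟩)
  · obtain ⟨s1, h1, h2⟩ := Set.not_disjoint_iff.1 hd
    refine ⟨s1, ?_, h2.1⟩
    have hoc := (isPreconnected_connectedComponentIn (x := s0) (F := J ⁻¹' C)).ordConnected
    exact (hoc.uIcc_subset (mem_connectedComponentIn hs0) h1).trans (connectedComponentIn_subset _ _)

lemma crosscut_aux (η : ℝ) (hη : 0 < η) (t : ℝ) :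
    (((t : ℂ) - Complex.I * η) / (t + Complex.I * η)).im = (-2 * t * η) / (t ^ 2 + η ^ 2) ∧
    (((t : ℂ) - Complex.I * η) / (t + Complex.I * η)).re = (t ^ 2 - η ^ 2) / (t ^ 2 + η ^ 2) := by
  have h : t ^ 2 + η ^ 2 > 0 := by positivity
  constructor
  · simp [Complex.div_im, Complex.normSq_apply]
    field_simp
    ring
  · simp [Complex.div_re, Complex.normSq_apply]
    field_simp
    ring

lemma crosscut {K G : Set ℂ} (hK : IsPreconnected K) {x y : ℂ} (hx : x ∈ K) (hy : y ∈ K)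
    (hxy : x ≠ y) (hG : IsOpen G) (hseg : openSegment ℝ x y ⊆ G) (hGK : Disjoint G K) :
    ∃ w1 ∈ G, ∃ w2 ∈ G, w1 ∉ segment ℝ x y ∧ w2 ∉ segment ℝ x y ∧
      ¬ HasLog (fun z => (z - w1) / (z - w2)) (K ∪ segment ℝ x y) := by
  set m : ℂ := (x + y) / 2 with hm
  set v : ℂ := (y - x) / 2 with hv
  have hv0 : v ≠ 0 := by
    rw [hv]; exact div_ne_zero (sub_ne_zero.2 hxy.symm) two_ne_zero
  have hmG : m ∈ G := by
    apply hseg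
    refine ⟨1/2, 1/2, by norm_num, by norm_num, by norm_num, ?_⟩
    simp only [Complex.real_smul]; push_cast; rw [hm]; ring
  obtain ⟨r, hr, hrG⟩ := Metric.isOpen_iff.1 hG m hmG
  obtain ⟨η, hη, hηr⟩ : ∃ η : ℝ, 0 < η ∧ η * ‖v‖ < r := by
    have : 0 < ‖v‖ := norm_pos_iff.2 hv0
    exact ⟨r / (2 * ‖v‖), by positivity, by field_simp; linarith⟩
  have hηv : ‖Complex.I * η * v‖ < r := by
    simpa [abs_of_pos hη] using hηr
  set w1 : ℂ := m + Complex.I * η * v with hw1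
  set w2 : ℂ := m - Complex.I * η * v with hw2
  have hw1B : w1 ∈ Metric.ball m r := by
    rw [Metric.mem_ball, dist_eq_norm]; simpa [hw1] using hηr.trans_eq' (by simp [abs_of_pos hη])
  have hw2B : w2 ∈ Metric.ball m r := by
    rw [Metric.mem_ball, dist_eq_norm, hw2, sub_sub_cancel_left, norm_neg]; exact hηv
  have hsegt : ∀ z ∈ segment ℝ x y, ∃ t : ℝ, z = m + t * v := by
    rintro z ⟨a, b, ha, hb, hab, rfl⟩
    refine ⟨b - a, ?_⟩
    have hab' : (a : ℂ) + b = 1 := by exact_mod_cast hab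
    simp only [Complex.real_smul]; push_cast; rw [hm, hv]
    linear_combination (-(x + y) / 2 * 1) * (-1) * hab' - 0 * hab'
  have hts : ∀ t ∈ Icc (-1 : ℝ) 1, m + t * v ∈ segment ℝ x y := by
    intro t ht
    refine ⟨(1 - t) / 2, (1 + t) / 2, by linarith [ht.2], by linarith [ht.1], by ring, ?_⟩
    simp only [Complex.real_smul]; push_cast; rw [hm, hv]; ring
  have hI : ∀ t : ℝ, (t : ℂ) ≠ Complex.I * η ∧ (t : ℂ) ≠ -(Complex.I * η) := by
    intro t
    constructor <;> intro h <;> have := congrArg Complex.im h <;> simp at this <;> linarith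
  have hq : ∀ t : ℝ, (m + t * v - w1) / (m + t * v - w2) = ((t : ℂ) - Complex.I * η) / (t + Complex.I * η) := by
    intro t
    have h2 := (hI t).2
    have : (t : ℂ) + Complex.I * η ≠ 0 := fun h => h2 (eq_neg_of_add_eq_zero_left h)
    rw [show m + t * v - w1 = v * (t - Complex.I * η) by rw [hw1]; ring,
      show m + t * v - w2 = v * (t + Complex.I * η) by rw [hw2]; ring, mul_div_mul_left _ _ hv0]
  refine ⟨w1, hrG hw1B, w2, hrG hw2B, ?_, ?_, ?_⟩
  · intro h
    obtain ⟨t, ht⟩ := hsegt _ h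
    exact (hI t).1 (mul_right_cancel₀ hv0 (by linear_combination -ht))
  · intro h
    obtain ⟨t, ht⟩ := hsegt _ h
    exact (hI t).2 (mul_right_cancel₀ hv0 (by linear_combination -ht))
  rintro ⟨L, hLc, hL⟩
  have hKB : K ⊆ (Metric.ball m r)ᶜ := fun z hz hzB => Set.disjoint_left.1 hGK (hrG hzB) hz
  obtain ⟨hl1, hl2⟩ := offball_log (convex_ball m r) hw1B hw2B
  obtain ⟨c, -, hc⟩ := log_diff_const_s11 hK (hLc.mono subset_union_left) (hl1.mono hKB)
    (fun z hz => by rw [hL z (Or.inl hz), hl2 z (hKB hz)])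
  let p : ℝ → ℂ := fun t => ((t : ℂ) - Complex.I * η) / (t + Complex.I * η)
  have hpc : Continuous p := by
    apply Continuous.div (by fun_prop) (by fun_prop)
    intro t h; exact (hI t).2 (eq_neg_of_add_eq_zero_left h)
  have hps : ∀ t, - p t ∈ Complex.slitPlane := by
    intro t
    obtain ⟨h1, h2⟩ := crosscut_aux η hη t
    have hpos : t ^ 2 + η ^ 2 > 0 := by positivity
    rw [Complex.mem_slitPlane_iff]
    by_cases ht : t = 0
    · left; rw [Complex.neg_re]; show 0 < - (p t).re
      have : (p t).re = _ := h2
      rw [this, ht]; simp [hη.ne']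
    · right; rw [Complex.neg_im]; have : (p t).im = _ := h1
      rw [this]
      simp [ht, hη.ne', hpos.ne']
  obtain ⟨c', -, hc'⟩ := log_diff_const_s11 (X := ℝ) (E := Icc (-1 : ℝ) 1) isPreconnected_Icc
    (L := fun t => L (m + t * v)) (l := fun t => Complex.log (- p t) + Real.pi * Complex.I)
    (hLc.comp (by fun_prop) (fun t ht => Or.inr (hts t ht)))
    (ContinuousOn.add (hpc.neg.continuousOn.clog (fun t _ => hps t)) continuousOn_const)
    (fun t ht => by
      show Complex.exp (L (m + t * v)) = _
      rw [hL _ (Or.inr (hts t ht))]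
      show (m + t * v - w1) / (m + t * v - w2) = _
      rw [hq t, Complex.exp_add, Complex.exp_log (Complex.slitPlane_ne_zero (hps t)),
        Complex.exp_pi_mul_I]; simp [p])
  have k1 := hc y hy
  have k2 := hc x hx
  have ey : y = m + (1 : ℝ) * v := by rw [hm, hv]; push_cast; ring
  have ex : x = m + (-1 : ℝ) * v := by rw [hm, hv]; push_cast; ring
  have j1 := hc' 1 (by norm_num)
  have j2 := hc' (-1) (by norm_num)
  have ey' : (y - w1) / (y - w2) = p 1 := by
    have := hq 1; rw [← ey] at this; exact this
  have ex' : (x - w1) / (x - w2) = p (-1) := by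
    have := hq (-1); rw [← ex] at this; exact this
  rw [← ey, k1, ey'] at j1
  rw [← ex, k2, ex'] at j2
  have hpos : (0 : ℝ) < 1 + η ^ 2 := by positivity
  have i1 : (p 1).im < 0 := by
    have : (p 1).im = _ := (crosscut_aux η hη 1).1
    rw [this]; apply div_neg_of_neg_of_pos <;> nlinarith
  have i2 : 0 < (p (-1)).im := by
    have : (p (-1)).im = _ := (crosscut_aux η hη (-1)).1
    rw [this]; apply div_pos <;> nlinarith
  have a1 : (p 1).arg < 0 := Complex.arg_neg_iff.2 i1
  have a2 : 0 ≤ (p (-1)).arg := Complex.arg_nonneg_iff.2 i2.le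
  have a3 : (-p (-1)).arg < 0 := Complex.arg_neg_iff.2 (by simpa using i2)
  have a4 : 0 ≤ (-p 1).arg := Complex.arg_nonneg_iff.2 (by simpa using i1.le)
  have b1 := congrArg Complex.im j1
  have b2 := congrArg Complex.im j2
  simp only [Complex.add_im, Complex.log_im] at b1 b2
  linarith

lemma preconn_subset_of_frontier {P G : Set ℂ} (hP : IsPreconnected P) (hG : IsOpen G)
    (hd : Disjoint P (frontier G)) (hne : (P ∩ G).Nonempty) : P ⊆ G := by
  have : P ⊆ G ∪ (closure G)ᶜ := by
    intro z hz
    by_cases h : z ∈ closure G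
    · left
      by_contra hzG
      exact Set.disjoint_left.1 hd hz ⟨h, by rwa [hG.interior_eq]⟩
    · exact Or.inr h
  exact hP.subset_left_of_subset_union hG isClosed_closure.isOpen_compl
    (Set.disjoint_left.2 fun z hz hz' => hz' (subset_closure hz)) this hne

lemma disj_frontier {G : Set ℂ} (hG : IsOpen G) : Disjoint G (frontier G) :=
  Set.disjoint_left.2 fun z hz hz' => hz'.2 (by rwa [hG.interior_eq])

lemma compact_component {X : Type*} [TopologicalSpace X] {F : Set X} (hF : IsCompact F) {x : X} (hx : x ∈ F) :
    IsCompact (connectedComponentIn F x) := by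
  have : CompactSpace F := isCompact_iff_compactSpace.1 hF
  rw [connectedComponentIn_eq_image hx]
  exact isClosed_connectedComponent.isCompact.image continuous_subtype_val

lemma hasLog_glue_pt {h : ℂ → ℂ} {A M : Set ℂ} (hA : IsClosed A) (hM : IsClosed M) (p : ℂ)
    (h1 : HasLog h A) (h2 : HasLog h M) (hAM : A ∩ M ⊆ {p}) : HasLog h (A ∪ M) := by
  obtain ⟨L, hL, hL'⟩ := h1
  obtain ⟨l, hl, hl'⟩ := h2
  by_cases hp : p ∈ A ∩ M
  · refine hasLog_glue (c := L p - l p) hA hM hL hL' hl hl' ?_ ?_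
    · rw [Complex.exp_sub, hL' p hp.1, ← hl' p hp.2, div_self (Complex.exp_ne_zero _)]
    · intro z hz hz'
      rw [hAM ⟨hz, hz'⟩]; ring
  · refine hasLog_glue (c := 0) hA hM hL hL' hl hl' (by simp) ?_
    intro z hz hz'
    exact absurd (hAM ⟨hz, hz'⟩ ▸ ⟨hz, hz'⟩) hp

lemma isCompact_seg (x y : ℂ) : IsCompact (segment ℝ x y) := by
  rw [segment_eq_image_lineMap]
  exact isCompact_Icc.image (by fun_prop)

lemma isPreconnected_seg (x y : ℂ) : IsPreconnected (segment ℝ x y) :=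
  (convex_segment x y).isPreconnected

lemma hasLog_seg {x y : ℂ} (hxy : x ≠ y) (h : ℂ → ℂ)
    (hc : ContinuousOn h (segment ℝ x y)) (h0 : ∀ z ∈ segment ℝ x y, h z ≠ 0) :
    HasLog h (segment ℝ x y) := by
  let J : C(unitInterval, ℂ) := ⟨fun t => AffineMap.lineMap x y (t : ℝ), by fun_prop⟩
  have hr : range J = segment ℝ x y := by
    rw [segment_eq_image_lineMap]
    ext z; constructor
    · rintro ⟨t, rfl⟩; exact ⟨t, t.2, rfl⟩
    · rintro ⟨t, ht, rfl⟩; exact ⟨⟨t, ht⟩, rfl⟩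
  have := hasLog_arc J (fun s t hst => Subtype.ext (AffineMap.lineMap_injective ℝ hxy hst)) h
    (by rwa [hr]) (by rwa [hr])
  rwa [hr] at this

lemma seg_inter {K G : Set ℂ} {x y : ℂ} (hseg : openSegment ℝ x y ⊆ G) (hGK : Disjoint G K)
    {z : ℂ} (hz : z ∈ segment ℝ x y) (hzK : z ∈ K) : z = x ∨ z = y := by
  by_contra hcon
  push Not at hcon
  have := mem_openSegment_of_ne_left_right hcon.1.symm hcon.2.symm hz
  exact Set.disjoint_left.1 hGK (hseg this) hzK

/-- crosscut component and a connected piece of its boundary. -/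
lemma crosscut_comp {G : Set ℂ} (hGo : IsOpen G) (hGc : IsPreconnected G) (hGb : Bornology.IsBounded G)
    (hKc : IsPreconnected (frontier G)) {x y : ℂ} (hx : x ∈ frontier G) (hy : y ∈ frontier G)
    (hxy : x ≠ y) (hseg : openSegment ℝ x y ⊆ G) {ω : ℂ} (hω : ω ∈ G) (hωs : ω ∉ segment ℝ x y) :
    ∃ W C : Set ℂ, IsOpen W ∧ W ⊆ G ∧ frontier W ⊆ frontier G ∪ segment ℝ x y ∧ ω ∉ W ∧
      (∀ P, IsPreconnected P → Disjoint P (frontier G ∪ segment ℝ x y) → (P ∩ W).Nonempty → P ⊆ W) ∧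
      IsCompact C ∧ IsPreconnected C ∧ C ⊆ closure W ∩ frontier G ∧ x ∈ C ∧ y ∈ C := by
  have hGK := disj_frontier hGo
  have hKcl : IsClosed (frontier G) := isClosed_frontier
  set A := frontier G ∪ segment ℝ x y with hA
  have hAcl : IsClosed A := hKcl.union (isCompact_seg x y).isClosed
  have hUo : IsOpen Aᶜ := hAcl.isOpen_compl
  have hGA : ∀ z ∈ G, z ∉ segment ℝ x y → z ∈ Aᶜ := by
    rintro z hz hzs (h | h)
    · exact Set.disjoint_left.1 hGK hz h
    · exact hzs h
  obtain ⟨w0, hw0G, hw0s, hw0⟩ : ∃ w0 ∈ G, w0 ∉ segment ℝ x y ∧ w0 ∉ connectedComponentIn Aᶜ ω := by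
    obtain ⟨w1, h1, w2, h2, h1s, h2s, hno⟩ := crosscut hKc hx hy hxy hGo hseg hGK
    by_contra hcon
    push Not at hcon
    apply hno
    exact hasLog_of_preconnected hAcl isPreconnected_connectedComponentIn
      (Set.disjoint_left.2 fun z hz => connectedComponentIn_subset _ _ hz) (hcon w1 h1 h1s) (hcon w2 h2 h2s)
  have hw0A : w0 ∈ Aᶜ := hGA w0 hw0G hw0s
  have hωA : ω ∈ Aᶜ := hGA ω hω hωs
  set W := connectedComponentIn Aᶜ w0 with hW
  have hWA : W ⊆ Aᶜ := connectedComponentIn_subset _ _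
  have hw0W : w0 ∈ W := mem_connectedComponentIn hw0A
  have hWo : IsOpen W := hUo.connectedComponentIn
  have hWp : IsPreconnected W := isPreconnected_connectedComponentIn
  have hWG : W ⊆ G := preconn_subset_of_frontier hWp hGo
    (Set.disjoint_left.2 fun z hz hz' => hWA hz (Or.inl hz')) ⟨w0, hw0W, hw0G⟩
  have hωW : ω ∉ W := by
    intro h
    rw [hW, connectedComponentIn_eq h] at hw0W
    exact hw0 hw0W
  have hmax : ∀ P, IsPreconnected P → Disjoint P A → (P ∩ W).Nonempty → P ⊆ W := by
    rintro P hP hPA ⟨z, hzP, hzW⟩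
    rw [hW, connectedComponentIn_eq hzW]
    exact hP.subset_connectedComponentIn hzP (Set.subset_compl_iff_disjoint_right.2 hPA)
  have hfr : frontier W ⊆ A := by
    intro z hz
    by_contra hzA
    have hzA' : z ∈ Aᶜ := hzA
    have ho : IsOpen (connectedComponentIn Aᶜ z) := hUo.connectedComponentIn
    have hne := mem_closure_iff.1 hz.1 _ ho (mem_connectedComponentIn hzA')
    have := hmax _ isPreconnected_connectedComponentIn
      (Set.disjoint_left.2 fun z hz => connectedComponentIn_subset _ _ hz) hne (mem_connectedComponentIn hzA')
    rw [hWo.frontier_eq] at hz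
    exact hz.2 this
  refine ⟨W, ?_⟩
  have hcW : closure W ⊆ closure G := closure_mono hWG
  have hWb : Bornology.IsBounded W := hGb.subset hWG
  have hKcpt : IsCompact (frontier G) := hGb.isCompact_closure.of_isClosed_subset hKcl frontier_subset_closure
  set F := closure W ∩ frontier G with hF
  have hFc : IsCompact F := hKcpt.inter_left isClosed_closure
  suffices hC : ∃ C, IsCompact C ∧ IsPreconnected C ∧ C ⊆ F ∧ x ∈ C ∧ y ∈ C by
    obtain ⟨C, hC⟩ := hC
    exact ⟨C, hWo, hWG, hfr, hωW, hmax, hC⟩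
  by_contra hcon
  obtain ⟨E, E', hEc, hE'c, hEE, hEF, hyE, hxE'⟩ : ∃ E E' : Set ℂ, IsCompact E ∧ IsCompact E' ∧ Disjoint E E' ∧
      E ∪ E' = F ∧ y ∉ E ∧ x ∉ E' := by
    by_cases hxF : x ∈ F
    · have hd : Disjoint (connectedComponentIn F x) ({y} ∩ F) := by
        rw [Set.disjoint_left]
        rintro z hz ⟨hzy, hzF⟩
        have hzy' : z = y := hzy
        subst hzy'
        refine hcon ⟨connectedComponentIn F x, ?_, isPreconnected_connectedComponentIn,
          connectedComponentIn_subset _ _, mem_connectedComponentIn hxF, hz⟩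
        exact compact_component hFc hxF
      obtain ⟨P, Q, hP, hQ, hPQ, hu, hxP, hTQ⟩ := sep_component hFc hxF isClosed_singleton hd
      refine ⟨P, Q, hP, hQ, hPQ, hu, ?_, fun h => Set.disjoint_left.1 hPQ hxP h⟩
      intro h
      exact Set.disjoint_left.1 hPQ h (hTQ ⟨rfl, hu ▸ Or.inl h⟩)
    · exact ⟨∅, F, isCompact_empty, hFc, by simp, by simp, by simp, hxF⟩
  have hlogK := hasLog_of_preconnected hKcl hGc hGK hw0G hω
  have hEK : E ⊆ frontier G := fun z hz => (hEF ▸ (Or.inl hz : z ∈ E ∪ E') : z ∈ F).2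
  have hE'K : E' ⊆ frontier G := fun z hz => (hEF ▸ (Or.inr hz : z ∈ E ∪ E') : z ∈ F).2
  have hlogS : HasLog (fun z => (z - w0) / (z - ω)) (segment ℝ x y) := by
    have n1 : ∀ z ∈ segment ℝ x y, z - w0 ≠ 0 := fun z hz h => hw0s (sub_eq_zero.1 h ▸ hz)
    have n2 : ∀ z ∈ segment ℝ x y, z - ω ≠ 0 := fun z hz h => hωs (sub_eq_zero.1 h ▸ hz)
    exact hasLog_seg hxy _ (ContinuousOn.div (by fun_prop) (by fun_prop) n2)
      (fun z hz => div_ne_zero (n1 z hz) (n2 z hz))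
  have hscl := (isCompact_seg x y).isClosed
  have g1 := hasLog_glue_pt hEc.isClosed hscl x (hlogK.mono hEK) hlogS (by
    rintro z ⟨hz, hzs⟩
    rcases seg_inter hseg hGK hzs (hEK hz) with h | h
    · exact h
    · exact absurd (h ▸ hz) hyE)
  have g2 := hasLog_glue_pt (hEc.isClosed.union hscl) hE'c.isClosed y g1 (hlogK.mono hE'K) (by
    rintro z ⟨hz | hzs, hz'⟩
    · exact absurd hz' (Set.disjoint_left.1 hEE hz)
    · rcases seg_inter hseg hGK hzs (hE'K hz') with h | h
      · exact absurd (h ▸ hz') hxE'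
      · exact h)
  have hωcl : ∀ z ∈ closure W, z - ω ≠ 0 := by
    intro z hz h
    rw [sub_eq_zero.1 h] at hz
    exact hωA (hfr ⟨hz, by rwa [hWo.interior_eq]⟩)
  have := eilenberg (k := 1) hWb ((hEc.isClosed.union hscl).union hE'c.isClosed) (A := E ∪ segment ℝ x y ∪ E') (by
      intro z hz
      rcases hfr hz with h | h
      · have : z ∈ E ∪ E' := by rw [hEF]; exact ⟨hz.1, h⟩
        rcases this with h | h
        · exact Or.inl (Or.inl h)
        · exact Or.inr h
      · exact Or.inl (Or.inr h)) hWo hw0W (fun z => (z - ω)⁻¹)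
      (ContinuousOn.inv₀ (by fun_prop) hωcl) (fun z hz => inv_ne_zero (hωcl z hz))
      (g2.congr (fun z hz => by simp [div_eq_mul_inv]))
  exact one_ne_zero this

lemma crosscut_avoid {G W E : Set ℂ} (hGo : IsOpen G) (hGc : IsPreconnected G) (hGb : Bornology.IsBounded G)
    {x y : ℂ} (hseg : openSegment ℝ x y ⊆ G) (hWo : IsOpen W) (hWG : W ⊆ G)
    (hfr : frontier W ⊆ frontier G ∪ segment ℝ x y) {q : ℂ} {ρ : ℝ}
    (hBs : Disjoint (Metric.ball q ρ) (segment ℝ x y)) {w2 : ℂ} (hw2G : w2 ∈ G) (hw2B : w2 ∈ Metric.ball q ρ)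
    (hw2W : w2 ∉ W) (hE : IsPreconnected E) (hEK : E ⊆ frontier G) (hEB : Disjoint E (Metric.ball q ρ))
    (hxE : x ∈ E) (hyE : y ∈ E) : Disjoint W (Metric.ball q ρ) := by
  rw [Set.disjoint_left]
  intro w1 hw1W hw1B
  have hGK := disj_frontier hGo
  have hKcl : IsClosed (frontier G) := isClosed_frontier
  obtain ⟨L, hL, hL'⟩ := hasLog_of_preconnected hKcl hGc hGK (hWG hw1W) hw2G
  obtain ⟨hl, hl'⟩ := offball_log (convex_ball q ρ) hw1B hw2B
  have hEB' : E ⊆ (Metric.ball q ρ)ᶜ := Set.subset_compl_iff_disjoint_right.2 hEB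
  have hSB' : segment ℝ x y ⊆ (Metric.ball q ρ)ᶜ := Set.subset_compl_iff_disjoint_left.2 hBs
  obtain ⟨c, hc, hc'⟩ := log_diff_const_s11 hE (hL.mono hEK) (hl.mono hEB')
    (fun z hz => by rw [hL' z (hEK hz), hl' z (hEB' hz)])
  have g := hasLog_glue hKcl (isCompact_seg x y).isClosed hL hL' (hl.mono hSB')
    (fun z hz => hl' z (hSB' hz)) hc (by
      intro z hz hzs
      rcases seg_inter hseg hGK hzs hz with rfl | rfl
      · exact hc' _ hxE
      · exact hc' _ hyE)
  have hωcl : ∀ z ∈ closure W, z - w2 ≠ 0 := by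
    intro z hz h
    rw [sub_eq_zero.1 h] at hz
    rcases hfr ⟨hz, by rwa [hWo.interior_eq]⟩ with h | h
    · exact Set.disjoint_left.1 hGK hw2G h
    · exact hSB' h hw2B
  have := eilenberg (k := 1) (hGb.subset hWG) (hKcl.union (isCompact_seg x y).isClosed) hfr hWo hw1W
      (fun z => (z - w2)⁻¹)
      (ContinuousOn.inv₀ (by fun_prop) hωcl) (fun z hz => inv_ne_zero (hωcl z hz))
      (g.congr (fun z hz => by simp [div_eq_mul_inv]))
  exact one_ne_zero this

lemma pc_union {s t : Set ℂ} (hs : IsPreconnected s) (ht : IsPreconnected t) (x : ℂ) (h1 : x ∈ s) (h2 : x ∈ t) :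
    IsPreconnected (s ∪ t) := IsPreconnected.union x h1 h2 hs ht

lemma pc_image {J : C(unitInterval, ℂ)} {u v : unitInterval} : IsPreconnected (J '' Icc u v) :=
  isPreconnected_Icc.image _ J.continuous.continuousOn

namespace AdmissibleDomain

lemma r1 (D : AdmissibleDomain) : range D.J1 ⊆ frontier D.G := fun _ h => D.boundary ▸ Or.inl (Or.inl h)
lemma r2 (D : AdmissibleDomain) : range D.J2 ⊆ frontier D.G := fun _ h => D.boundary ▸ Or.inl (Or.inr h)
lemma r3 (D : AdmissibleDomain) : range D.J3 ⊆ frontier D.G := fun _ h => D.boundary ▸ Or.inr h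

lemma isPreconnected_frontier (D : AdmissibleDomain) : IsPreconnected (frontier D.G) := by
  rw [← D.boundary]
  have h1 : IsPreconnected (range D.J1) := isPreconnected_range D.J1.continuous
  have h2 : IsPreconnected (range D.J2) := isPreconnected_range D.J2.continuous
  have h3 : IsPreconnected (range D.J3) := isPreconnected_range D.J3.continuous
  have h12 := pc_union h1 h2 D.a ⟨1, D.e11⟩ ⟨0, D.e20⟩
  exact pc_union h12 h3 D.c (Or.inr ⟨1, D.e21⟩) ⟨0, D.e30⟩

lemma isCompact_frontier (D : AdmissibleDomain) : IsCompact (frontier D.G) :=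
  D.bounded.isCompact_closure.of_isClosed_subset isClosed_frontier frontier_subset_closure

lemma ray_notMem (D : AdmissibleDomain) {γ : ℝ → ℂ} (hc : Continuous γ)
    (ht : Tendsto (fun t => ‖γ t‖) atTop atTop) {t0 : ℝ}
    (hf : ∀ t : ℝ, t0 ≤ t → γ t ∉ frontier D.G) : γ t0 ∉ closure D.G := by
  intro hcl
  have hG : γ t0 ∈ D.G := by
    by_contra h
    exact hf t0 le_rfl ⟨hcl, by rwa [D.isOpen.interior_eq]⟩
  have hP : IsPreconnected (γ '' Ici t0) := isPreconnected_Ici.image _ hc.continuousOn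
  have hsub : γ '' Ici t0 ⊆ D.G := preconn_subset_of_frontier hP D.isOpen
    (by rw [Set.disjoint_left]; rintro _ ⟨t, ht, rfl⟩; exact hf t ht) ⟨γ t0, ⟨t0, self_mem_Ici, rfl⟩, hG⟩
  obtain ⟨R, hR⟩ := D.bounded.exists_norm_le
  obtain ⟨t, ht1, ht2⟩ := ((ht.eventually_gt_atTop R).and (eventually_ge_atTop t0)).exists
  exact absurd (hR _ (hsub ⟨t, ht2, rfl⟩)) (not_le.2 ht1)

lemma no_log (D : AdmissibleDomain) {w u : ℂ} (hw : w ∈ D.G) (hu : u ∉ closure D.G) :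
    ¬ HasLog (fun z => (z - w) / (z - u)) (frontier D.G) := by
  intro hlog
  have hcl : ∀ z ∈ closure D.G, z - u ≠ 0 := by
    intro z hz h
    rw [sub_eq_zero.1 h] at hz
    exact hu hz
  have := eilenberg (k := 1) D.bounded isClosed_frontier subset_rfl D.isOpen hw
      (fun z => (z - u)⁻¹)
      (ContinuousOn.inv₀ (by fun_prop) hcl) (fun z hz => inv_ne_zero (hcl z hz))
      (hlog.congr (fun z hz => by simp [div_eq_mul_inv]))
  exact one_ne_zero this

lemma ac_ne (D : AdmissibleDomain) : D.a ≠ D.c := by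
  rw [← D.e20, ← D.e21]; exact fun h => zero_ne_one (D.inj2 h)
lemma ad_ne (D : AdmissibleDomain) : D.a ≠ D.d := by
  rw [← D.e10, ← D.e11]; exact fun h => zero_ne_one (D.inj1 h).symm

lemma touch1 (D : AdmissibleDomain) {z : ℂ} (h3 : z ∈ range D.J3) (h1 : z ∈ range D.J1) : z = D.d ∨ z = D.a := by
  by_contra h
  have : z ∈ range D.J3 ∩ (range D.J1 \ {D.d, D.a}) := ⟨h3, h1, by simpa using h⟩
  rw [D.noTouch1] at this; exact this
lemma touch2 (D : AdmissibleDomain) {z : ℂ} (h3 : z ∈ range D.J3) (h1 : z ∈ range D.J2) : z = D.a ∨ z = D.c := by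
  by_contra h
  have : z ∈ range D.J3 ∩ (range D.J2 \ {D.a, D.c}) := ⟨h3, h1, by simpa using h⟩
  rw [D.noTouch2] at this; exact this

end AdmissibleDomain

lemma isPreconnected_far {R : ℝ} (hR : 0 < R) : IsPreconnected {z : ℂ | R < ‖z‖} := by
  have : {z : ℂ | R < ‖z‖} = Complex.exp '' {w : ℂ | Real.log R < w.re} := by
    ext z; constructor
    · intro hz
      have hz' : R < ‖z‖ := hz
      have hz0 : z ≠ 0 := norm_pos_iff.1 (hR.trans hz')
      refine ⟨Complex.log z, ?_, Complex.exp_log hz0⟩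
      simp only [mem_ofPred_eq, Complex.log_re]
      exact Real.log_lt_log hR hz'
    · rintro ⟨w, hw, rfl⟩
      simp only [mem_ofPred_eq, Complex.norm_exp]
      exact (Real.log_lt_iff_lt_exp hR).1 hw
  rw [this]
  exact (convex_halfSpace_re_gt _).isPreconnected.image _ Complex.continuous_exp.continuousOn

lemma exists_ball_disjoint {N : Set ℂ} (hN : IsClosed N) {p : ℂ} (hp : p ∉ N) :
    ∃ ρ > 0, Disjoint (Metric.ball p ρ) N := by
  obtain ⟨ρ, h, h'⟩ := Metric.isOpen_iff.1 hN.isOpen_compl p hp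
  exact ⟨ρ, h, Set.disjoint_left.2 h'⟩

lemma AdmissibleDomain.a_notMem (D : AdmissibleDomain) : D.a ∉ range D.J3 := by
  rintro ⟨s, hs⟩
  have hs0 : 0 < s := by
    rw [unitInterval.pos_iff_ne_zero]; rintro rfl; exact D.ac_ne (hs ▸ D.e30)
  have hs1 : s < 1 := by
    rw [unitInterval.lt_one_iff_ne_one]; rintro rfl; exact D.ad_ne (hs ▸ D.e31)
  have hcl : ∀ u v : unitInterval, IsClosed (D.J3 '' Icc u v) := fun u v =>
    (isCompact_Icc.image D.J3.continuous).isClosed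
  have hc1 : IsClosed (range D.J1) := (isCompact_range D.J1.continuous).isClosed
  have hc2 : IsClosed (range D.J2) := (isCompact_range D.J2.continuous).isClosed
  obtain ⟨σ, hσ0, hσs⟩ := exists_between hs0
  obtain ⟨v', hsv', hv'1⟩ := exists_between hs1
  obtain ⟨v1, hsv1, hv1v'⟩ := exists_between hsv'
  obtain ⟨v2, hv'v2, hv21⟩ := exists_between hv'1
  set L1 := D.J3 '' Icc s 1 ∪ range D.J1 with hL1
  have hL1c : IsClosed L1 := (hcl _ _).union hc1
  have hL1K : L1 ⊆ frontier D.G := union_subset ((image_subset_range _ _).trans D.r3) D.r1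
  have hp : D.J3 σ ∉ L1 := by
    rintro (⟨t, ht, hh⟩ | h)
    · rw [D.inj3 hh] at ht; exact absurd ht.1 (not_le.2 hσs)
    · rcases D.touch1 (mem_range_self σ) h with h | h
      · rw [← D.e31] at h; exact (hσs.trans hs1).ne (D.inj3 h)
      · rw [← hs] at h; exact hσs.ne (D.inj3 h)
  obtain ⟨r, hr, hrd⟩ := exists_ball_disjoint hL1c hp
  set N := range D.J1 ∪ range D.J2 ∪ D.J3 '' Icc 0 v1 ∪ D.J3 '' Icc v2 1 with hN
  have hNc : IsClosed N := ((hc1.union hc2).union (hcl _ _)).union (hcl _ _)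
  have hp' : D.J3 v' ∉ N := by
    rintro (((h | h) | ⟨t, ht, hh⟩) | ⟨t, ht, hh⟩)
    · rcases D.touch1 (mem_range_self v') h with h | h
      · rw [← D.e31] at h; exact hv'1.ne (D.inj3 h)
      · rw [← hs] at h; exact hsv'.ne (D.inj3 h).symm
    · rcases D.touch2 (mem_range_self v') h with h | h
      · rw [← hs] at h; exact hsv'.ne (D.inj3 h).symm
      · rw [← D.e30] at h; exact (hs0.trans hsv').ne (D.inj3 h).symm
    · rw [D.inj3 hh] at ht; exact absurd ht.2 (not_le.2 hv1v')
    · rw [D.inj3 hh] at ht; exact absurd ht.1 (not_le.2 hv'v2)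
  obtain ⟨ρ, hρ, hρd⟩ := exists_ball_disjoint hNc hp'
  obtain ⟨γ, hγc, hγ0, hγt, hγf⟩ := D.toInfinity _ (mem_range_self σ)
  obtain ⟨γ', hγ'c, hγ'0, hγ't, hγ'f⟩ := D.toInfinity _ (mem_range_self v')
  obtain ⟨w', hw'B, hw'G⟩ := mem_closure_iff.1 (D.r3 (mem_range_self v')).1 _ Metric.isOpen_ball
    (Metric.mem_ball_self hρ)
  obtain ⟨w, hwB, hwG⟩ := mem_closure_iff.1 (D.r3 (mem_range_self σ)).1 _ Metric.isOpen_ball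
    (Metric.mem_ball_self hr)
  have near : ∀ (γ : ℝ → ℂ) (p : ℂ) (ρ : ℝ), 0 < ρ → Continuous γ → γ 0 = p → ∃ t > 0, γ t ∈ Metric.ball p ρ := by
    intro γ p ρ hρ hc h0
    have h1 : ∀ᶠ t in 𝓝[>] (0 : ℝ), γ t ∈ Metric.ball p ρ :=
      (hc.tendsto 0).mono_left nhdsWithin_le_nhds (by rw [h0]; exact Metric.ball_mem_nhds _ hρ)
    obtain ⟨t, ht, ht'⟩ := (h1.and self_mem_nhdsWithin).exists
    exact ⟨t, ht', ht⟩
  obtain ⟨t', ht'0, ht'B⟩ := near γ' _ ρ hρ hγ'c hγ'0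
  obtain ⟨t, ht0, htB⟩ := near γ _ r hr hγc hγ0
  have hu' : γ' t' ∉ closure D.G := D.ray_notMem hγ'c hγ't (fun t ht => hγ'f t (ht'0.trans_le ht))
  obtain ⟨R, hR0, hR⟩ : ∃ R > 0, ∀ z ∈ frontier D.G, ‖z‖ ≤ R := by
    obtain ⟨R, hR⟩ := D.isCompact_frontier.isBounded.exists_norm_le
    exact ⟨max R 1, by positivity, fun z hz => (hR z hz).trans (le_max_left _ _)⟩
  have hS : HasLog (fun z => (z - w') / (z - γ' t')) L1 := by
    have i1 : IsPreconnected (γ '' Ioi 0) := isPreconnected_Ioi.image _ hγc.continuousOn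
    have i2 : IsPreconnected (γ' '' Ioi 0) := isPreconnected_Ioi.image _ hγ'c.continuousOn
    obtain ⟨τ, hτ1, hτ2⟩ := ((hγt.eventually_gt_atTop R).and (eventually_gt_atTop 0)).exists
    obtain ⟨τ', hτ'1, hτ'2⟩ := ((hγ't.eventually_gt_atTop R).and (eventually_gt_atTop 0)).exists
    have k1 := IsPreconnected.union w hwG hwB D.connected.isPreconnected (convex_ball _ r).isPreconnected
    have k2 := pc_union k1 i1 (γ t) (Or.inr htB) ⟨t, ht0, rfl⟩
    have k3 := pc_union k2 (isPreconnected_far hR0) (γ τ) (Or.inr ⟨τ, hτ2, rfl⟩) hτ1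
    have k4 := pc_union k3 i2 (γ' τ') (Or.inr hτ'1) ⟨τ', hτ'2, rfl⟩
    refine hasLog_of_preconnected hL1c k4 ?_ (Or.inl (Or.inl (Or.inl (Or.inl hw'G)))) (Or.inr ⟨t', ht'0, rfl⟩)
    rw [Set.disjoint_left]
    rintro z ((((h | h) | ⟨t, ht, rfl⟩) | h) | ⟨t, ht, rfl⟩) hz
    · exact Set.disjoint_left.1 (disj_frontier D.isOpen) h (hL1K hz)
    · exact Set.disjoint_left.1 hrd h hz
    · exact hγf t ht (hL1K hz)
    · exact absurd (hR z (hL1K hz)) (not_le.2 h)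
    · exact hγ'f t ht (hL1K hz)
  obtain ⟨L, hL, hL'⟩ := hS
  obtain ⟨hl, hl'⟩ := offball_log (convex_ball _ ρ) hw'B ht'B
  have hNB : N ⊆ (Metric.ball (D.J3 v') ρ)ᶜ := Set.subset_compl_iff_disjoint_left.2 hρd
  set E := range D.J1 ∪ D.J3 '' Icc s v1 ∪ D.J3 '' Icc v2 1 with hE
  have hEc : IsPreconnected E := by
    have h1 : IsPreconnected (range D.J1) := isPreconnected_range D.J1.continuous
    have h2 := pc_union h1 (pc_image (J := D.J3) (u := s) (v := v1)) D.a ⟨1, D.e11⟩ ⟨s, ⟨le_rfl, hsv1.le⟩, hs⟩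
    exact pc_union h2 pc_image D.d (Or.inl ⟨0, D.e10⟩) ⟨1, ⟨hv21.le, le_rfl⟩, D.e31⟩
  have hEL1 : E ⊆ L1 := by
    rintro z ((h | ⟨t, ht, rfl⟩) | ⟨t, ht, rfl⟩)
    · exact Or.inr h
    · exact Or.inl ⟨t, ⟨ht.1, ht.2.trans (hv1v'.trans hv'1).le⟩, rfl⟩
    · exact Or.inl ⟨t, ⟨(hsv'.trans hv'v2).le.trans ht.1, ht.2⟩, rfl⟩
  have hEN : E ⊆ N := by
    rintro z ((h | ⟨t, ht, rfl⟩) | ⟨t, ht, rfl⟩)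
    · exact Or.inl (Or.inl (Or.inl h))
    · exact Or.inl (Or.inr ⟨t, ⟨hs0.le.trans ht.1, ht.2⟩, rfl⟩)
    · exact Or.inr ⟨t, ht, rfl⟩
  obtain ⟨c, hc, hc'⟩ := log_diff_const_s11 hEc (hL.mono hEL1) (hl.mono (hEN.trans hNB))
    (fun z hz => by rw [hL' z (hEL1 hz), hl' z (hNB (hEN hz))])
  have hglue := hasLog_glue hL1c hNc hL hL' (hl.mono hNB) (fun z hz => hl' z (hNB hz)) hc (by
    intro z hz hzN
    apply hc'
    rcases hz with ⟨t, ht, rfl⟩ | hz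
    · rcases hzN with ((h | h) | ⟨t', ht', hh⟩) | h
      · exact Or.inl (Or.inl h)
      · rcases D.touch2 (mem_range_self t) h with h | h
        · exact Or.inl (Or.inl ⟨1, by rw [h, D.e11]⟩)
        · rw [← D.e30] at h; rw [D.inj3 h] at ht; exact absurd ht.1 (not_le.2 hs0)
      · rw [D.inj3 hh] at ht'; exact Or.inl (Or.inr ⟨t, ⟨ht.1, ht'.2⟩, rfl⟩)
      · exact Or.inr h
    · exact Or.inl (Or.inl hz))
  refine D.no_log hw'G hu' (hglue.mono ?_)
  rw [← D.boundary]
  rintro z ((h | h) | ⟨t, rfl⟩)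
  · exact Or.inl (Or.inr h)
  · exact Or.inr (Or.inl (Or.inl (Or.inr h)))
  · rcases le_total s t with h | h
    · exact Or.inl (Or.inl ⟨t, ⟨h, t.2.2⟩, rfl⟩)
    · exact Or.inr (Or.inl (Or.inr ⟨t, ⟨t.2.1, h.trans hsv1.le⟩, rfl⟩))

namespace AdmissibleDomain
lemma meet1 (D : AdmissibleDomain) {s t : unitInterval} (h : D.J1 s = D.J3 t) : s = 0 ∧ t = 1 := by
  have : D.J1 s = D.d := by
    rcases D.touch1 (z := D.J1 s) ⟨t, h.symm⟩ ⟨s, rfl⟩ with h' | h'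
    · exact h'
    · exact absurd ⟨t, by rw [← h, h']⟩ D.a_notMem
  exact ⟨D.inj1 (by rw [this, D.e10]), D.inj3 (by rw [← h, this, D.e31])⟩
lemma meet2 (D : AdmissibleDomain) {s t : unitInterval} (h : D.J2 s = D.J3 t) : s = 1 ∧ t = 0 := by
  have : D.J2 s = D.c := by
    rcases D.touch2 (z := D.J2 s) ⟨t, h.symm⟩ ⟨s, rfl⟩ with h' | h'
    · exact absurd ⟨t, by rw [← h, h']⟩ D.a_notMem
    · exact h'
  exact ⟨D.inj2 (by rw [this, D.e21]), D.inj3 (by rw [← h, this, D.e30])⟩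
end AdmissibleDomain

lemma IsReparam.surj {φ : unitInterval → unitInterval} (h : IsReparam φ) (s : unitInterval) : ∃ t, φ t = s :=
  mem_range_of_exists_le_of_exists_ge h.1 ⟨0, by rw [h.2.2.1]; exact s.2.1⟩ ⟨1, by rw [h.2.2.2]; exact s.2.2⟩

lemma IsReparam.surj_le {φ : unitInterval → unitInterval} (h : IsReparam φ) {s t : unitInterval} (hs : s ≤ φ t) :
    ∃ τ ≤ t, φ τ = s := by
  obtain ⟨τ, rfl⟩ := h.surj s
  rcases le_total τ t with hh | hh
  · exact ⟨τ, hh, rfl⟩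
  · exact ⟨t, le_rfl, le_antisymm (h.2.1 hh) hs⟩

lemma IsReparam.surj_ge {φ : unitInterval → unitInterval} (h : IsReparam φ) {s t : unitInterval} (hs : φ t ≤ s) :
    ∃ τ, t ≤ τ ∧ φ τ = s := by
  obtain ⟨τ, rfl⟩ := h.surj s
  rcases le_total t τ with hh | hh
  · exact ⟨τ, hh, rfl⟩
  · exact ⟨t, le_rfl, le_antisymm hs (h.2.1 hh)⟩

/-- parametrized convergence of arcs -/
structure ArcConv (Jn : ℕ → C(unitInterval, ℂ)) (J : C(unitInterval, ℂ)) (φ ψ : ℕ → unitInterval → unitInterval) : Prop where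
  hφ : ∀ n, IsReparam (φ n)
  hψ : ∀ n, IsReparam (ψ n)
  conv : ∀ ε > 0, ∀ᶠ n in atTop, ∀ t, dist (Jn n (φ n t)) (J (ψ n t)) < ε

lemma exists_arcConv {Jn : ℕ → C(unitInterval, ℂ)} {J : C(unitInterval, ℂ)}
    (h : Tendsto (fun n => curveDist (Jn n) J) atTop (𝓝 0)) : ∃ φ ψ, ArcConv Jn J φ ψ := by
  have key : ∀ n, ∃ φ ψ : unitInterval → unitInterval, IsReparam φ ∧ IsReparam ψ ∧
      ∀ t, dist (Jn n (φ t)) (J (ψ t)) < curveDist (Jn n) J + 1 / (n + 1) := by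
    intro n
    have hne : { r : ℝ | 0 ≤ r ∧ ∃ φ ψ : unitInterval → unitInterval,
        IsReparam φ ∧ IsReparam ψ ∧ ∀ t, dist (Jn n (φ t)) (J (ψ t)) ≤ r }.Nonempty := by
      have hid : IsReparam id := ⟨continuous_id, monotone_id, rfl, rfl⟩
      refine ⟨dist (Jn n) J, dist_nonneg, id, id, hid, hid, fun t => ContinuousMap.dist_apply_le_dist t⟩
    have hlt : curveDist (Jn n) J < curveDist (Jn n) J + 1 / (n + 1) := by
      have : (0 : ℝ) < 1 / (n + 1) := by positivity
      linarith
    obtain ⟨r, ⟨-, φ, ψ, h1, h2, h3⟩, hr⟩ := exists_lt_of_csInf_lt hne hlt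
    exact ⟨φ, ψ, h1, h2, fun t => (h3 t).trans_lt hr⟩
  choose φ ψ h1 h2 h3 using key
  refine ⟨φ, ψ, h1, h2, fun ε hε => ?_⟩
  have ht : Tendsto (fun n : ℕ => curveDist (Jn n) J + 1 / ((n : ℝ) + 1)) atTop (𝓝 (0 + 0)) :=
    h.add tendsto_one_div_add_atTop_nhds_zero_nat
  filter_upwards [ht.eventually (gt_mem_nhds (by simpa using hε))] with n hn t
  exact (h3 n t).trans hn

namespace ArcConv
variable {Jn : ℕ → C(unitInterval, ℂ)} {J : C(unitInterval, ℂ)} {φ ψ : ℕ → unitInterval → unitInterval}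

lemma avoid (h : ArcConv Jn J φ ψ) {X : Set ℂ} (hX : IsClosed X) {T : Set unitInterval} (hT : IsClosed T)
    (hd : ∀ s ∈ T, J s ∉ X) : ∀ᶠ n in atTop, ∀ t, ψ n t ∈ T → Jn n (φ n t) ∉ X := by
  obtain ⟨r, hr, hr'⟩ := Metric.exists_pos_forall_lt_edist (hT.isCompact.image J.continuous) hX
    (by rw [Set.disjoint_left]; rintro _ ⟨s, hs, rfl⟩; exact hd s hs)
  filter_upwards [h.conv r (by exact_mod_cast hr)] with n hn t ht hx
  have h1 := hr' _ ⟨_, ht, rfl⟩ _ hx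
  have h2 := hn t
  rw [edist_dist, dist_comm] at h1
  rw [← ENNReal.ofReal_coe_nnreal, ENNReal.ofReal_lt_ofReal_iff_of_nonneg (by positivity)] at h1
  linarith

lemma avoid_range (h : ArcConv Jn J φ ψ) {X : Set ℂ} (hX : IsClosed X)
    (hd : Disjoint (range J) X) : ∀ᶠ n in atTop, Disjoint (range (Jn n)) X := by
  filter_upwards [h.avoid hX isClosed_univ (fun s _ => Set.disjoint_left.1 hd (mem_range_self s))] with n hn
  rw [Set.disjoint_left]
  rintro _ ⟨s, rfl⟩
  obtain ⟨t, rfl⟩ := (h.hφ n).surj s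
  exact hn t trivial

/-- points with converging parameters converge -/
lemma tendsto (h : ArcConv Jn J φ ψ) {t : ℕ → unitInterval} {s : unitInterval}
    (ht : Tendsto (fun n => ψ n (t n)) atTop (𝓝 s)) : Tendsto (fun n => Jn n (φ n (t n))) atTop (𝓝 (J s)) := by
  have h1 : Tendsto (fun n => J (ψ n (t n))) atTop (𝓝 (J s)) := (J.continuous.tendsto s).comp ht
  refine h1.congr_dist ?_
  rw [Metric.tendsto_nhds]
  intro ε hε
  filter_upwards [h.conv ε hε] with n hn
  rw [Real.dist_0_eq_abs, abs_of_nonneg dist_nonneg, dist_comm]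
  exact hn _

end ArcConv

lemma AdmissibleDomain.jump_zero (D : AdmissibleDomain) {s1 s2 : unitInterval} (h12 : s1 ≤ s2) {B : Set ℂ}
    (hB : Convex ℝ B) {g u ω : ℂ} (hgB : g ∈ B) (huB : u ∈ B) (hωB : ω ∈ B) (hgG : g ∈ D.G)
    (hu : u ∉ closure D.G) (hω : ω ∉ closure D.G)
    (hd : Disjoint (range D.J1 ∪ range D.J2 ∪ D.J3 '' Icc 0 s1 ∪ D.J3 '' Icc s2 1) B)
    {L : ℂ → ℂ} (hL : ContinuousOn L (range D.J3))
    (hL' : ∀ z ∈ range D.J3, Complex.exp (L z) = (z - ω) / (z - u)) :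
    L (D.J3 s1) - Complex.log ((D.J3 s1 - ω) / (D.J3 s1 - u)) =
    L (D.J3 s2) - Complex.log ((D.J3 s2 - ω) / (D.J3 s2 - u)) := by
  set M := range D.J1 ∪ range D.J2 ∪ D.J3 '' Icc 0 s1 ∪ D.J3 '' Icc s2 1 with hM
  have hcl : ∀ u v : unitInterval, IsClosed (D.J3 '' Icc u v) := fun u v =>
    (isCompact_Icc.image D.J3.continuous).isClosed
  have hMc : IsClosed M := (((isCompact_range D.J1.continuous).isClosed.union
    (isCompact_range D.J2.continuous).isClosed).union (hcl _ _)).union (hcl _ _)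
  have hMB : M ⊆ Bᶜ := Set.subset_compl_iff_disjoint_right.2 hd
  have hGK := disj_frontier D.isOpen
  have ne : ∀ w, w ∉ frontier D.G → ∀ z ∈ range D.J3, z - w ≠ 0 := fun w hw z hz h =>
    hw (sub_eq_zero.1 h ▸ D.r3 hz)
  have hgK : g ∉ frontier D.G := Set.disjoint_left.1 hGK hgG
  have huK : u ∉ frontier D.G := fun h => hu h.1
  obtain ⟨Lg, hLg, hLg'⟩ := hasLog_arc D.J3 D.inj3 (fun z => (z - g) / (z - u))
    (ContinuousOn.div (by fun_prop) (by fun_prop) (ne u huK))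
    (fun z hz => div_ne_zero (ne g hgK z hz) (ne u huK z hz))
  obtain ⟨lg, lg'⟩ := offball_log hB hgB huB
  obtain ⟨l, l'⟩ := offball_log hB hωB huB
  have m1 : D.J3 s1 ∈ M := Or.inl (Or.inr ⟨s1, ⟨s1.2.1, le_rfl⟩, rfl⟩)
  have m2 : D.J3 s2 ∈ M := Or.inr ⟨s2, ⟨le_rfl, s2.2.2⟩, rfl⟩
  have ex : ∀ (L l f : ℂ → ℂ), (∀ z ∈ range D.J3, Complex.exp (L z) = f z) → (∀ z ∈ Bᶜ, Complex.exp (l z) = f z) →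
      ∀ z ∈ range D.J3, z ∈ M → ∃ n : ℤ, L z - l z = n * (2 * Real.pi * Complex.I) := by
    intro L l f h1 h2 z hz hzM
    have : Complex.exp (L z) = Complex.exp (l z) := by rw [h1 z hz, h2 z (hMB hzM)]
    obtain ⟨n, hn⟩ := Complex.exp_eq_exp_iff_exists_int.1 this
    exact ⟨n, by rw [hn]; ring⟩
  obtain ⟨a1, ha1⟩ := ex L _ _ hL' l' _ (mem_range_self s1) m1
  obtain ⟨a2, ha2⟩ := ex L _ _ hL' l' _ (mem_range_self s2) m2
  obtain ⟨b1, hb1⟩ := ex Lg _ _ hLg' lg' _ (mem_range_self s1) m1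
  obtain ⟨b2, hb2⟩ := ex Lg _ _ hLg' lg' _ (mem_range_self s2) m2
  -- the combined function
  set k : ℤ := a2 - a1 with hk
  set j : ℤ := b2 - b1 with hj
  have hglue : HasLog (fun z => ((z - g) / (z - u)) ^ k * ((z - ω) / (z - u)) ^ (-j)) (D.J3 '' Icc s1 s2 ∪ M) := by
    refine hasLog_glue (hcl _ _) hMc (L := fun z => k * Lg z + ((-j : ℤ) : ℂ) * L z)
      (l := fun z => k * Complex.log ((z - g) / (z - u)) + ((-j : ℤ) : ℂ) * Complex.log ((z - ω) / (z - u)))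
      (c := ((k * b1 - j * a1 : ℤ) : ℂ) * (2 * Real.pi * Complex.I)) ?_ ?_ ?_ ?_ ?_ ?_
    · have h1 := hLg.mono (image_subset_range D.J3 (Icc s1 s2))
      have h2 := hL.mono (image_subset_range D.J3 (Icc s1 s2))
      fun_prop
    · intro z hz
      have hz := image_subset_range _ _ hz
      rw [Complex.exp_add, Complex.exp_int_mul, Complex.exp_int_mul, hL' z hz, hLg' z hz]
    · exact (continuousOn_const.mul (lg.mono hMB)).add (continuousOn_const.mul (l.mono hMB))
    · intro z hz
      rw [Complex.exp_add, Complex.exp_int_mul, Complex.exp_int_mul, l' z (hMB hz), lg' z (hMB hz)]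
    · exact Complex.exp_int_mul_two_pi_mul_I _
    · rintro z ⟨s, hs, rfl⟩ hz
      have : s = s1 ∨ s = s2 := by
        rcases hz with ((⟨t, h⟩ | ⟨t, h⟩) | ⟨t, ht, h⟩) | ⟨t, ht, h⟩
        · have := (D.meet1 h).2
          right; exact le_antisymm hs.2 (by rw [this]; exact s2.2.2)
        · have := (D.meet2 h).2
          left; exact le_antisymm (by rw [this]; exact s1.2.1) hs.1
        · rw [D.inj3 h] at ht; left; exact le_antisymm ht.2 hs.1
        · rw [D.inj3 h] at ht; right; exact le_antisymm hs.2 ht.1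
      rcases this with rfl | rfl
      · push_cast
        linear_combination (k : ℂ) * hb1 - (j : ℂ) * ha1
      · have hk' : (k : ℂ) = a2 - a1 := by rw [hk]; push_cast; ring
        have hj' : (j : ℂ) = b2 - b1 := by rw [hj]; push_cast; ring
        push_cast
        rw [hk', hj']
        linear_combination ((a2 : ℂ) - a1) * hb2 - ((b2 : ℂ) - b1) * ha2
  have hk0 : k = 0 := by
    have nu : ∀ w, w ∉ closure D.G → ∀ z ∈ closure D.G, z - w ≠ 0 := fun w hw z hz h => hw (sub_eq_zero.1 h ▸ hz)
    have hfrM : frontier D.G ⊆ D.J3 '' Icc s1 s2 ∪ M := by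
      rw [← D.boundary]
      rintro z ((h | h) | ⟨t, rfl⟩)
      · exact Or.inr (Or.inl (Or.inl (Or.inl h)))
      · exact Or.inr (Or.inl (Or.inl (Or.inr h)))
      · rcases le_total t s1 with h | h
        · exact Or.inr (Or.inl (Or.inr ⟨t, ⟨t.2.1, h⟩, rfl⟩))
        · rcases le_total t s2 with h' | h'
          · exact Or.inl ⟨t, ⟨h, h'⟩, rfl⟩
          · exact Or.inr (Or.inr ⟨t, ⟨h', t.2.2⟩, rfl⟩)
    refine eilenberg D.bounded ((hcl s1 s2).union hMc) hfrM D.isOpen hgG k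
      (fun z => (z - u) ^ (-k) * ((z - ω) / (z - u)) ^ (-j)) ?_ ?_ ?_
    · apply ContinuousOn.mul
      · exact ContinuousOn.zpow₀ (by fun_prop) _ (fun z hz => Or.inl (nu u hu z hz))
      · exact ContinuousOn.zpow₀ (ContinuousOn.div (by fun_prop) (by fun_prop) (nu u hu)) _
          (fun z hz => Or.inl (div_ne_zero (nu ω hω z hz) (nu u hu z hz)))
    · intro z hz
      exact mul_ne_zero (zpow_ne_zero _ (nu u hu z hz)) (zpow_ne_zero _ (div_ne_zero (nu ω hω z hz) (nu u hu z hz)))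
    · refine hglue.congr fun z hz => ?_
      rw [div_zpow, zpow_neg (z - u) k, div_eq_mul_inv]; ring
  rw [ha1, ha2]
  have : a2 = a1 := by linarith [hk0, hk]
  rw [this]

lemma AdmissibleDomain.jump_ne (D : AdmissibleDomain) {s1 s2 : unitInterval} (h12 : s1 ≤ s2) {B : Set ℂ}
    (hB : Convex ℝ B) {u ω : ℂ} (huB : u ∈ B) (hωB : ω ∈ B) (hω : ω ∈ D.G)
    (hu : u ∉ closure D.G)
    (hd : Disjoint (range D.J1 ∪ range D.J2 ∪ D.J3 '' Icc 0 s1 ∪ D.J3 '' Icc s2 1) B)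
    {L : ℂ → ℂ} (hL : ContinuousOn L (range D.J3))
    (hL' : ∀ z ∈ range D.J3, Complex.exp (L z) = (z - ω) / (z - u)) :
    L (D.J3 s1) - Complex.log ((D.J3 s1 - ω) / (D.J3 s1 - u)) ≠
    L (D.J3 s2) - Complex.log ((D.J3 s2 - ω) / (D.J3 s2 - u)) := by
  intro heq
  set M := range D.J1 ∪ range D.J2 ∪ D.J3 '' Icc 0 s1 ∪ D.J3 '' Icc s2 1 with hM
  have hcl : ∀ u v : unitInterval, IsClosed (D.J3 '' Icc u v) := fun u v =>
    (isCompact_Icc.image D.J3.continuous).isClosed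
  have hMc : IsClosed M := (((isCompact_range D.J1.continuous).isClosed.union
    (isCompact_range D.J2.continuous).isClosed).union (hcl _ _)).union (hcl _ _)
  have hMB : M ⊆ Bᶜ := Set.subset_compl_iff_disjoint_right.2 hd
  obtain ⟨l, l'⟩ := offball_log hB hωB huB
  have m1 : D.J3 s1 ∈ M := Or.inl (Or.inr ⟨s1, ⟨s1.2.1, le_rfl⟩, rfl⟩)
  have hglue : HasLog (fun z => ((z - ω) / (z - u))) (D.J3 '' Icc s1 s2 ∪ M) := by
    refine hasLog_glue (hcl _ _) hMc (L := L) (l := fun z => Complex.log ((z - ω) / (z - u)))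
      (c := L (D.J3 s1) - Complex.log ((D.J3 s1 - ω) / (D.J3 s1 - u))) (hL.mono (image_subset_range _ _))
      (fun z hz => hL' z (image_subset_range _ _ hz)) (l.mono hMB) (fun z hz => l' z (hMB hz)) ?_ ?_
    · rw [Complex.exp_sub, hL' _ (mem_range_self s1), l' _ (hMB m1), div_self]
      exact Complex.slitPlane_ne_zero (quot_mem_slit hB hωB huB (hMB m1))
    · rintro z ⟨s, hs, rfl⟩ hz
      have : s = s1 ∨ s = s2 := by
        rcases hz with ((⟨t, h⟩ | ⟨t, h⟩) | ⟨t, ht, h⟩) | ⟨t, ht, h⟩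
        · have := (D.meet1 h).2
          right; exact le_antisymm hs.2 (by rw [this]; exact s2.2.2)
        · have := (D.meet2 h).2
          left; exact le_antisymm (by rw [this]; exact s1.2.1) hs.1
        · rw [D.inj3 h] at ht; left; exact le_antisymm ht.2 hs.1
        · rw [D.inj3 h] at ht; right; exact le_antisymm hs.2 ht.1
      rcases this with rfl | rfl
      · ring
      · rw [heq]; ring
  refine D.no_log hω hu (hglue.mono ?_)
  rw [← D.boundary]
  rintro z ((h | h) | ⟨t, rfl⟩)
  · exact Or.inr (Or.inl (Or.inl (Or.inl h)))
  · exact Or.inr (Or.inl (Or.inl (Or.inr h)))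
  · rcases le_total t s1 with h | h
    · exact Or.inr (Or.inl (Or.inr ⟨t, ⟨t.2.1, h⟩, rfl⟩))
    · rcases le_total t s2 with h' | h'
      · exact Or.inl ⟨t, ⟨h, h'⟩, rfl⟩
      · exact Or.inr (Or.inr ⟨t, ⟨h', t.2.2⟩, rfl⟩)

/-- parametrized convergence of admissible domains -/
structure CData (Dn : ℕ → AdmissibleDomain) (D : AdmissibleDomain) where
  φ1 : ℕ → unitInterval → unitInterval
  ψ1 : ℕ → unitInterval → unitInterval
  φ2 : ℕ → unitInterval → unitInterval
  ψ2 : ℕ → unitInterval → unitInterval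
  φ3 : ℕ → unitInterval → unitInterval
  ψ3 : ℕ → unitInterval → unitInterval
  c1 : ArcConv (fun n => (Dn n).J1) D.J1 φ1 ψ1
  c2 : ArcConv (fun n => (Dn n).J2) D.J2 φ2 ψ2
  c3 : ArcConv (fun n => (Dn n).J3) D.J3 φ3 ψ3

lemma AdmConverges.cdata {Dn : ℕ → AdmissibleDomain} {D : AdmissibleDomain} (h : AdmConverges Dn D) :
    Nonempty (CData Dn D) := by
  obtain ⟨h1, h2, h3, -⟩ := h
  obtain ⟨φ1, ψ1, k1⟩ := exists_arcConv h1
  obtain ⟨φ2, ψ2, k2⟩ := exists_arcConv h2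
  obtain ⟨φ3, ψ3, k3⟩ := exists_arcConv h3
  exact ⟨⟨φ1, ψ1, φ2, ψ2, φ3, ψ3, k1, k2, k3⟩⟩

namespace CData
variable {Dn : ℕ → AdmissibleDomain} {D : AdmissibleDomain}

lemma avoid_frontier (h : CData Dn D) {X : Set ℂ} (hX : IsClosed X) (hd : Disjoint (frontier D.G) X) :
    ∀ᶠ n in atTop, Disjoint (frontier (Dn n).G) X := by
  filter_upwards [h.c1.avoid_range hX (hd.mono_left D.r1), h.c2.avoid_range hX (hd.mono_left D.r2),
    h.c3.avoid_range hX (hd.mono_left D.r3)] with n h1 h2 h3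
  rw [← (Dn n).boundary]
  exact (h1.union_left h2).union_left h3

lemma eventually_mem_aux (h : CData Dn D) : ∃ ω ∈ D.G, ∀ᶠ n in atTop, ω ∈ (Dn n).G := by
  obtain ⟨v1, h01, hv11⟩ := exists_between (zero_lt_one (α := unitInterval))
  obtain ⟨v0, hv10, hv01⟩ := exists_between hv11
  obtain ⟨v2, hv02, hv21⟩ := exists_between hv01
  have hcl : ∀ u v : unitInterval, IsClosed (D.J3 '' Icc u v) := fun u v =>
    (isCompact_Icc.image D.J3.continuous).isClosed
  set M := range D.J1 ∪ range D.J2 ∪ D.J3 '' Icc 0 v1 ∪ D.J3 '' Icc v2 1 with hM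
  have hMc : IsClosed M := (((isCompact_range D.J1.continuous).isClosed.union
    (isCompact_range D.J2.continuous).isClosed).union (hcl _ _)).union (hcl _ _)
  have hp : D.J3 v0 ∉ M := by
    rintro (((⟨t, ht⟩ | ⟨t, ht⟩) | ⟨t, ht, hh⟩) | ⟨t, ht, hh⟩)
    · exact hv01.ne (D.meet1 ht).2
    · exact (h01.trans hv10).ne (D.meet2 ht).2.symm
    · rw [D.inj3 hh] at ht; exact absurd ht.2 (not_le.2 hv10)
    · rw [D.inj3 hh] at ht; exact absurd ht.1 (not_le.2 hv02)
  set p := D.J3 v0 with hpdef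
  obtain ⟨ρ', hρ', hρd'⟩ := exists_ball_disjoint hMc hp
  obtain ⟨ρ, hρ, hρρ'⟩ := exists_between hρ'
  have hcd : Disjoint (Metric.closedBall p ρ) M := hρd'.mono_left (Metric.closedBall_subset_ball hρρ')
  set B := Metric.ball p ρ with hB
  have hBC : B ⊆ Metric.closedBall p ρ := Metric.ball_subset_closedBall
  have hBconv : Convex ℝ B := convex_ball _ _
  obtain ⟨γ, hγc, hγ0, hγt, hγf⟩ := D.toInfinity _ (mem_range_self v0)
  obtain ⟨t', ht'0, huB⟩ : ∃ t > 0, γ t ∈ B := by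
    have h1 : ∀ᶠ t in 𝓝[>] (0 : ℝ), γ t ∈ B :=
      (hγc.tendsto 0).mono_left nhdsWithin_le_nhds (by rw [hγ0]; exact Metric.ball_mem_nhds _ hρ)
    obtain ⟨t, ht, ht'⟩ := (h1.and self_mem_nhdsWithin).exists
    exact ⟨t, ht', ht⟩
  set u := γ t' with hu
  have huG : u ∉ closure D.G := D.ray_notMem hγc hγt (fun t ht => hγf t (ht'0.trans_le ht))
  obtain ⟨R, hR⟩ : ∃ R, ∀ z ∈ frontier D.G, ‖z‖ ≤ R := D.isCompact_frontier.isBounded.exists_norm_le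
  obtain ⟨T, hT⟩ := (hγt.eventually_ge_atTop (R + 1)).exists_forall_of_atTop
  have huGn : ∀ᶠ n in atTop, u ∉ closure (Dn n).G := by
    have hXc : IsClosed (γ '' Icc t' T ∪ {z : ℂ | R + 1 ≤ ‖z‖}) :=
      (isCompact_Icc.image hγc).isClosed.union (isClosed_le continuous_const continuous_norm)
    filter_upwards [h.avoid_frontier hXc (by
      rw [Set.disjoint_left]
      rintro z hz (⟨t, ht, rfl⟩ | h')
      · exact hγf t (ht'0.trans_le ht.1) hz
      · have h'' : R + 1 ≤ ‖z‖ := h'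
        linarith [hR z hz])] with n hn
    refine (Dn n).ray_notMem hγc hγt (fun t ht hf => Set.disjoint_left.1 hn hf ?_)
    rcases le_total t T with h' | h'
    · exact Or.inl ⟨t, ⟨ht, h'⟩, rfl⟩
    · exact Or.inr (hT t h')
  obtain ⟨ω, hωB, hωG⟩ := mem_closure_iff.1 (D.r3 (mem_range_self v0)).1 _ Metric.isOpen_ball
    (Metric.mem_ball_self hρ)
  refine ⟨ω, hωG, ?_⟩
  by_contra hcon
  rw [not_eventually] at hcon
  have hωK : ω ∉ frontier D.G := Set.disjoint_left.1 (disj_frontier D.isOpen) hωG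
  have huK : u ∉ frontier D.G := fun h => huG h.1
  have hωKn : ∀ᶠ n in atTop, ω ∉ frontier (Dn n).G := by
    filter_upwards [h.avoid_frontier (isClosed_singleton (x := ω)) (by simpa using hωK)] with n hn
    simpa using hn
  -- log on a neighbourhood of J3
  obtain ⟨O, hOo, hJO, hO, L, hLc, hL⟩ := log_extend (h := fun z => (z - ω) / (z - u)) (A := range D.J3)
    (O := {ω, u}ᶜ) (isCompact_range D.J3.continuous).isClosed (by
      exact ((Set.finite_singleton u).insert ω).isClosed.isOpen_compl) (by
      rintro z hz hz'
      rcases hz' with rfl | hz'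
      · exact hωK (D.r3 hz)
      · rw [mem_singleton_iff.1 hz'] at hz; exact huK (D.r3 hz))
    (by
      apply ContinuousOn.div (by fun_prop) (by fun_prop)
      intro z hz hh
      exact hz (Or.inr (sub_eq_zero.1 hh)))
    (by
      intro z hz
      refine div_ne_zero (fun hh => hz (Or.inl (sub_eq_zero.1 hh))) (fun hh => hz (Or.inr (sub_eq_zero.1 hh))))
    (by
      apply hasLog_arc D.J3 D.inj3
      · apply ContinuousOn.div (by fun_prop) (by fun_prop)
        intro z hz hh
        rw [sub_eq_zero.1 hh] at hz; exact huK (D.r3 hz)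
      · intro z hz
        refine div_ne_zero (fun hh => ?_) (fun hh => ?_)
        · rw [sub_eq_zero.1 hh] at hz; exact hωK (D.r3 hz)
        · rw [sub_eq_zero.1 hh] at hz; exact huK (D.r3 hz))
  have hJnO : ∀ᶠ n in atTop, range (Dn n).J3 ⊆ O := by
    filter_upwards [h.c3.avoid_range hOo.isClosed_compl (Set.disjoint_compl_right_iff_subset.2 hJO)] with n hn
    exact Set.disjoint_compl_right_iff_subset.1 hn
  choose τ1 hτ1 using fun n => (h.c3.hψ n).surj v1
  choose τ2 hτ2 using fun n => (h.c3.hψ n).surj v2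
  choose τ0 hτ0 using fun n => (h.c3.hψ n).surj v0
  have e1 := h.c3.tendsto (t := τ1) (s := v1) (by simp only [hτ1]; exact tendsto_const_nhds)
  have e2 := h.c3.tendsto (t := τ2) (s := v2) (by simp only [hτ2]; exact tendsto_const_nhds)
  have e0 := h.c3.tendsto (t := τ0) (s := v0) (by simp only [hτ0]; exact tendsto_const_nhds)
  have hMB : ∀ z ∈ M, z ∉ B := fun z hz hzB => Set.disjoint_left.1 hcd (hBC hzB) hz
  have m1 : D.J3 v1 ∈ M := Or.inl (Or.inr ⟨v1, ⟨v1.2.1, le_rfl⟩, rfl⟩)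
  have m2 : D.J3 v2 ∈ M := Or.inr ⟨v2, ⟨le_rfl, v2.2.2⟩, rfl⟩
  let F : ℂ → ℂ := fun z => L z - Complex.log ((z - ω) / (z - u))
  have hFc : ∀ z ∈ O, z ∉ B → ContinuousAt F z := by
    intro z hz hzB
    apply ContinuousAt.sub (hLc.continuousAt (hOo.mem_nhds hz))
    apply ContinuousAt.clog
    · apply ContinuousAt.div (by fun_prop) (by fun_prop)
      intro hh; rw [sub_eq_zero.1 hh] at hzB; exact hzB huB
    · exact quot_mem_slit hBconv hωB huB hzB
  have f1 := (hFc _ (hJO (mem_range_self v1)) (hMB _ m1)).tendsto.comp e1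
  have f2 := (hFc _ (hJO (mem_range_self v2)) (hMB _ m2)).tendsto.comp e2
  have hne : F (D.J3 v1) - F (D.J3 v2) ≠ 0 := sub_ne_zero.2 <|
    D.jump_ne (hv10.trans hv02).le hBconv huB hωB hωG huG
      (hcd.symm.mono_right hBC) (hLc.mono hJO) (fun z hz => hL z (hJO hz))
  have hev := (f1.sub f2).eventually_ne hne
  have a1 := h.c1.avoid (Metric.isClosed_closedBall (x := p) (ε := ρ)) isClosed_univ
    (fun s _ hs => Set.disjoint_left.1 hcd hs (Or.inl (Or.inl (Or.inl (mem_range_self s)))))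
  have a2 := h.c2.avoid (Metric.isClosed_closedBall (x := p) (ε := ρ)) isClosed_univ
    (fun s _ hs => Set.disjoint_left.1 hcd hs (Or.inl (Or.inl (Or.inr (mem_range_self s)))))
  have a3 := h.c3.avoid (Metric.isClosed_closedBall (x := p) (ε := ρ)) (isClosed_Iic (a := v1))
    (fun s hs' hs => Set.disjoint_left.1 hcd hs (Or.inl (Or.inr ⟨s, ⟨s.2.1, hs'⟩, rfl⟩)))
  have a4 := h.c3.avoid (Metric.isClosed_closedBall (x := p) (ε := ρ)) (isClosed_Ici (a := v2))
    (fun s hs' hs => Set.disjoint_left.1 hcd hs (Or.inr ⟨s, ⟨hs', s.2.2⟩, rfl⟩))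
  have e0B := e0.eventually (Metric.ball_mem_nhds _ hρ)
  obtain ⟨n, hn, hev, a1, a2, a3, a4, hO, hωKn, huGn, e0B⟩ := (hcon.and_eventually (hev.and (a1.and (a2.and (a3.and (a4.and
    (hJnO.and (hωKn.and (huGn.and e0B))))))))).exists
  have hωcl : ω ∉ closure (Dn n).G := fun hh => hωKn ⟨hh, by rwa [(Dn n).isOpen.interior_eq]⟩
  obtain ⟨g, hgB, hgG⟩ := mem_closure_iff.1 ((Dn n).r3 (mem_range_self (h.φ3 n (τ0 n)))).1 _ Metric.isOpen_ball e0B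
  have hτ : τ1 n ≤ τ2 n := by
    by_contra hh
    have := (h.c3.hψ n).2.1 (not_le.1 hh).le
    rw [hτ1, hτ2] at this
    exact absurd this (not_le.2 (hv10.trans hv02))
  refine hev (sub_eq_zero.2 ?_)
  refine (Dn n).jump_zero ((h.c3.hφ n).2.1 hτ) hBconv hgB huB hωB hgG huGn hωcl ?_ (hLc.mono hO) (fun z hz => hL z (hO hz))
  rw [Set.disjoint_left]
  rintro z (((⟨s, rfl⟩ | ⟨s, rfl⟩) | ⟨s, hs, rfl⟩) | ⟨s, hs, rfl⟩) hzB
  · obtain ⟨t, rfl⟩ := (h.c1.hφ n).surj s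
    exact a1 t trivial (hBC hzB)
  · obtain ⟨t, rfl⟩ := (h.c2.hφ n).surj s
    exact a2 t trivial (hBC hzB)
  · obtain ⟨t, ht, rfl⟩ := (h.c3.hφ n).surj_le hs.2
    have := (h.c3.hψ n).2.1 ht
    rw [hτ1] at this
    exact a3 t this (hBC hzB)
  · obtain ⟨t, ht, rfl⟩ := (h.c3.hφ n).surj_ge hs.1
    have := (h.c3.hψ n).2.1 ht
    rw [hτ2] at this
    exact a4 t this (hBC hzB)

lemma exists_conn (D : AdmissibleDomain) {w1 w2 : ℂ} (h1 : w1 ∈ D.G) (h2 : w2 ∈ D.G) :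
    ∃ P ⊆ D.G, IsCompact P ∧ IsPreconnected P ∧ w1 ∈ P ∧ w2 ∈ P := by
  have hpc : IsPathConnected D.G := D.isOpen.isConnected_iff_isPathConnected.1 D.connected
  obtain ⟨γ, hγ⟩ := hpc.joinedIn w1 h1 w2 h2
  refine ⟨range γ, ?_, isCompact_range γ.continuous, isPreconnected_range γ.continuous, ⟨0, γ.source⟩, ⟨1, γ.target⟩⟩
  rintro _ ⟨t, rfl⟩; exact hγ t

lemma eventually_mem (h : CData Dn D) {ω : ℂ} (hω : ω ∈ D.G) : ∀ᶠ n in atTop, ω ∈ (Dn n).G := by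
  obtain ⟨ω0, hω0, hev⟩ := h.eventually_mem_aux
  obtain ⟨P, hPG, hPc, hPp, h0, h1⟩ := exists_conn D hω0 hω
  filter_upwards [hev, h.avoid_frontier hPc.isClosed ((disj_frontier D.isOpen).symm.mono_right hPG)] with n hn hd
  exact preconn_subset_of_frontier hPp (Dn n).isOpen hd.symm ⟨ω0, h0, hn⟩ h1

end CData

/-- reparametrized arcs -/
noncomputable def cmpArc (Jn : ℕ → C(unitInterval, ℂ)) (φ : ℕ → unitInterval → unitInterval) (n : ℕ) (τ : unitInterval) : ℂ :=
  Jn n (φ n τ)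

/-- `A n` stays away from `q` along `U`. -/
def Av (U : Filter ℕ) (A : ℕ → Set ℂ) (q : ℂ) : Prop :=
  ∃ ρ > 0, ∀ᶠ n in U, Disjoint (A n) (Metric.ball q ρ)

lemma Av.union {U : Filter ℕ} {A B : ℕ → Set ℂ} {q : ℂ} (hA : Av U A q) (hB : Av U B q) :
    Av U (fun n => A n ∪ B n) q := by
  obtain ⟨r, hr, h1⟩ := hA
  obtain ⟨r', hr', h2⟩ := hB
  refine ⟨min r r', lt_min hr hr', ?_⟩
  filter_upwards [h1, h2] with n h1 h2
  exact (h1.mono_right (Metric.ball_subset_ball (min_le_left _ _))).union_left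
    (h2.mono_right (Metric.ball_subset_ball (min_le_right _ _)))

namespace ArcConv
variable {Jn : ℕ → C(unitInterval, ℂ)} {J : C(unitInterval, ℂ)} {φ ψ : ℕ → unitInterval → unitInterval}

lemma cmp_cont (h : ArcConv Jn J φ ψ) (n : ℕ) : Continuous (cmpArc Jn φ n) :=
  (Jn n).continuous.comp (h.hφ n).1

lemma tendsto' (h : ArcConv Jn J φ ψ) {U : Filter ℕ} (hU : U ≤ atTop) {t : ℕ → unitInterval} {s : unitInterval}
    (ht : Tendsto (fun n => ψ n (t n)) U (𝓝 s)) : Tendsto (fun n => cmpArc Jn φ n (t n)) U (𝓝 (J s)) := by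
  have h1 : Tendsto (fun n => J (ψ n (t n))) U (𝓝 (J s)) := (J.continuous.tendsto s).comp ht
  refine h1.congr_dist ?_
  rw [Metric.tendsto_nhds]
  intro ε hε
  filter_upwards [hU (h.conv ε hε)] with n hn
  rw [Real.dist_0_eq_abs, abs_of_nonneg dist_nonneg, dist_comm]
  exact hn _

lemma small (h : ArcConv Jn J φ ψ) {U : Filter ℕ} (hU : U ≤ atTop) {t t' : ℕ → unitInterval} {s : unitInterval}
    (ht : Tendsto (fun n => ψ n (t n)) U (𝓝 s)) (ht' : Tendsto (fun n => ψ n (t' n)) U (𝓝 s)) {ε : ℝ} (hε : 0 < ε) :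
    ∀ᶠ n in U, cmpArc Jn φ n '' uIcc (t n) (t' n) ⊆ Metric.ball (J s) ε := by
  have hnb : J ⁻¹' Metric.ball (J s) (ε / 2) ∈ 𝓝 s :=
    J.continuous.continuousAt.preimage_mem_nhds (Metric.ball_mem_nhds _ (by positivity))
  have hsm := (ht.uIcc ht').eventually (eventually_smallSets_subset.2 hnb : ∀ᶠ S in (𝓝 s).smallSets, S ⊆ J ⁻¹' Metric.ball (J s) (ε / 2))
  filter_upwards [hsm, hU (h.conv (ε / 2) (by positivity))] with n hn hc
  rintro _ ⟨τ, hτ, rfl⟩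
  have h1 : ψ n τ ∈ uIcc (ψ n (t n)) (ψ n (t' n)) := by
    have := (h.hψ n).2.1.mapsTo_uIcc hτ
    exact this
  have h2 : dist (J (ψ n τ)) (J s) < ε / 2 := hn h1
  have h3 := dist_triangle (Jn n (φ n τ)) (J (ψ n τ)) (J s)
  have h4 := hc τ
  show dist (Jn n (φ n τ)) (J s) < ε
  linarith

lemma avgen (h : ArcConv Jn J φ ψ) {U : Filter ℕ} (hU : U ≤ atTop) {S : Set unitInterval} (hS : IsClosed S)
    {q : ℂ} (hq : q ∉ J '' S) {t : ℕ → unitInterval} {s : unitInterval} (hs : s ∈ S)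
    (ht : Tendsto (fun n => ψ n (t n)) U (𝓝 s)) :
    Av U (fun n => cmpArc Jn φ n '' {τ | ψ n τ ∈ S ∪ uIcc (ψ n (t n)) s}) q := by
  have hcl : IsClosed (J '' S) := (hS.isCompact.image J.continuous).isClosed
  obtain ⟨r, hr, hr'⟩ := exists_ball_disjoint hcl hq
  have hnb : J ⁻¹' (Metric.closedBall q (r / 2))ᶜ ∈ 𝓝 s := by
    refine J.continuous.continuousAt.preimage_mem_nhds (Metric.isClosed_closedBall.isOpen_compl.mem_nhds ?_)
    intro hh
    exact Set.disjoint_left.1 hr' (Metric.closedBall_subset_ball (by linarith) hh) ⟨s, hs, rfl⟩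
  have hsm := (ht.uIcc tendsto_const_nhds).eventually (eventually_smallSets_subset.2 hnb : ∀ᶠ S in (𝓝 s).smallSets, S ⊆ J ⁻¹' (Metric.closedBall q (r / 2))ᶜ)
  refine ⟨r / 4, by positivity, ?_⟩
  filter_upwards [hsm, hU (h.conv (r / 4) (by positivity))] with n hn hc
  rw [Set.disjoint_left]
  rintro _ ⟨τ, hτ, rfl⟩ hB
  have h1 : dist (Jn n (φ n τ)) q < r / 4 := hB
  have h2 := hc τ
  have h3 := dist_triangle_left (J (ψ n τ)) q (Jn n (φ n τ))
  have h4 : r / 2 < dist (J (ψ n τ)) q := by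
    rcases hτ with h' | h'
    · by_contra hcon
      have : J (ψ n τ) ∈ Metric.ball q r := Metric.mem_ball.2 (by linarith [not_lt.1 hcon])
      exact Set.disjoint_left.1 hr' this ⟨_, h', rfl⟩
    · have := hn h'
      simpa using this
  linarith

lemma avmono {U : Filter ℕ} {A B : ℕ → Set ℂ} {q : ℂ} (hA : Av U A q) (hB : ∀ n, B n ⊆ A n) : Av U B q := by
  obtain ⟨r, hr, h1⟩ := hA
  exact ⟨r, hr, h1.mono fun n hn => hn.mono_left (hB n)⟩

lemma avge (h : ArcConv Jn J φ ψ) {U : Filter ℕ} (hU : U ≤ atTop) {q : ℂ} {t : ℕ → unitInterval} {s : unitInterval}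
    (hq : ∀ τ, s ≤ τ → J τ ≠ q) (ht : Tendsto (fun n => ψ n (t n)) U (𝓝 s)) :
    Av U (fun n => cmpArc Jn φ n '' Ici (t n)) q := by
  refine avmono (h.avgen hU (isClosed_Ici (a := s)) (by rintro ⟨τ, h1, h2⟩; exact hq τ h1 h2) self_mem_Ici ht) fun n => ?_
  apply image_mono
  intro τ hτ
  have h1 : ψ n (t n) ≤ ψ n τ := (h.hψ n).2.1 hτ
  rcases le_total s (ψ n τ) with h2 | h2
  · exact Or.inl h2
  · exact Or.inr (mem_uIcc.2 (Or.inl ⟨h1, h2⟩))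

lemma avle (h : ArcConv Jn J φ ψ) {U : Filter ℕ} (hU : U ≤ atTop) {q : ℂ} {t : ℕ → unitInterval} {s : unitInterval}
    (hq : ∀ τ, τ ≤ s → J τ ≠ q) (ht : Tendsto (fun n => ψ n (t n)) U (𝓝 s)) :
    Av U (fun n => cmpArc Jn φ n '' Iic (t n)) q := by
  refine avmono (h.avgen hU (isClosed_Iic (a := s)) (by rintro ⟨τ, h1, h2⟩; exact hq τ h1 h2) self_mem_Iic ht) fun n => ?_
  apply image_mono
  intro τ hτ
  have h1 : ψ n τ ≤ ψ n (t n) := (h.hψ n).2.1 hτ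
  rcases le_total (ψ n τ) s with h2 | h2
  · exact Or.inl h2
  · exact Or.inr (mem_uIcc.2 (Or.inr ⟨h2, h1⟩))

lemma avall (h : ArcConv Jn J φ ψ) {U : Filter ℕ} (hU : U ≤ atTop) {q : ℂ} (hq : ∀ τ, J τ ≠ q) :
    Av U (fun n => range (Jn n)) q := by
  have h1 := h.avge hU (t := fun _ => 0) (s := 0) (q := q) (fun τ _ => hq τ)
    (by simp only [(h.hψ _).2.2.1]; exact tendsto_const_nhds)
  refine avmono h1 fun n => ?_
  rintro _ ⟨s, rfl⟩
  obtain ⟨τ, rfl⟩ := (h.hφ n).surj s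
  exact ⟨τ, τ.2.1, rfl⟩

end ArcConv

lemma exists_lim (U : Ultrafilter ℕ) (f : ℕ → unitInterval) : ∃ s, Tendsto f U (𝓝 s) := by
  obtain ⟨s, -, hs⟩ := isCompact_univ.ultrafilter_le_nhds (U.map f) (by simp)
  exact ⟨s, hs⟩

/-- Crosscut data. -/
structure CC (D : AdmissibleDomain) (x y ω : ℂ) (W C : Set ℂ) : Prop where
  o : IsOpen W
  sub : W ⊆ D.G
  fr : frontier W ⊆ frontier D.G ∪ segment ℝ x y
  om : ω ∉ W
  mx : ∀ P, IsPreconnected P → Disjoint P (frontier D.G ∪ segment ℝ x y) → (P ∩ W).Nonempty → P ⊆ W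
  cc : IsCompact C
  cp : IsPreconnected C
  cs : C ⊆ closure W ∩ frontier D.G
  xm : x ∈ C
  ym : y ∈ C

namespace CData
variable {Dn : ℕ → AdmissibleDomain} {D : AdmissibleDomain}

lemma lim_frontier (h : CData Dn D) {U : Filter ℕ} [NeBot U] (hU : U ≤ atTop) {q : ℕ → ℂ} {q0 : ℂ}
    (hq : ∀ᶠ n in U, q n ∈ frontier (Dn n).G) (ht : Tendsto q U (𝓝 q0)) : q0 ∈ frontier D.G := by
  by_contra hcon
  obtain ⟨r, hr, hr'⟩ := exists_ball_disjoint isClosed_frontier hcon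
  have h1 := h.avoid_frontier (Metric.isClosed_closedBall (x := q0) (ε := r / 2))
    (hr'.symm.mono_right (Metric.closedBall_subset_ball (by linarith)))
  have h2 := ht.eventually (Metric.closedBall_mem_nhds q0 (half_pos hr))
  obtain ⟨n, h1, h2, h3⟩ := ((h1.filter_mono hU).and (h2.and hq)).exists
  exact Set.disjoint_left.1 h1 h3 h2

lemma seg_near {U : Filter ℕ} {x y : ℕ → ℂ} {z : ℂ} (hx : Tendsto x U (𝓝 z)) (hy : Tendsto y U (𝓝 z)) {r : ℝ}
    (hr : 0 < r) : ∀ᶠ n in U, segment ℝ (x n) (y n) ⊆ Metric.ball z r := by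
  filter_upwards [hx.eventually (Metric.ball_mem_nhds z hr), hy.eventually (Metric.ball_mem_nhds z hr)] with n h1 h2
  exact (convex_ball z r).segment_subset h1 h2

lemma no_cluster (h : CData Dn D) {U : Filter ℕ} [NeBot U] (hU : U ≤ atTop) {x y : ℕ → ℂ} {z ω : ℂ} {W C : ℕ → Set ℂ}
    (hseg : ∀ᶠ n in U, openSegment ℝ (x n) (y n) ⊆ (Dn n).G)
    (hx : Tendsto x U (𝓝 z)) (hy : Tendsto y U (𝓝 z)) (hω : ω ∈ D.G)
    (hCC : ∀ᶠ n in U, CC (Dn n) (x n) (y n) ω (W n) (C n)) {q : ℕ → ℂ} {q0 : ℂ} (hqz : q0 ≠ z)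
    (hq : ∀ᶠ n in U, q n ∈ C n) (hqt : Tendsto q U (𝓝 q0)) {E : ℕ → Set ℂ} (hEa : Av U E q0)
    (hE : ∀ᶠ n in U, IsPreconnected (E n) ∧ E n ⊆ frontier (Dn n).G ∧ x n ∈ E n ∧ y n ∈ E n) : False := by
  obtain ⟨ρ, hρ, hEd⟩ := hEa
  have hqK : q0 ∈ frontier D.G := h.lim_frontier hU (by
    filter_upwards [hq, hCC] with n h1 h2 using (h2.cs h1).2) hqt
  have hzK : z ∈ frontier D.G := h.lim_frontier hU (by
    filter_upwards [hCC] with n h2 using (h2.cs h2.xm).2) hx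
  have hd : 0 < dist q0 z := dist_pos.2 hqz
  obtain ⟨ρ', hρ'0, hρ'⟩ : ∃ ρ' > 0, ρ' ≤ ρ ∧ ρ' ≤ dist q0 z / 2 :=
    ⟨min ρ (dist q0 z / 2), lt_min hρ (by positivity), min_le_left _ _, min_le_right _ _⟩
  obtain ⟨wq, hwB, hwG⟩ := mem_closure_iff.1 hqK.1 _ Metric.isOpen_ball (Metric.mem_ball_self hρ'0)
  obtain ⟨P, hPG, hPc, hPp, hP0, hP1⟩ := exists_conn D hω hwG
  have hPK : Disjoint (frontier D.G) P := (disj_frontier D.isOpen).symm.mono_right hPG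
  have hzP : z ∉ P := Set.disjoint_left.1 hPK hzK
  obtain ⟨r, hr, hrP⟩ := exists_ball_disjoint hPc.isClosed hzP
  obtain ⟨n, hseg, hCC, hqC, hEd, ⟨hE1, hE2, hE3, hE4⟩, hPn, hwn, s1, s2, hqn⟩ := (hseg.and (hCC.and (hq.and (hEd.and (hE.and
    (((h.avoid_frontier hPc.isClosed hPK).filter_mono hU).and (((h.eventually_mem hwG).filter_mono hU).and ((seg_near hx hy hr).and
    ((seg_near hx hy (half_pos hd)).and (hqt.eventually (Metric.ball_mem_nhds q0 hρ'0))))))))))).exists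
  have hwW : wq ∉ W n := by
    intro hw
    refine hCC.om (hCC.mx P hPp ?_ ⟨wq, hP1, hw⟩ hP0)
    exact hPn.symm.union_right (hrP.symm.mono_right s1)
  have key := crosscut_avoid (Dn n).isOpen (Dn n).connected.isPreconnected (Dn n).bounded hseg hCC.o hCC.sub hCC.fr
    (q := q0) (ρ := ρ') (by
      rw [Set.disjoint_left]
      intro v hv hv'
      have h1 : dist v z < dist q0 z / 2 := s2 hv'
      have h2 : dist v q0 < ρ' := hv
      have := dist_triangle_left q0 z v
      linarith) hwn hwB hwW hE1 hE2 (hEd.mono_right (Metric.ball_subset_ball hρ'.1)) hE3 hE4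
  obtain ⟨v, hv1, hv2⟩ := mem_closure_iff.1 (hCC.cs hqC).1 _ Metric.isOpen_ball hqn
  exact Set.disjoint_left.1 key hv2 hv1

end CData

/-- `x`, `y` are joined inside the boundary near `z`. -/
def GoodC (D : AdmissibleDomain) (x y z : ℂ) (ε : ℝ) : Prop :=
  ∃ B ⊆ frontier D.G, IsPreconnected B ∧ x ∈ B ∧ y ∈ B ∧ B ⊆ Metric.ball z ε

lemma GoodC.symm {D : AdmissibleDomain} {x y z : ℂ} {ε : ℝ} (h : GoodC D x y z ε) : GoodC D y x z ε := by
  obtain ⟨B, h1, h2, h3, h4, h5⟩ := h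
  exact ⟨B, h1, h2, h4, h3, h5⟩

namespace CData
variable {Dn : ℕ → AdmissibleDomain} {D : AdmissibleDomain}

noncomputable abbrev α1 (h : CData Dn D) := cmpArc (fun n => (Dn n).J1) h.φ1
noncomputable abbrev α2 (h : CData Dn D) := cmpArc (fun n => (Dn n).J2) h.φ2
noncomputable abbrev α3 (h : CData Dn D) := cmpArc (fun n => (Dn n).J3) h.φ3

lemma α1_sub (h : CData Dn D) (n : ℕ) (S : Set unitInterval) : h.α1 n '' S ⊆ frontier (Dn n).G := by
  rintro _ ⟨τ, -, rfl⟩; exact (Dn n).r1 (mem_range_self _)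
lemma α2_sub (h : CData Dn D) (n : ℕ) (S : Set unitInterval) : h.α2 n '' S ⊆ frontier (Dn n).G := by
  rintro _ ⟨τ, -, rfl⟩; exact (Dn n).r2 (mem_range_self _)
lemma α3_sub (h : CData Dn D) (n : ℕ) (S : Set unitInterval) : h.α3 n '' S ⊆ frontier (Dn n).G := by
  rintro _ ⟨τ, -, rfl⟩; exact (Dn n).r3 (mem_range_self _)

lemma α10 (h : CData Dn D) (n : ℕ) : h.α1 n 0 = (Dn n).d := by
  simp only [α1, cmpArc, (h.c1.hφ n).2.2.1, (Dn n).e10]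
lemma α11 (h : CData Dn D) (n : ℕ) : h.α1 n 1 = (Dn n).a := by
  simp only [α1, cmpArc, (h.c1.hφ n).2.2.2, (Dn n).e11]
lemma α20 (h : CData Dn D) (n : ℕ) : h.α2 n 0 = (Dn n).a := by
  simp only [α2, cmpArc, (h.c2.hφ n).2.2.1, (Dn n).e20]
lemma α21 (h : CData Dn D) (n : ℕ) : h.α2 n 1 = (Dn n).c := by
  simp only [α2, cmpArc, (h.c2.hφ n).2.2.2, (Dn n).e21]
lemma α30 (h : CData Dn D) (n : ℕ) : h.α3 n 0 = (Dn n).c := by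
  simp only [α3, cmpArc, (h.c3.hφ n).2.2.1, (Dn n).e30]
lemma α31 (h : CData Dn D) (n : ℕ) : h.α3 n 1 = (Dn n).d := by
  simp only [α3, cmpArc, (h.c3.hφ n).2.2.2, (Dn n).e31]

/-- the piece of the boundary through `a` -/
def EA (h : CData Dn D) (u v : ℕ → unitInterval) (n : ℕ) : Set ℂ := h.α1 n '' Ici (u n) ∪ h.α2 n '' Iic (v n)
/-- the piece of the boundary through `J3` -/
def EB (h : CData Dn D) (u v : ℕ → unitInterval) (n : ℕ) : Set ℂ :=
  (h.α1 n '' Iic (u n) ∪ range (Dn n).J3) ∪ h.α2 n '' Ici (v n)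

lemma EA_pc (h : CData Dn D) (u v : ℕ → unitInterval) (n : ℕ) : IsPreconnected (h.EA u v n) := by
  refine pc_union (isPreconnected_Ici.image _ (h.c1.cmp_cont n).continuousOn)
    (isPreconnected_Iic.image _ (h.c2.cmp_cont n).continuousOn) (Dn n).a ?_ ?_
  · exact ⟨1, (u n).2.2, h.α11 n⟩
  · exact ⟨0, (v n).2.1, h.α20 n⟩

lemma EB_pc (h : CData Dn D) (u v : ℕ → unitInterval) (n : ℕ) : IsPreconnected (h.EB u v n) := by
  refine pc_union (pc_union (isPreconnected_Iic.image _ (h.c1.cmp_cont n).continuousOn)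
    (isPreconnected_range (Dn n).J3.continuous) (Dn n).d ?_ ?_)
    (isPreconnected_Ici.image _ (h.c2.cmp_cont n).continuousOn) (Dn n).c ?_ ?_
  · exact ⟨0, (u n).2.1, h.α10 n⟩
  · exact ⟨1, (Dn n).e31⟩
  · exact Or.inr ⟨0, (Dn n).e30⟩
  · exact ⟨1, (v n).2.2, h.α21 n⟩

lemma EA_sub (h : CData Dn D) (u v : ℕ → unitInterval) (n : ℕ) : h.EA u v n ⊆ frontier (Dn n).G :=
  union_subset (h.α1_sub n _) (h.α2_sub n _)
lemma EB_sub (h : CData Dn D) (u v : ℕ → unitInterval) (n : ℕ) : h.EB u v n ⊆ frontier (Dn n).G :=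
  union_subset (union_subset (h.α1_sub n _) (Dn n).r3) (h.α2_sub n _)
lemma EA_l (h : CData Dn D) (u v : ℕ → unitInterval) (n : ℕ) : h.α1 n (u n) ∈ h.EA u v n :=
  Or.inl ⟨_, self_mem_Ici, rfl⟩
lemma EA_r (h : CData Dn D) (u v : ℕ → unitInterval) (n : ℕ) : h.α2 n (v n) ∈ h.EA u v n :=
  Or.inr ⟨_, self_mem_Iic, rfl⟩
lemma EB_l (h : CData Dn D) (u v : ℕ → unitInterval) (n : ℕ) : h.α1 n (u n) ∈ h.EB u v n :=
  Or.inl (Or.inl ⟨_, self_mem_Iic, rfl⟩)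
lemma EB_r (h : CData Dn D) (u v : ℕ → unitInterval) (n : ℕ) : h.α2 n (v n) ∈ h.EB u v n :=
  Or.inr ⟨_, self_mem_Ici, rfl⟩

lemma EA_av (h : CData Dn D) {U : Filter ℕ} (hU : U ≤ atTop) {u v : ℕ → unitInterval} {s t : unitInterval} {q : ℂ}
    (hu : Tendsto (fun n => h.ψ1 n (u n)) U (𝓝 s)) (hv : Tendsto (fun n => h.ψ2 n (v n)) U (𝓝 t))
    (h1 : ∀ τ, s ≤ τ → D.J1 τ ≠ q) (h2 : ∀ τ, τ ≤ t → D.J2 τ ≠ q) : Av U (h.EA u v) q :=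
  (h.c1.avge hU h1 hu).union (h.c2.avle hU h2 hv)

lemma EB_av (h : CData Dn D) {U : Filter ℕ} (hU : U ≤ atTop) {u v : ℕ → unitInterval} {s t : unitInterval} {q : ℂ}
    (hu : Tendsto (fun n => h.ψ1 n (u n)) U (𝓝 s)) (hv : Tendsto (fun n => h.ψ2 n (v n)) U (𝓝 t))
    (h1 : ∀ τ, τ ≤ s → D.J1 τ ≠ q) (h3 : ∀ τ, D.J3 τ ≠ q) (h2 : ∀ τ, t ≤ τ → D.J2 τ ≠ q) : Av U (h.EB u v) q :=
  ((h.c1.avle hU h1 hu).union (h.c3.avall hU h3)).union (h.c2.avge hU h2 hv)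

lemma exists_sep (D : AdmissibleDomain) {s sb t tb : unitInterval} (hs : D.J1 s = D.J2 t) (hb : D.J1 sb = D.J2 tb)
    (hne : s ≠ sb) : t ≠ tb ∧ ∃ r ∈ uIcc s sb, r ≠ s ∧ r ≠ sb ∧ (∀ τ ≤ min t tb, D.J2 τ ≠ D.J1 r) ∧
      ∀ τ, max t tb ≤ τ → D.J2 τ ≠ D.J1 r := by
  have htt : t ≠ tb := by
    rintro rfl
    exact hne (D.inj1 (hs.trans hb.symm))
  refine ⟨htt, ?_⟩
  have hmM : min t tb < max t tb := min_lt_max.2 htt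
  by_contra hcon
  push Not at hcon
  have hcl1 : IsClosed (D.J2 '' Iic (min t tb)) := (isClosed_Iic.isCompact.image D.J2.continuous).isClosed
  have hcl2 : IsClosed (D.J2 '' Ici (max t tb)) := (isClosed_Ici.isCompact.image D.J2.continuous).isClosed
  have hpc : IsPreconnected (D.J1 '' uIcc s sb) := isPreconnected_uIcc.image _ D.J1.continuous.continuousOn
  have key : ∀ {t' : unitInterval}, t' = t ∨ t' = tb → D.J2 t' ∈ D.J1 '' uIcc s sb := by
    rintro t' (rfl | rfl)
    · exact ⟨s, left_mem_uIcc, hs⟩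
    · exact ⟨sb, right_mem_uIcc, hb⟩
  have hmin : min t tb = t ∨ min t tb = tb := min_choice _ _
  have hmax : max t tb = t ∨ max t tb = tb := max_choice _ _
  have hcov : D.J1 '' uIcc s sb ⊆ D.J2 '' Iic (min t tb) ∪ D.J2 '' Ici (max t tb) := by
    rintro _ ⟨r, hr, rfl⟩
    by_cases h1 : r = s
    · rw [h1, hs]
      rcases le_total t tb with h' | h'
      · exact Or.inl ⟨t, by simp [h'], rfl⟩
      · exact Or.inr ⟨t, by simp [h'], rfl⟩
    by_cases h2 : r = sb
    · rw [h2, hb]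
      rcases le_total t tb with h' | h'
      · exact Or.inr ⟨tb, by simp [h'], rfl⟩
      · exact Or.inl ⟨tb, by simp [h'], rfl⟩
    by_cases h3 : ∀ τ ≤ min t tb, D.J2 τ ≠ D.J1 r
    · obtain ⟨τ, h4, h5⟩ := hcon r hr h1 h2 h3
      exact Or.inr ⟨τ, h4, h5⟩
    · push Not at h3
      obtain ⟨τ, h4, h5⟩ := h3
      exact Or.inl ⟨τ, h4, h5⟩
  obtain ⟨w, -, ⟨τ, h1, h2⟩, ⟨τ', h3, h4⟩⟩ := isPreconnected_closed_iff.1 hpc _ _ hcl1 hcl2 hcov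
    ⟨_, key hmin, ⟨_, self_mem_Iic, rfl⟩⟩ ⟨_, key hmax, ⟨_, self_mem_Ici, rfl⟩⟩
  rw [D.inj2 (h2.trans h4.symm)] at h1
  exact absurd (h3.trans h1) (not_le.2 hmM)

lemma hard (h : CData Dn D) (U : Ultrafilter ℕ) (hU : (U : Filter ℕ) ≤ atTop) {tx ty : ℕ → unitInterval}
    {s t : unitInterval} (hs : Tendsto (fun n => h.ψ1 n (tx n)) U (𝓝 s))
    (ht : Tendsto (fun n => h.ψ2 n (ty n)) U (𝓝 t)) (hst : D.J1 s = D.J2 t)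
    (hxy : ∀ᶠ n in U, h.α1 n (tx n) ≠ h.α2 n (ty n))
    (hseg : ∀ᶠ n in U, openSegment ℝ (h.α1 n (tx n)) (h.α2 n (ty n)) ⊆ (Dn n).G) {ε : ℝ} (hε : 0 < ε) :
    ∀ᶠ n in U, GoodC (Dn n) (h.α1 n (tx n)) (h.α2 n (ty n)) (D.J1 s) ε := by
  have hx := h.c1.tendsto' hU hs
  have hy := h.c2.tendsto' hU ht
  rw [← hst] at hy
  have hs0 : s ≠ 0 := by
    rintro rfl
    rw [D.e10, ← D.e31] at hst
    exact absurd (D.meet2 hst.symm).2 one_ne_zero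
  have ht1 : t ≠ 1 := by
    rintro rfl
    rw [D.e21, ← D.e30] at hst
    exact absurd (D.meet1 hst).2 zero_ne_one
  obtain ⟨ω, hω⟩ := D.connected.nonempty
  have hzω : ω ≠ D.J1 s := by
    rintro rfl
    exact Set.disjoint_left.1 (disj_frontier D.isOpen) hω (D.r1 (mem_range_self _))
  have hCC : ∀ᶠ n in U, ∃ WC : Set ℂ × Set ℂ, CC (Dn n) (h.α1 n (tx n)) (h.α2 n (ty n)) ω WC.1 WC.2 := by
    filter_upwards [hxy, hseg, (h.eventually_mem hω).filter_mono hU,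
      seg_near hx hy (dist_pos.2 hzω)] with n h1 h2 h3 h4
    have hωs : ω ∉ segment ℝ (h.α1 n (tx n)) (h.α2 n (ty n)) := by
      intro hh
      have := h4 hh
      simp at this
    obtain ⟨W, C, k1, k2, k3, k4, k5, k6, k7, k8, k9, k10⟩ := crosscut_comp (Dn n).isOpen
      (Dn n).connected.isPreconnected (Dn n).bounded (Dn n).isPreconnected_frontier
      ((Dn n).r1 (mem_range_self _)) ((Dn n).r2 (mem_range_self _)) h1 h2 h3 hωs
    exact ⟨(W, C), ⟨k1, k2, k3, k4, k5, k6, k7, k8, k9, k10⟩⟩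
  obtain ⟨WC, hCC⟩ := hCC.choice
  -- Step A
  have stepA : ∀ᶠ n in U, Disjoint (WC n).2 (range (Dn n).J3) := by
    by_contra hcon
    rw [← Ultrafilter.eventually_not] at hcon
    have h1 : ∀ᶠ n in U, ∃ τ, h.α3 n τ ∈ (WC n).2 := by
      filter_upwards [hcon] with n hn
      obtain ⟨_, h1, ⟨r, rfl⟩⟩ := Set.not_disjoint_iff.1 hn
      obtain ⟨τ, rfl⟩ := (h.c3.hφ n).surj r
      exact ⟨τ, h1⟩
    obtain ⟨τ, hτ⟩ := h1.choice
    obtain ⟨σ, hσ⟩ := exists_lim U (fun n => h.ψ3 n (τ n))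
    have hq := h.c3.tendsto' hU hσ
    refine h.no_cluster hU hseg hx hy hω hCC ?_ hτ hq (E := h.EA tx ty) ?_ ?_
    · intro hh
      exact hs0 (D.meet1 hh.symm).1
    · refine h.EA_av hU hs ht ?_ ?_
      · intro r hr hh
        rw [(D.meet1 hh).1] at hr
        exact hs0 (le_antisymm hr s.2.1)
      · intro r hr hh
        rw [(D.meet2 hh).1] at hr
        exact ht1 (le_antisymm t.2.2 hr)
    · exact Eventually.of_forall fun n => ⟨h.EA_pc _ _ n, h.EA_sub _ _ n, h.EA_l _ _ n, h.EA_r _ _ n⟩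
  -- Step B
  have stepB : ∀ᶠ n in U, ∃ p : unitInterval × unitInterval,
      (∀ τ ∈ uIcc (tx n) p.1, h.α1 n τ ∈ (WC n).2) ∧ h.α1 n p.1 = h.α2 n p.2 := by
    filter_upwards [hCC, stepA] with n hC hA
    obtain ⟨s1, h1, ⟨r, h2⟩⟩ := arc_reach (Dn n).J1 (Dn n).inj1 hC.cc hC.cp
      (L := range (Dn n).J2) (isCompact_range (Dn n).J2.continuous).isClosed (by
        intro w hw
        have h1 := (hC.cs hw).2
        rw [← (Dn n).boundary] at h1
        rcases h1 with h1 | h1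
        · exact h1
        · exact absurd h1 (Set.disjoint_left.1 hA hw)) hC.xm ⟨_, hC.ym, mem_range_self _⟩
    obtain ⟨τ1, rfl⟩ := (h.c1.hφ n).surj s1
    obtain ⟨τ2, rfl⟩ := (h.c2.hφ n).surj r
    exact ⟨(τ1, τ2), fun τ hτ => h1 ((h.c1.hφ n).2.1.mapsTo_uIcc hτ), h2.symm⟩
  obtain ⟨p, hp⟩ := stepB.choice
  obtain ⟨sb, hsb⟩ := exists_lim U (fun n => h.ψ1 n (p n).1)
  obtain ⟨tb, htb⟩ := exists_lim U (fun n => h.ψ2 n (p n).2)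
  have hb : D.J1 sb = D.J2 tb := by
    refine tendsto_nhds_unique_of_eventuallyEq (h.c1.tendsto' hU hsb) (h.c2.tendsto' hU htb) ?_
    filter_upwards [hp] with n hn using hn.2
  by_cases hne : s = sb
  · -- Step C
    subst hne
    have : t = tb := D.inj2 (hst.symm.trans hb)
    subst this
    have g2 := h.c2.small hU htb ht hε
    rw [← hst] at g2
    filter_upwards [hp, h.c1.small hU hs hsb hε, g2] with n h1 h2 h3
    refine ⟨_, union_subset (h.α1_sub n (uIcc (tx n) (p n).1)) (h.α2_sub n (uIcc (p n).2 (ty n))), ?_,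
      Or.inl ⟨_, left_mem_uIcc, rfl⟩, Or.inr ⟨_, right_mem_uIcc, rfl⟩, union_subset h2 h3⟩
    refine pc_union (isPreconnected_uIcc.image _ (h.c1.cmp_cont n).continuousOn)
      (isPreconnected_uIcc.image _ (h.c2.cmp_cont n).continuousOn) (h.α1 n (p n).1) ⟨_, right_mem_uIcc, rfl⟩ ?_
    rw [h1.2]
    exact ⟨_, left_mem_uIcc, rfl⟩
  -- Step D
  exfalso
  obtain ⟨htt, r, hr, hrs, hrb, hlo, hhi⟩ := exists_sep D hst hb hne
  choose τ hτ using fun n => (h.c1.hψ n).surj r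
  have hq := h.c1.tendsto' hU (t := τ) (s := r) (by simp only [hτ]; exact tendsto_const_nhds)
  have hqz : D.J1 r ≠ D.J1 s := fun hh => hrs (D.inj1 hh)
  have h3 : ∀ σ, D.J3 σ ≠ D.J1 r := by
    intro σ hh
    have h0 := (D.meet1 hh.symm).1
    rw [h0] at hr hrs hrb
    rcases mem_uIcc.1 hr with ⟨h1, -⟩ | ⟨h1, -⟩
    · exact hrs (le_antisymm s.2.1 h1)
    · exact hrb (le_antisymm sb.2.1 h1)
  have hqC : ∀ᶠ n in U, h.α1 n (τ n) ∈ (WC n).2 := by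
    rcases mem_uIcc.1 hr with ⟨h1, h2⟩ | ⟨h1, h2⟩
    · filter_upwards [hp, hs.eventually (gt_mem_nhds (lt_of_le_of_ne h1 (Ne.symm hrs))),
        hsb.eventually (lt_mem_nhds (lt_of_le_of_ne h2 hrb))] with n hp e1 e2
      rw [← hτ n] at e1 e2
      exact hp.1 _ (mem_uIcc.2 (Or.inl ⟨((h.c1.hψ n).2.1.reflect_lt e1).le, ((h.c1.hψ n).2.1.reflect_lt e2).le⟩))
    · filter_upwards [hp, hsb.eventually (gt_mem_nhds (lt_of_le_of_ne h1 (Ne.symm hrb))),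
        hs.eventually (lt_mem_nhds (lt_of_le_of_ne h2 hrs))] with n hp e1 e2
      rw [← hτ n] at e1 e2
      exact hp.1 _ (mem_uIcc.2 (Or.inr ⟨((h.c1.hψ n).2.1.reflect_lt e1).le, ((h.c1.hψ n).2.1.reflect_lt e2).le⟩))
  have hgt : ∀ {v : unitInterval}, v < r → ∀ w, w ≤ v → D.J1 w ≠ D.J1 r := by
    intro v hv w hw hh
    rw [D.inj1 hh] at hw
    exact absurd hw (not_le.2 hv)
  have hlt : ∀ {v : unitInterval}, r < v → ∀ w, v ≤ w → D.J1 w ≠ D.J1 r := by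
    intro v hv w hw hh
    rw [D.inj1 hh] at hw
    exact absurd hw (not_le.2 hv)
  rcases mem_uIcc.1 hr with ⟨h1, h2⟩ | ⟨h1, h2⟩
  · have h1 := lt_of_le_of_ne h1 (Ne.symm hrs)
    have h2 := lt_of_le_of_ne h2 hrb
    rcases le_total t tb with h4 | h4
    · rw [min_eq_left h4] at hlo
      rw [max_eq_right h4] at hhi
      refine h.no_cluster hU hseg hx hy hω hCC hqz hqC hq
        (E := fun n => h.EB tx (fun n => (p n).2) n ∪ h.EA (fun n => (p n).1) ty n)
        ((h.EB_av hU hs htb (hgt h1) h3 hhi).union (h.EA_av hU hsb ht (hlt h2) hlo)) ?_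
      filter_upwards [hp] with n hp
      refine ⟨pc_union (h.EB_pc _ _ n) (h.EA_pc _ _ n) (h.α1 n (p n).1) ?_ (h.EA_l _ _ n),
        union_subset (h.EB_sub _ _ n) (h.EA_sub _ _ n), Or.inl (h.EB_l _ _ n), Or.inr (h.EA_r _ _ n)⟩
      rw [hp.2]; exact h.EB_r _ _ n
    · rw [max_eq_left h4] at hhi
      refine h.no_cluster hU hseg hx hy hω hCC hqz hqC hq (E := h.EB tx ty)
        (h.EB_av hU hs ht (hgt h1) h3 hhi) ?_
      exact Eventually.of_forall fun n => ⟨h.EB_pc _ _ n, h.EB_sub _ _ n, h.EB_l _ _ n, h.EB_r _ _ n⟩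
  · have h1 := lt_of_le_of_ne h1 (Ne.symm hrb)
    have h2 := lt_of_le_of_ne h2 hrs
    rcases le_total t tb with h4 | h4
    · rw [min_eq_left h4] at hlo
      refine h.no_cluster hU hseg hx hy hω hCC hqz hqC hq (E := h.EA tx ty)
        (h.EA_av hU hs ht (hlt h2) hlo) ?_
      exact Eventually.of_forall fun n => ⟨h.EA_pc _ _ n, h.EA_sub _ _ n, h.EA_l _ _ n, h.EA_r _ _ n⟩
    · rw [min_eq_right h4] at hlo
      rw [max_eq_left h4] at hhi
      refine h.no_cluster hU hseg hx hy hω hCC hqz hqC hq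
        (E := fun n => h.EA tx (fun n => (p n).2) n ∪ h.EB (fun n => (p n).1) ty n)
        ((h.EA_av hU hs htb (hlt h2) hlo).union (h.EB_av hU hsb ht (hgt h1) h3 hhi)) ?_
      filter_upwards [hp] with n hp
      refine ⟨pc_union (h.EA_pc _ _ n) (h.EB_pc _ _ n) (h.α1 n (p n).1) ?_ (h.EB_l _ _ n),
        union_subset (h.EA_sub _ _ n) (h.EB_sub _ _ n), Or.inl (h.EA_l _ _ n), Or.inr (h.EB_r _ _ n)⟩
      rw [hp.2]; exact h.EA_r _ _ n

end CData

lemma ArcConv.good {Dn : ℕ → AdmissibleDomain} {Jn : ℕ → C(unitInterval, ℂ)} {J : C(unitInterval, ℂ)}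
    {φ ψ : ℕ → unitInterval → unitInterval} (h : ArcConv Jn J φ ψ) (hr : ∀ n, range (Jn n) ⊆ frontier (Dn n).G)
    {U : Filter ℕ} (hU : U ≤ atTop) {t t' : ℕ → unitInterval} {s : unitInterval}
    (ht : Tendsto (fun n => ψ n (t n)) U (𝓝 s)) (ht' : Tendsto (fun n => ψ n (t' n)) U (𝓝 s)) {ε : ℝ} (hε : 0 < ε) :
    ∀ᶠ n in U, GoodC (Dn n) (cmpArc Jn φ n (t n)) (cmpArc Jn φ n (t' n)) (J s) ε := by
  filter_upwards [h.small hU ht ht' hε] with n hn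
  refine ⟨_, ?_, isPreconnected_uIcc.image _ (h.cmp_cont n).continuousOn, ⟨_, left_mem_uIcc, rfl⟩,
    ⟨_, right_mem_uIcc, rfl⟩, hn⟩
  rintro _ ⟨τ, -, rfl⟩
  exact hr n (mem_range_self _)

lemma GoodC.trans {D : AdmissibleDomain} {x y w z : ℂ} {ε : ℝ} (h : GoodC D x y z ε) (h' : GoodC D y w z ε) :
    GoodC D x w z ε := by
  obtain ⟨B, h1, h2, h3, h4, h5⟩ := h
  obtain ⟨B', h1', h2', h3', h4', h5'⟩ := h'
  exact ⟨B ∪ B', union_subset h1 h1', pc_union h2 h2' y h4 h3', Or.inl h3, Or.inr h4', union_subset h5 h5'⟩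

namespace CData
variable {Dn : ℕ → AdmissibleDomain} {D : AdmissibleDomain}

lemma pair13 (h : CData Dn D) {U : Filter ℕ} (hU : U ≤ atTop) {tx ty : ℕ → unitInterval}
    {s t : unitInterval} (hs : Tendsto (fun n => h.ψ1 n (tx n)) U (𝓝 s))
    (ht : Tendsto (fun n => h.ψ3 n (ty n)) U (𝓝 t)) (hst : D.J1 s = D.J3 t) {ε : ℝ} (hε : 0 < ε) :
    ∀ᶠ n in U, GoodC (Dn n) (h.α1 n (tx n)) (h.α3 n (ty n)) (D.J1 s) ε := by
  obtain ⟨rfl, rfl⟩ := D.meet1 hst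
  have g1 := h.c1.good (Dn := Dn) (fun n => (Dn n).r1) hU hs (t' := fun _ => 0)
    (by simp only [(h.c1.hψ _).2.2.1]; exact tendsto_const_nhds) hε
  have g2 := h.c3.good (Dn := Dn) (fun n => (Dn n).r3) hU (t := fun _ => 1)
    (by simp only [(h.c3.hψ _).2.2.2]; exact tendsto_const_nhds) ht hε
  filter_upwards [g1, g2] with n g1 g2
  rw [← hst] at g2
  have e : h.α1 n 0 = h.α3 n 1 := by rw [h.α10, h.α31]
  have g1' : GoodC (Dn n) (h.α1 n (tx n)) (h.α1 n 0) (D.J1 0) ε := g1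
  rw [e] at g1'
  exact g1'.trans g2

lemma pair23 (h : CData Dn D) {U : Filter ℕ} (hU : U ≤ atTop) {tx ty : ℕ → unitInterval}
    {s t : unitInterval} (hs : Tendsto (fun n => h.ψ2 n (tx n)) U (𝓝 s))
    (ht : Tendsto (fun n => h.ψ3 n (ty n)) U (𝓝 t)) (hst : D.J2 s = D.J3 t) {ε : ℝ} (hε : 0 < ε) :
    ∀ᶠ n in U, GoodC (Dn n) (h.α2 n (tx n)) (h.α3 n (ty n)) (D.J2 s) ε := by
  obtain ⟨rfl, rfl⟩ := D.meet2 hst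
  have g1 := h.c2.good (Dn := Dn) (fun n => (Dn n).r2) hU hs (t' := fun _ => 1)
    (by simp only [(h.c2.hψ _).2.2.2]; exact tendsto_const_nhds) hε
  have g2 := h.c3.good (Dn := Dn) (fun n => (Dn n).r3) hU (t := fun _ => 0)
    (by simp only [(h.c3.hψ _).2.2.1]; exact tendsto_const_nhds) ht hε
  filter_upwards [g1, g2] with n g1 g2
  rw [← hst] at g2
  have e : h.α2 n 1 = h.α3 n 0 := by rw [h.α21, h.α30]
  have g1' : GoodC (Dn n) (h.α2 n (tx n)) (h.α2 n 1) (D.J2 1) ε := g1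
  rw [e] at g1'
  exact g1'.trans g2

lemma split_arc {Jn : ℕ → C(unitInterval, ℂ)} {J : C(unitInterval, ℂ)} {φ ψ : ℕ → unitInterval → unitInterval}
    (h : ArcConv Jn J φ ψ) (U : Ultrafilter ℕ) (hU : (U : Filter ℕ) ≤ atTop) {x : ℕ → ℂ}
    (hx : ∀ᶠ n in U, x n ∈ range (Jn n)) : ∃ (t : ℕ → unitInterval) (s : unitInterval),
      (∀ᶠ n in U, cmpArc Jn φ n (t n) = x n) ∧ Tendsto (fun n => ψ n (t n)) U (𝓝 s) ∧ Tendsto x U (𝓝 (J s)) := by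
  have h1 : ∀ᶠ n in U, ∃ τ, cmpArc Jn φ n τ = x n := by
    filter_upwards [hx] with n ⟨r, hr⟩
    obtain ⟨τ, rfl⟩ := (h.hφ n).surj r
    exact ⟨τ, hr⟩
  obtain ⟨t, ht⟩ := h1.choice
  obtain ⟨s, hs⟩ := exists_lim U (fun n => ψ n (t n))
  exact ⟨t, s, ht, hs, (h.tendsto' hU hs).congr' ht⟩

lemma ultra (h : CData Dn D) (U : Ultrafilter ℕ) (hU : (U : Filter ℕ) ≤ atTop) {x y : ℕ → ℂ}
    (hxf : ∀ n, x n ∈ frontier (Dn n).G) (hyf : ∀ n, y n ∈ frontier (Dn n).G) (hxy : ∀ n, x n ≠ y n)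
    (hseg : ∀ n, openSegment ℝ (x n) (y n) ⊆ (Dn n).G)
    (hd : Tendsto (fun n => dist (x n) (y n)) U (𝓝 0)) {ε : ℝ} (hε : 0 < ε) :
    ∃ z, Tendsto x U (𝓝 z) ∧ ∀ᶠ n in U, GoodC (Dn n) (x n) (y n) z ε := by
  have hor : ∀ {w : ℕ → ℂ}, (∀ n, w n ∈ frontier (Dn n).G) → (∀ᶠ n in U, w n ∈ range (Dn n).J1) ∨
      (∀ᶠ n in U, w n ∈ range (Dn n).J2) ∨ (∀ᶠ n in U, w n ∈ range (Dn n).J3) := by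
    intro w hw
    rw [← Ultrafilter.eventually_or, ← Ultrafilter.eventually_or]
    refine Eventually.of_forall fun n => ?_
    have := hw n
    rw [← (Dn n).boundary] at this
    exact or_assoc.1 this
  have huniq : ∀ {p q : ℂ}, Tendsto x U (𝓝 p) → Tendsto y U (𝓝 q) → p = q := by
    intro p q hp hq
    exact eq_of_dist_eq_zero (tendsto_nhds_unique (hp.dist hq) hd)
  rcases hor hxf with h1 | h1 | h1 <;> rcases hor hyf with h2 | h2 | h2
  · obtain ⟨tx, s, e1, l1, x1⟩ := split_arc h.c1 U hU h1
    obtain ⟨ty, t, e2, l2, y1⟩ := split_arc h.c1 U hU h2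
    have hz := huniq x1 y1
    have := D.inj1 hz
    subst this
    refine ⟨_, x1, ?_⟩
    filter_upwards [e1, e2, h.c1.good (Dn := Dn) (fun n => (Dn n).r1) hU l1 l2 hε] with n e1 e2 g
    rw [← e1, ← e2]; exact g
  · obtain ⟨tx, s, e1, l1, x1⟩ := split_arc h.c1 U hU h1
    obtain ⟨ty, t, e2, l2, y1⟩ := split_arc h.c2 U hU h2
    have hz := huniq x1 y1
    refine ⟨_, x1, ?_⟩
    filter_upwards [e1, e2, h.hard U hU l1 l2 hz (by filter_upwards [e1, e2] with n e1 e2; have hh := hxy n; rw [← e1, ← e2] at hh; exact hh)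
      (by filter_upwards [e1, e2] with n e1 e2; have hh := hseg n; rw [← e1, ← e2] at hh; exact hh) hε] with n e1 e2 g
    rw [← e1, ← e2]; exact g
  · obtain ⟨tx, s, e1, l1, x1⟩ := split_arc h.c1 U hU h1
    obtain ⟨ty, t, e2, l2, y1⟩ := split_arc h.c3 U hU h2
    have hz := huniq x1 y1
    refine ⟨_, x1, ?_⟩
    filter_upwards [e1, e2, h.pair13 hU l1 l2 hz hε] with n e1 e2 g
    rw [← e1, ← e2]; exact g
  · obtain ⟨tx, s, e1, l1, x1⟩ := split_arc h.c2 U hU h1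
    obtain ⟨ty, t, e2, l2, y1⟩ := split_arc h.c1 U hU h2
    have hz := huniq x1 y1
    refine ⟨_, x1, ?_⟩
    rw [hz]
    filter_upwards [e1, e2, h.hard U hU l2 l1 hz.symm
      (by filter_upwards [e1, e2] with n e1 e2; have hh := hxy n; rw [← e1, ← e2] at hh; exact hh.symm)
      (by filter_upwards [e1, e2] with n e1 e2; rw [openSegment_symm]; have hh := hseg n; rw [← e1, ← e2] at hh; exact hh) hε] with n e1 e2 g
    rw [← e1, ← e2]; exact g.symm
  · obtain ⟨tx, s, e1, l1, x1⟩ := split_arc h.c2 U hU h1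
    obtain ⟨ty, t, e2, l2, y1⟩ := split_arc h.c2 U hU h2
    have hz := huniq x1 y1
    have := D.inj2 hz
    subst this
    refine ⟨_, x1, ?_⟩
    filter_upwards [e1, e2, h.c2.good (Dn := Dn) (fun n => (Dn n).r2) hU l1 l2 hε] with n e1 e2 g
    rw [← e1, ← e2]; exact g
  · obtain ⟨tx, s, e1, l1, x1⟩ := split_arc h.c2 U hU h1
    obtain ⟨ty, t, e2, l2, y1⟩ := split_arc h.c3 U hU h2
    have hz := huniq x1 y1
    refine ⟨_, x1, ?_⟩
    filter_upwards [e1, e2, h.pair23 hU l1 l2 hz hε] with n e1 e2 g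
    rw [← e1, ← e2]; exact g
  · obtain ⟨tx, s, e1, l1, x1⟩ := split_arc h.c3 U hU h1
    obtain ⟨ty, t, e2, l2, y1⟩ := split_arc h.c1 U hU h2
    have hz := huniq x1 y1
    refine ⟨_, x1, ?_⟩
    rw [hz]
    filter_upwards [e1, e2, h.pair13 hU l2 l1 hz.symm hε] with n e1 e2 g
    rw [← e1, ← e2]; exact g.symm
  · obtain ⟨tx, s, e1, l1, x1⟩ := split_arc h.c3 U hU h1
    obtain ⟨ty, t, e2, l2, y1⟩ := split_arc h.c2 U hU h2
    have hz := huniq x1 y1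
    refine ⟨_, x1, ?_⟩
    rw [hz]
    filter_upwards [e1, e2, h.pair23 hU l2 l1 hz.symm hε] with n e1 e2 g
    rw [← e1, ← e2]; exact g.symm
  · obtain ⟨tx, s, e1, l1, x1⟩ := split_arc h.c3 U hU h1
    obtain ⟨ty, t, e2, l2, y1⟩ := split_arc h.c3 U hU h2
    have hz := huniq x1 y1
    have := D.inj3 hz
    subst this
    refine ⟨_, x1, ?_⟩
    filter_upwards [e1, e2, h.c3.good (Dn := Dn) (fun n => (Dn n).r3) hU l1 l2 hε] with n e1 e2 g
    rw [← e1, ← e2]; exact g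

/-- pass to a subsequence -/
def sub (h : CData Dn D) (k : ℕ → ℕ) (hk : Tendsto k atTop atTop) : CData (fun n => Dn (k n)) D where
  φ1 n := h.φ1 (k n)
  ψ1 n := h.ψ1 (k n)
  φ2 n := h.φ2 (k n)
  ψ2 n := h.ψ2 (k n)
  φ3 n := h.φ3 (k n)
  ψ3 n := h.ψ3 (k n)
  c1 := ⟨fun _ => h.c1.hφ _, fun _ => h.c1.hψ _, fun ε hε => hk.eventually (h.c1.conv ε hε)⟩
  c2 := ⟨fun _ => h.c2.hφ _, fun _ => h.c2.hψ _, fun ε hε => hk.eventually (h.c2.conv ε hε)⟩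
  c3 := ⟨fun _ => h.c3.hφ _, fun _ => h.c3.hψ _, fun ε hε => hk.eventually (h.c3.conv ε hε)⟩

lemma main (h : CData Dn D) {ε : ℝ} (hε : 0 < ε) : ∃ δ > 0, ∃ N, ∀ n ≥ N, ∀ x ∈ frontier (Dn n).G,
    ∀ y ∈ frontier (Dn n).G, x ≠ y → dist x y < δ → openSegment ℝ x y ⊆ (Dn n).G → GoodC (Dn n) x y x ε := by
  by_contra hcon
  push Not at hcon
  have := fun m : ℕ => hcon (1 / (m + 1)) (by positivity) m
  choose k hk x hx y hy hxy hd hseg hbad using this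
  have hkt : Tendsto k atTop atTop := tendsto_atTop_mono hk tendsto_id
  let U : Ultrafilter ℕ := hyperfilter ℕ
  have hU : (U : Filter ℕ) ≤ atTop := Nat.hyperfilter_le_atTop
  have hd0 : Tendsto (fun n => dist (x n) (y n)) U (𝓝 0) := by
    refine Tendsto.mono_left ?_ hU
    exact squeeze_zero (fun _ => dist_nonneg) (fun n => (hd n).le) tendsto_one_div_add_atTop_nhds_zero_nat
  obtain ⟨z, hxz, hg⟩ := (h.sub k hkt).ultra U hU hx hy hxy hseg hd0 (half_pos hε)
  obtain ⟨n, B, h1, h2, h3, h4, h5⟩ := hg.exists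
  refine hbad n ⟨B, h1, h2, h3, h4, fun w hw => ?_⟩
  have e1 : dist w z < ε / 2 := h5 hw
  have e2 : dist (x n) z < ε / 2 := h5 h3
  have := dist_triangle_right w (x n) z
  rw [Metric.mem_ball]
  linarith

end CData

lemma reduce_gap (D : AdmissibleDomain) {η δ : ℝ} (hη : 0 < η)
    (hM : ∀ x ∈ frontier D.G, ∀ y ∈ frontier D.G, x ≠ y → dist x y < δ → openSegment ℝ x y ⊆ D.G → GoodC D x y x η)
    {x y : ℂ} (hx : x ∈ D.Gᶜ) (hy : y ∈ D.Gᶜ) (h1 : dist x y < δ) (h2 : dist x y < η) :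
    ∃ B : Set ℂ, B ⊆ D.Gᶜ ∧ x ∈ B ∧ y ∈ B ∧ IsCompact B ∧ IsConnected B ∧ Metric.diam B ≤ 2 * (2 * η) := by
  set M := D.Gᶜ ∩ Metric.closedBall x (2 * η) with hMdef
  have hMc : IsCompact M := (isCompact_closedBall _ _).inter_left D.isOpen.isClosed_compl
  have hxM : x ∈ M := ⟨hx, Metric.mem_closedBall_self (by positivity)⟩
  have hyM : y ∈ M := ⟨hy, by rw [Metric.mem_closedBall, dist_comm]; linarith⟩
  have hsub : connectedComponentIn M x ⊆ M := connectedComponentIn_subset _ _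
  have hyC : y ∈ connectedComponentIn M x := by
    by_contra hcon
    obtain ⟨P, Q, hP, hQ, hPQ, hU, hxP, hTQ⟩ := sep_component hMc hxM (isClosed_singleton (x := y)) (by
      rw [Set.disjoint_left]
      rintro w hw ⟨hw', -⟩
      rw [mem_singleton_iff.1 hw'] at hw
      exact hcon hw)
    have hyQ : y ∈ Q := hTQ ⟨rfl, hyM⟩
    let L : ℝ → ℂ := fun t => AffineMap.lineMap x y t
    have hL : Continuous L := AffineMap.lineMap_continuous
    have hL0 : L 0 = x := AffineMap.lineMap_apply_zero x y
    have hL1 : L 1 = y := AffineMap.lineMap_apply_one x y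
    have hLd : ∀ t ∈ Icc (0 : ℝ) 1, dist (L t) x < η := by
      intro t ht
      have h3 : dist (L t) x = ‖t‖ * dist x y := dist_lineMap_left x y t
      rw [h3, Real.norm_of_nonneg ht.1]
      nlinarith [ht.2, dist_nonneg (x := x) (y := y)]
    obtain ⟨t1, ⟨⟨ht1, ht1Q⟩, hmin⟩⟩ := (isCompact_Icc (a := (0 : ℝ)) (b := 1) |>.inter_right
      (hQ.isClosed.preimage hL)).exists_isLeast ⟨1, ⟨zero_le_one, le_rfl⟩, by rw [mem_preimage, hL1]; exact hyQ⟩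
    obtain ⟨t0, ⟨⟨ht0, ht0P⟩, hmax⟩⟩ := (isCompact_Icc (a := (0 : ℝ)) (b := t1) |>.inter_right
      (hP.isClosed.preimage hL)).exists_isGreatest ⟨0, ⟨le_rfl, ht1.1⟩, by rw [mem_preimage, hL0]; exact hxP⟩
    have hne : L t0 ≠ L t1 := by
      intro hh
      refine Set.disjoint_left.1 hPQ ht0P ?_
      rw [hh]; exact ht1Q
    have hlt : t0 < t1 := lt_of_le_of_ne ht0.2 (fun hh => hne (by rw [hh]))
    have hseg : openSegment ℝ (L t0) (L t1) ⊆ D.G := by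
      rintro w ⟨α, β, hα, hβ, hαβ, rfl⟩
      have e : α • L t0 + β • L t1 = L (α * t0 + β * t1) := by
        have : α = 1 - β := by linarith
        subst this
        simp only [L, AffineMap.lineMap_apply, vsub_eq_sub, vadd_eq_add, Complex.real_smul]
        push_cast
        ring
      rw [e]
      have k1 : t0 < α * t0 + β * t1 := by
        have : α = 1 - β := by linarith
        subst this; nlinarith
      have k2 : α * t0 + β * t1 < t1 := by
        have : β = 1 - α := by linarith
        subst this; nlinarith
      set t := α * t0 + β * t1
      by_contra hG
      have htI : t ∈ Icc (0 : ℝ) 1 := ⟨ht0.1.trans k1.le, k2.le.trans ht1.2⟩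
      have hm : L t ∈ M := ⟨hG, by rw [Metric.mem_closedBall]; linarith [hLd t htI]⟩
      rw [← hU] at hm
      rcases hm with hm | hm
      · exact absurd (hmax ⟨⟨htI.1, k2.le⟩, hm⟩) (not_le.2 k1)
      · exact absurd (hmin ⟨htI, hm⟩) (not_le.2 k2)
    have hcl : segment ℝ (L t0) (L t1) ⊆ closure D.G := by
      rw [← closure_openSegment]
      exact closure_mono hseg
    have hPM : P ⊆ M := hU ▸ subset_union_left
    have hQM : Q ⊆ M := hU ▸ subset_union_right
    have f0 : L t0 ∈ frontier D.G := ⟨hcl (left_mem_segment _ _ _), by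
      rw [D.isOpen.interior_eq]; exact (hPM ht0P).1⟩
    have f1 : L t1 ∈ frontier D.G := ⟨hcl (right_mem_segment _ _ _), by
      rw [D.isOpen.interior_eq]; exact (hQM ht1Q).1⟩
    have hdd : dist (L t0) (L t1) < δ := by
      have h3 : dist (L t0) (L t1) = dist t0 t1 * dist x y := dist_lineMap_lineMap x y t0 t1
      have h4 : dist t0 t1 ≤ 1 := by
        rw [Real.dist_eq, abs_sub_comm, abs_of_nonneg (by linarith)]
        linarith [ht1.2, ht0.1]
      rw [h3]
      nlinarith [dist_nonneg (x := x) (y := y)]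
    obtain ⟨B, b1, b2, b3, b4, b5⟩ := hM _ f0 _ f1 hne hdd hseg
    have hBM : B ⊆ P ∪ Q := by
      rw [hU]
      intro w hw
      refine ⟨fun hG => Set.disjoint_left.1 (disj_frontier D.isOpen) hG (b1 hw), ?_⟩
      have e1 : dist w (L t0) < η := b5 hw
      have e2 := hLd t0 ⟨ht0.1, ht0.2.trans ht1.2⟩
      have e3 := dist_triangle w (L t0) x
      rw [Metric.mem_closedBall]
      linarith
    obtain ⟨w, -, w1, w2⟩ := isPreconnected_closed_iff.1 b2 P Q hP.isClosed hQ.isClosed hBM ⟨_, b3, ht0P⟩ ⟨_, b4, ht1Q⟩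
    exact Set.disjoint_left.1 hPQ w1 w2
  refine ⟨connectedComponentIn M x, hsub.trans inter_subset_left, mem_connectedComponentIn hxM, hyC,
    compact_component hMc hxM, isConnected_connectedComponentIn_iff.2 hxM, ?_⟩
  exact (Metric.diam_mono (hsub.trans inter_subset_right) Metric.isBounded_closedBall).trans
    (Metric.diam_closedBall (by positivity))

lemma CData.const (D : AdmissibleDomain) : Nonempty (CData (fun _ => D) D) := by
  have hid : IsReparam id := ⟨continuous_id, monotone_id, rfl, rfl⟩
  refine ⟨⟨fun _ => id, fun _ => id, fun _ => id, fun _ => id, fun _ => id, fun _ => id, ?_, ?_, ?_⟩⟩ <;>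
  · refine ⟨fun _ => hid, fun _ => hid, fun ε hε => Eventually.of_forall fun n t => ?_⟩
    simpa using hε

lemma exists_min_pos (d : ℕ → ℝ) (hd : ∀ n, 0 < d n) (N : ℕ) : ∃ δ > 0, ∀ n < N, δ ≤ d n := by
  induction N with
  | zero => exact ⟨1, one_pos, fun n hn => absurd hn (Nat.not_lt_zero n)⟩
  | succ N ih =>
    obtain ⟨δ, h1, h2⟩ := ih
    refine ⟨min δ (d N), lt_min h1 (hd N), fun n hn => ?_⟩
    rcases Nat.lt_succ_iff_lt_or_eq.1 hn with h | rfl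
    · exact (min_le_left _ _).trans (h2 n h)
    · exact min_le_right _ _

/-- If admissible domains `(Gₙ, aₙ, cₙ, dₙ)` converge to an admissible domain
`(G, a, c, d)`, then the closed sets `ℂ ∖ Gₙ` are uniformly locally connected. -/
theorem complements_uniformly_locally_connected
    (Dn : ℕ → AdmissibleDomain) (D : AdmissibleDomain) (h : AdmConverges Dn D) :
    UnifLocallyConnected (fun n => ((Dn n).G)ᶜ) := by
  intro ε hε
  obtain ⟨C⟩ := h.cdata
  have hη : 0 < ε / 5 := by positivity
  obtain ⟨δ0, hδ0, N, hN⟩ := C.main hη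
  have hc : ∀ n, ∃ δ > 0, ∀ x ∈ frontier (Dn n).G, ∀ y ∈ frontier (Dn n).G, x ≠ y → dist x y < δ →
      openSegment ℝ x y ⊆ (Dn n).G → GoodC (Dn n) x y x (ε / 5) := by
    intro n
    obtain ⟨C'⟩ := CData.const (Dn n)
    obtain ⟨δ, hδ, N', hN'⟩ := C'.main hη
    exact ⟨δ, hδ, hN' N' le_rfl⟩
  choose d hd hd' using hc
  obtain ⟨δ1, hδ1, hm⟩ := exists_min_pos d hd N
  refine ⟨min (min δ0 δ1) (ε / 5), lt_min (lt_min hδ0 hδ1) hη, fun n x hx y hy hxy => ?_⟩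
  have k1 : dist x y < δ0 := hxy.trans_le ((min_le_left _ _).trans (min_le_left _ _))
  have k2 : dist x y < δ1 := hxy.trans_le ((min_le_left _ _).trans (min_le_right _ _))
  have k3 : dist x y < ε / 5 := hxy.trans_le (min_le_right _ _)
  have key : ∃ B : Set ℂ, B ⊆ (Dn n).Gᶜ ∧ x ∈ B ∧ y ∈ B ∧ IsCompact B ∧ IsConnected B ∧
      Metric.diam B ≤ 2 * (2 * (ε / 5)) := by
    rcases lt_or_ge n N with hn | hn
    · exact reduce_gap (Dn n) hη (hd' n) hx hy (k2.trans_le (hm n hn)) k3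
    · exact reduce_gap (Dn n) hη (hN n hn) hx hy k1 k3
  obtain ⟨B, b1, b2, b3, b4, b5, b6⟩ := key
  exact ⟨B, b1, b2, b3, b4, b5, by linarith⟩
end
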